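/- For every natural number n and every pair of conjugate elements f, g of Thompson's group F with ℓ(f) + ℓ(g) ≤ n, there exists h ∈ F with h⁻¹fh = g and ℓ(h) ≤ (7/2)n² + 15n + 20. Equivalently, the conjugator length function of F satisfies CLF(n) ≤ (7/2)n² + 15n + 20 for all n. -/

import Mathlib

noncomputable section

open Set

noncomputable section

open Set

def x0fun : ℝ → ℝ := fun t =>
  if t < 0 then t
  else if t ≤ 1/2 then t / 2
  else if t ≤ 3/4 then t - 1/4
  else if t ≤ 1 then 2 * t - 1
  else t

def x0inv : ℝ → ℝ := fun t =>
  if t < 0 then t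
  else if t ≤ 1/4 then 2 * t
  else if t ≤ 1/2 then t + 1/4
  else if t ≤ 1 then (t + 1) / 2
  else t

/-- The generator `x₀` of Thompson's group `F`, as a permutation of `ℝ`
(the identity outside `[0,1]`). -/
def x0 : Equiv.Perm ℝ where
  toFun := x0fun
  invFun := x0inv
  left_inv := by
    intro t
    show x0inv (x0fun t) = t
    unfold x0fun
    split_ifs <;> (unfold x0inv; split_ifs <;> linarith)
  right_inv := by
    intro t
    show x0fun (x0inv t) = t
    unfold x0inv
    split_ifs <;> (unfold x0fun; split_ifs <;> linarith)

def x1fun : ℝ → ℝ := fun t =>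
  if t < 0 then t
  else if t ≤ 1/2 then t
  else if t ≤ 3/4 then t / 2 + 1/4
  else if t ≤ 7/8 then t - 1/8
  else if t ≤ 1 then 2 * t - 1
  else t

def x1inv : ℝ → ℝ := fun t =>
  if t < 0 then t
  else if t ≤ 1/2 then t
  else if t ≤ 5/8 then 2 * t - 1/2
  else if t ≤ 3/4 then t + 1/8
  else if t ≤ 1 then (t + 1) / 2
  else t

set_option maxHeartbeats 2000000 in
/-- The generator `x₁` of Thompson's group `F`, as a permutation of `ℝ`
(the identity outside `[0,1]`). -/
def x1 : Equiv.Perm ℝ where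
  toFun := x1fun
  invFun := x1inv
  left_inv := by
    intro t
    show x1inv (x1fun t) = t
    unfold x1fun
    split_ifs <;> (unfold x1inv; split_ifs <;> linarith)
  right_inv := by
    intro t
    show x1fun (x1inv t) = t
    unfold x1inv
    split_ifs <;> (unfold x1fun; split_ifs <;> linarith)

/-- Thompson's group `F`: the subgroup generated by `x₀` and `x₁`. -/
def ThompsonF : Subgroup (Equiv.Perm ℝ) :=
  Subgroup.closure ({x0, x1} : Set (Equiv.Perm ℝ))

/-- Word length with respect to the generating set `{x₀, x₁}`. -/
def wordLength (f : Equiv.Perm ℝ) : ℕ :=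
  sInf {n | ∃ w : List (Equiv.Perm ℝ), w.length = n ∧
    (∀ g ∈ w, g ∈ ({x0, x1, x0⁻¹, x1⁻¹} : Set (Equiv.Perm ℝ))) ∧ w.prod = f}
/-- Conjugator distance in Thompson's group `F` (the minimum word length of a conjugator). -/
def conjDist (f g : Equiv.Perm ℝ) : ℕ :=
  sInf {n | ∃ h ∈ ThompsonF, h⁻¹ * f * h = g ∧ wordLength h = n}

/-- The conjugator length function of Thompson's group `F`. -/
def CLF (n : ℕ) : ℕ :=
  sSup {m | ∃ f g : Equiv.Perm ℝ, f ∈ ThompsonF ∧ g ∈ ThompsonF ∧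
    (∃ h ∈ ThompsonF, h⁻¹ * f * h = g) ∧ wordLength f + wordLength g ≤ n ∧ conjDist f g = m}

/-- The half-open unit interval, which parametrizes all dyadic intervals. -/
abbrev UI : Type := ↥(Ioc (0 : ℝ) 1)

/-- The affine parametrization of the dyadic interval `(m/2^k, (m+1)/2^k]`. -/
def node (k m : ℕ) : UI → ℝ := fun s => (m + s) / 2 ^ k

/-- Parametrizations of the standard dyadic subintervals of `(0,1]`. -/
def Nodes : Set (UI → ℝ) := {u | ∃ k m : ℕ, m < 2 ^ k ∧ u = node k m}

/-- Affine parametrizations of dyadic subintervals, seen as self-maps of `(0,1]`. -/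
def IsCell (γ : UI → UI) : Prop := (fun s => (γ s : ℝ)) ∈ Nodes

def UI.one : UI := ⟨1, by norm_num, le_rfl⟩
def UI.half : UI := ⟨1 / 2, by norm_num, by norm_num⟩

/-- The left half of `(0,1]`. -/
def hL (s : UI) : UI := ⟨s / 2, by have := s.2.1; linarith, by have := s.2.2; linarith⟩
/-- The right half of `(0,1]`. -/
def hR (s : UI) : UI := ⟨(1 + s) / 2, by have := s.2.1; linarith, by have := s.2.2; linarith⟩

@[simp] lemma UI.one_val : (UI.one : ℝ) = 1 := rfl
@[simp] lemma UI.half_val : (UI.half : ℝ) = 1 / 2 := rfl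
@[simp] lemma hL_val (s : UI) : (hL s : ℝ) = s / 2 := rfl
@[simp] lemma hR_val (s : UI) : (hR s : ℝ) = (1 + s) / 2 := rfl

lemma UI.le_one (s : UI) : s ≤ UI.one := s.2.2

lemma perm_smul_apply (f : Equiv.Perm ℝ) (u : UI → ℝ) (s : UI) : (f • u) s = f (u s) := rfl

lemma smul_comp (f : Equiv.Perm ℝ) (u : UI → ℝ) (γ : UI → UI) :
    f • (u ∘ γ) = (f • u) ∘ γ := rfl

lemma node_mem {k m : ℕ} (h : m < 2 ^ k) : node k m ∈ Nodes := ⟨k, m, h, rfl⟩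

lemma Nodes.affine {u : UI → ℝ} (hu : u ∈ Nodes) :
    ∃ a w : ℝ, 0 < w ∧ 0 ≤ a ∧ a + w ≤ 1 ∧ ∀ s : UI, u s = a + w * s := by
  obtain ⟨k, m, h, rfl⟩ := hu
  have h2 : (0 : ℝ) < 2 ^ k := by positivity
  refine ⟨m / 2 ^ k, 1 / 2 ^ k, by positivity, by positivity, ?_, fun s => ?_⟩
  · rw [← add_div, div_le_one h2]; exact_mod_cast h
  · simp only [node]; ring

lemma Nodes.strictMono {u : UI → ℝ} (hu : u ∈ Nodes) : StrictMono u := by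
  obtain ⟨a, w, hw, -, -, h⟩ := Nodes.affine hu
  intro s t hst
  have : (s : ℝ) < t := hst
  rw [h, h]; nlinarith

lemma Nodes.pos {u : UI → ℝ} (hu : u ∈ Nodes) (s : UI) : 0 < u s := by
  obtain ⟨a, w, hw, h0, -, h⟩ := Nodes.affine hu
  have := s.2.1
  rw [h]; positivity

lemma Nodes.le_one {u : UI → ℝ} (hu : u ∈ Nodes) (s : UI) : u s ≤ 1 := by
  obtain ⟨a, w, hw, h0, h1, h⟩ := Nodes.affine hu
  have := s.2.2
  rw [h]; nlinarith

lemma Nodes.convex {u : UI → ℝ} (hu : u ∈ Nodes) {x y z : ℝ} (hx : x ∈ range u)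
    (hz : z ∈ range u) (hxy : x ≤ y) (hyz : y ≤ z) : y ∈ range u := by
  obtain ⟨a, w, hw, h0, h1, h⟩ := Nodes.affine hu
  obtain ⟨s, rfl⟩ := hx
  obtain ⟨t, rfl⟩ := hz
  rw [h] at hxy hyz
  have hs := s.2.1
  have ht := t.2.2
  refine ⟨⟨(y - a) / w, ?_, ?_⟩, ?_⟩
  · apply div_pos _ hw; nlinarith [mul_pos hw hs]
  · rw [div_le_one hw]; nlinarith
  · rw [h]; field_simp; ring

lemma UI.ext' {s t : UI} (h : (s : ℝ) = t) : s = t := Subtype.ext h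

lemma Nodes.eq_of_eq_two {u v : UI → ℝ} (hu : u ∈ Nodes) (hv : v ∈ Nodes) {s t : UI}
    (hst : s ≠ t) (h1 : u s = v s) (h2 : u t = v t) : u = v := by
  obtain ⟨a, w, -, -, -, h⟩ := Nodes.affine hu
  obtain ⟨a', w', -, -, -, h'⟩ := Nodes.affine hv
  rw [h, h'] at h1 h2
  have hne : (s : ℝ) - t ≠ 0 := sub_ne_zero.2 fun e => hst (UI.ext' e)
  have : (w - w') * ((s : ℝ) - t) = 0 := by linear_combination h1 - h2
  rcases mul_eq_zero.1 this with e | e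
  · have e1 : w = w' := by linarith
    subst e1
    have e2 : a = a' := by linarith
    subst e2
    funext r; rw [h, h']
  · exact absurd e hne

lemma isCell_id : IsCell id := ⟨0, 0, by norm_num, by funext s; simp [node]⟩
lemma isCell_hL : IsCell hL := ⟨1, 0, by norm_num, by funext s; simp [node]⟩
lemma isCell_hR : IsCell hR := ⟨1, 1, by norm_num, by funext s; simp [node]⟩

lemma Nodes.comp {u : UI → ℝ} (hu : u ∈ Nodes) {γ : UI → UI} (hγ : IsCell γ) :
    u ∘ γ ∈ Nodes := by
  obtain ⟨k, m, h, rfl⟩ := hu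
  obtain ⟨k', m', h', e⟩ := hγ
  refine ⟨k + k', m * 2 ^ k' + m', ?_, ?_⟩
  · calc m * 2 ^ k' + m' < m * 2 ^ k' + 2 ^ k' := by omega
      _ = (m + 1) * 2 ^ k' := by ring
      _ ≤ 2 ^ k * 2 ^ k' := Nat.mul_le_mul_right _ h
      _ = 2 ^ (k + k') := by ring
  · funext s
    have := congrFun e s
    simp only [node] at this
    simp only [Function.comp, node, this]
    push_cast
    field_simp
    ring

lemma IsCell.comp {γ δ : UI → UI} (hγ : IsCell γ) (hδ : IsCell δ) : IsCell (γ ∘ δ) :=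
  Nodes.comp hγ hδ

lemma IsCell.iterate {γ : UI → UI} (hγ : IsCell γ) (n : ℕ) : IsCell (γ^[n]) := by
  induction n with
  | zero => exact isCell_id
  | succ n ih => exact ih.comp hγ

/-- The root node `(0,1]`. -/
lemma root_mem : (fun s : UI => (s : ℝ)) ∈ Nodes := isCell_id

lemma Nodes.exists_comp_of_le {k m k' m' : ℕ} (hk : k ≤ k') {s t : UI}
    (h : node k m s = node k' m' t) : ∃ γ, IsCell γ ∧ node k' m' = node k m ∘ γ := by
  obtain ⟨d, rfl⟩ := Nat.exists_eq_add_of_le hk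
  simp only [node] at h
  rw [pow_add] at h
  field_simp at h
  have hd : (0 : ℝ) < 2 ^ d := by positivity
  have hs := s.2.1; have hs' := s.2.2; have ht := t.2.1; have ht' := t.2.2
  have h1 : m * 2 ^ d < m' + 1 := by
    have : (m * 2 ^ d : ℝ) < m' + 1 := by nlinarith [mul_pos hd hs]
    exact_mod_cast this
  have h2 : m' < (m + 1) * 2 ^ d := by
    have : (m' : ℝ) < (m + 1) * 2 ^ d := by nlinarith
    exact_mod_cast this
  obtain ⟨c, rfl⟩ := Nat.exists_eq_add_of_le (Nat.lt_succ_iff.1 h1)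
  have hc : c < 2 ^ d := by nlinarith
  have hc' : (c : ℝ) + 1 ≤ 2 ^ d := by exact_mod_cast hc
  refine ⟨fun r => ⟨(c + r) / 2 ^ d, ?_, ?_⟩, ⟨d, c, hc, rfl⟩, ?_⟩
  · have := r.2.1; positivity
  · rw [div_le_one hd]; have := r.2.2; linarith
  · funext r
    simp only [node, Function.comp, pow_add]
    push_cast
    field_simp
    ring

lemma Nodes.comparable {u v : UI → ℝ} (hu : u ∈ Nodes) (hv : v ∈ Nodes) {x : ℝ}
    (hxu : x ∈ range u) (hxv : x ∈ range v) :
    (∃ γ, IsCell γ ∧ u = v ∘ γ) ∨ (∃ γ, IsCell γ ∧ v = u ∘ γ) := by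
  obtain ⟨k, m, h, rfl⟩ := hu
  obtain ⟨k', m', h', rfl⟩ := hv
  obtain ⟨s, rfl⟩ := hxu
  obtain ⟨t, ht⟩ := hxv
  rcases le_total k k' with hk | hk
  · exact Or.inr (Nodes.exists_comp_of_le hk ht.symm)
  · exact Or.inl (Nodes.exists_comp_of_le hk ht)

/-- A cell is the identity or factors through one of the halves. -/
lemma IsCell.cases {γ : UI → UI} (hγ : IsCell γ) :
    γ = id ∨ (∃ δ, IsCell δ ∧ γ = hL ∘ δ) ∨ (∃ δ, IsCell δ ∧ γ = hR ∘ δ) := by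
  by_cases hγ1 : γ = id
  · exact Or.inl hγ1
  right
  obtain ⟨k, m, hm, e⟩ := hγ
  rcases k with _ | k
  · exfalso; apply hγ1; funext s; apply UI.ext'
    have := congrFun e s
    have hm0 : m = 0 := by simpa using hm
    subst hm0
    simpa [node] using this
  have hk : (0 : ℝ) < 2 ^ k := by positivity
  rcases lt_or_ge m (2 ^ k) with h | h
  · left
    have h' : (m : ℝ) + 1 ≤ 2 ^ k := by exact_mod_cast h
    refine ⟨fun s => ⟨(m + s) / 2 ^ k, ?_, ?_⟩, ⟨k, m, h, rfl⟩, ?_⟩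
    · have := s.2.1; positivity
    · rw [div_le_one hk]; have := s.2.2; linarith
    · funext s; apply UI.ext'
      have := congrFun e s
      simp only [node] at this
      simp only [Function.comp, hL_val, this, pow_succ]
      field_simp
  · right
    obtain ⟨c, rfl⟩ := Nat.exists_eq_add_of_le h
    have hc : c < 2 ^ k := by rw [pow_succ] at hm; omega
    have h' : (c : ℝ) + 1 ≤ 2 ^ k := by exact_mod_cast hc
    refine ⟨fun s => ⟨(c + s) / 2 ^ k, ?_, ?_⟩, ⟨k, c, hc, rfl⟩, ?_⟩
    · have := s.2.1; positivity
    · rw [div_le_one hk]; have := s.2.2; linarith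
    · funext s; apply UI.ext'
      have := congrFun e s
      simp only [node] at this
      simp only [Function.comp, hR_val, this, pow_succ]
      push_cast
      field_simp
      ring

lemma IsCell.inj {γ : UI → UI} (hγ : IsCell γ) : Function.Injective γ := by
  intro s t h
  exact (Nodes.strictMono hγ).injective (by simp [h])

lemma IsCell.eq_id_of_half {γ : UI → UI} (hγ : IsCell γ) (h : γ UI.half = UI.half) : γ = id := by
  rcases hγ.cases with h1 | ⟨δ, hδ, rfl⟩ | ⟨δ, hδ, rfl⟩
  · exact h1
  · have := congrArg (fun s : UI => (s : ℝ)) h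
    simp only [Function.comp, hL_val, UI.half_val] at this
    have h2 := Nodes.strictMono hδ (show UI.half < UI.one by
      show (UI.half : ℝ) < UI.one; norm_num)
    have h3 := (δ UI.one).2.2
    linarith
  · have := congrArg (fun s : UI => (s : ℝ)) h
    simp only [Function.comp, hR_val, UI.half_val] at this
    have h3 := (δ UI.half).2.1
    linarith

lemma Nodes.eq_of_half {u v : UI → ℝ} (hu : u ∈ Nodes) (hv : v ∈ Nodes)
    (h : u UI.half = v UI.half) : u = v := by
  rcases Nodes.comparable hu hv (mem_range_self UI.half) ⟨UI.half, h.symm⟩ with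
    ⟨γ, hγ, e⟩ | ⟨γ, hγ, e⟩
  · have : γ UI.half = UI.half := by
      apply (Nodes.strictMono hv).injective
      rw [← h, e]; rfl
    rw [e, hγ.eq_id_of_half this, Function.comp_id]
  · have : γ UI.half = UI.half := by
      apply (Nodes.strictMono hu).injective
      rw [h, e]; rfl
    rw [e, hγ.eq_id_of_half this, Function.comp_id]

/-- Every point of `(0,1]` lies in a node of every depth. -/
lemma exists_node_mem {x : ℝ} (h0 : 0 < x) (h1 : x ≤ 1) (k : ℕ) :
    ∃ m < 2 ^ k, x ∈ range (node k m) := by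
  have hk : (0 : ℝ) < 2 ^ k := by positivity
  have hx : 0 < x * 2 ^ k := by positivity
  obtain ⟨c, hc⟩ : ∃ c, ⌈x * 2 ^ k⌉₊ = c + 1 :=
    Nat.exists_eq_succ_of_ne_zero (Nat.ceil_pos.2 hx).ne'
  have h2 := Nat.le_ceil (x * 2 ^ k)
  have h3 := Nat.ceil_lt_add_one hx.le
  rw [hc] at h2 h3
  push_cast at h2 h3
  refine ⟨c, ?_, ⟨⟨x * 2 ^ k - c, by linarith, by linarith⟩, ?_⟩⟩
  · have : (c : ℝ) < 2 ^ k := by nlinarith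
    exact_mod_cast this
  · simp only [node]; field_simp; ring

lemma node_sub_lt {k m : ℕ} {x y : ℝ} (hx : x ∈ range (node k m)) (hy : y ∈ range (node k m)) :
    y - x < 1 / 2 ^ k := by
  have hk : (0 : ℝ) < 2 ^ k := by positivity
  obtain ⟨s, rfl⟩ := hx
  obtain ⟨t, rfl⟩ := hy
  have := s.2.1; have := t.2.2
  simp only [node]
  rw [← sub_div, div_lt_div_iff_of_pos_right hk]
  linarith

/-- If `f` is affine on a node `u` and its image, the displacement is a dilation. -/
lemma Nodes.slope {f : Equiv.Perm ℝ} {u : UI → ℝ} (hu : u ∈ Nodes) (hfu : f • u ∈ Nodes) :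
    ∃ ρ > 0, ∀ x ∈ range u, ∀ y ∈ range u, f y - f x = ρ * (y - x) := by
  obtain ⟨a, w, hw, -, -, h⟩ := Nodes.affine hu
  obtain ⟨a', w', hw', -, -, h'⟩ := Nodes.affine hfu
  refine ⟨w' / w, by positivity, ?_⟩
  rintro _ ⟨s, rfl⟩ _ ⟨t, rfl⟩
  have h1 := h' s
  have h2 := h' t
  rw [perm_smul_apply] at h1 h2
  rw [h1, h2, h, h]; field_simp; ring

lemma Nodes.fixed_of_two {f : Equiv.Perm ℝ} {u : UI → ℝ} (hu : u ∈ Nodes) (hfu : f • u ∈ Nodes)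
    {x y : ℝ} (hx : x ∈ range u) (hy : y ∈ range u) (hxy : x ≠ y) (fx : f x = x) (fy : f y = y) :
    f • u = u := by
  obtain ⟨s, rfl⟩ := hx
  obtain ⟨t, rfl⟩ := hy
  exact Nodes.eq_of_eq_two hfu hu (fun e => hxy (by rw [e])) fx fy

lemma pow_smul_eq_iterate {f : Equiv.Perm ℝ} {u : UI → ℝ} {γ : UI → UI} (h : f • u = u ∘ γ) (n : ℕ) :
    f ^ n • u = u ∘ γ^[n] := by
  induction n with
  | zero => simp
  | succ n ih => rw [pow_succ, mul_smul, h, smul_comp, ih]; rfl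

/-- If a node meets its image, its forward or backward iterates are nested nodes. -/
lemma Nodes.nested {f : Equiv.Perm ℝ} {u : UI → ℝ} (hu : u ∈ Nodes) (hfu : f • u ∈ Nodes)
    {x : ℝ} (hx : x ∈ range u) (hx' : x ∈ range (f • u)) :
    (∃ γ, IsCell γ ∧ f • u = u ∘ γ) ∨ (∃ γ, IsCell γ ∧ f⁻¹ • u = u ∘ γ) := by
  rcases Nodes.comparable hfu hu hx' hx with h | ⟨γ, hγ, e⟩
  · exact Or.inl h
  · refine Or.inr ⟨γ, hγ, ?_⟩
    rw [inv_smul_eq_iff, smul_comp]; exact e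

lemma Nodes.pow_smul_mem {f : Equiv.Perm ℝ} {u : UI → ℝ} (hu : u ∈ Nodes) {γ : UI → UI}
    (hγ : IsCell γ) (h : f • u = u ∘ γ) (n : ℕ) : f ^ n • u ∈ Nodes := by
  rw [pow_smul_eq_iterate h]; exact Nodes.comp hu (hγ.iterate n)

/-- Dyadic points of `(0,1)`: midpoints of nodes. -/
def Dy (c : ℝ) : Prop := ∃ u ∈ Nodes, u UI.half = c

lemma Nodes.halves {u : UI → ℝ} {x : ℝ} (hu : u ∈ Nodes) (hx : x ∈ range u) :
    (x ≤ u UI.half ∧ x ∈ range (u ∘ hL)) ∨ (u UI.half < x ∧ x ∈ range (u ∘ hR)) := by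
  obtain ⟨s, rfl⟩ := hx
  have := s.2.1
  have := s.2.2
  rcases le_or_gt (s : ℝ) (1 / 2) with h | h
  · exact Or.inl ⟨(Nodes.strictMono hu).monotone (show (s : ℝ) ≤ UI.half from h),
      ⟨⟨2 * s, by linarith, by linarith⟩, congrArg u (UI.ext' (by simp))⟩⟩
  · exact Or.inr ⟨(Nodes.strictMono hu) (show (UI.half : ℝ) < s from h),
      ⟨⟨2 * s - 1, by linarith, by linarith⟩, congrArg u (UI.ext' (by simp))⟩⟩

lemma Nodes.le_half {u : UI → ℝ} {x : ℝ} (hu : u ∈ Nodes) (hx : x ∈ range (u ∘ hL)) :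
    x ≤ u UI.half := by
  obtain ⟨s, rfl⟩ := hx
  exact (Nodes.strictMono hu).monotone (show ((hL s : UI) : ℝ) ≤ UI.half by
    have := s.2.2; simp; linarith)

lemma Nodes.half_lt {u : UI → ℝ} {x : ℝ} (hu : u ∈ Nodes) (hx : x ∈ range (u ∘ hR)) :
    u UI.half < x := by
  obtain ⟨s, rfl⟩ := hx
  exact (Nodes.strictMono hu) (show (UI.half : ℝ) < hR s by
    have := s.2.1; simp; linarith)

/-- The smallest node containing two points `x < y` is split by them. -/
lemma exists_split_node {x y : ℝ} (h0 : 0 < x) (hxy : x < y) (h1 : y ≤ 1) :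
    ∃ u ∈ Nodes, x ∈ range u ∧ y ∈ range u ∧ x ≤ u UI.half ∧ u UI.half < y := by
  obtain ⟨N, hN⟩ : ∃ N : ℕ, 1 / 2 ^ N < y - x := by
    obtain ⟨N, hN⟩ := exists_pow_lt_of_lt_one (sub_pos.2 hxy) (show (1 / 2 : ℝ) < 1 by norm_num)
    exact ⟨N, by rwa [div_pow, one_pow] at hN⟩
  let P : ℕ → Prop := fun k => ∃ m < 2 ^ k, x ∈ range (node k m) ∧ y ∈ range (node k m)
  have hP0 : P 0 := ⟨0, by norm_num, ⟨⟨x, h0, hxy.le.trans h1⟩, by simp [node]⟩,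
    ⟨⟨y, h0.trans hxy, h1⟩, by simp [node]⟩⟩
  have hPN : ¬ P N := by
    rintro ⟨m, hm, hx, hy⟩
    exact absurd (node_sub_lt hx hy) (not_lt.2 hN.le)
  obtain ⟨k, hk, hkn⟩ : ∃ k, P k ∧ ¬ P (k + 1) := by
    by_contra! H
    exact hPN (Nat.rec hP0 (fun k ih => H k ih) N)
  obtain ⟨m, hm, hx, hy⟩ := hk
  have hL' : node k m ∘ hL = node (k + 1) (2 * m) := by
    funext s; simp only [Function.comp, node, hL_val, pow_succ]; push_cast; field_simp
  have hR' : node k m ∘ hR = node (k + 1) (2 * m + 1) := by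
    funext s; simp only [Function.comp, node, hR_val, pow_succ]; push_cast; field_simp; ring
  refine ⟨node k m, node_mem hm, hx, hy, ?_⟩
  rcases Nodes.halves (node_mem hm) hx with ⟨a1, b1⟩ | ⟨a1, b1⟩ <;>
    rcases Nodes.halves (node_mem hm) hy with ⟨a2, b2⟩ | ⟨a2, b2⟩
  · exact absurd ⟨2 * m, by rw [pow_succ]; omega, by rwa [← hL'], by rwa [← hL']⟩ hkn
  · exact ⟨a1, a2⟩
  · linarith
  · exact absurd ⟨2 * m + 1, by rw [pow_succ]; omega, by rwa [← hR'], by rwa [← hR']⟩ hkn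

/-- The node `(1 - 1/2^k, 1]`. -/
def spine (k : ℕ) : UI → ℝ := fun s => 1 - (1 - s) / 2 ^ k

/-- The left half of `spine j`. -/
def rho (j : ℕ) : UI → ℝ := spine j ∘ hL

/-- Nodes not touching `1`. -/
def Ns : Set (UI → ℝ) := {u | u ∈ Nodes ∧ u UI.one ≠ 1}

/-- Nodes that are not mapped to nodes. -/
def T (f : Equiv.Perm ℝ) : Set (UI → ℝ) := {u | u ∈ Nodes ∧ f • u ∉ Nodes}

/-- Nodes not touching `1` that are not mapped to such nodes. -/
def D (f : Equiv.Perm ℝ) : Set (UI → ℝ) := {u | u ∈ Ns ∧ f • u ∉ Ns}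

lemma spine_succ (k : ℕ) : spine (k + 1) = spine k ∘ hR := by
  funext s; simp only [spine, Function.comp, hR_val, pow_succ]; field_simp; ring

lemma spine_zero : spine 0 = fun s : UI => (s : ℝ) := by funext s; simp [spine]

lemma spine_mem (k : ℕ) : spine k ∈ Nodes := by
  induction k with
  | zero => rw [spine_zero]; exact root_mem
  | succ k ih => rw [spine_succ]; exact Nodes.comp ih isCell_hR

lemma spine_one (k : ℕ) : spine k UI.one = 1 := by simp [spine]

lemma rho_mem (j : ℕ) : rho j ∈ Nodes := Nodes.comp (spine_mem j) isCell_hL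

lemma rho_comp_mem (j : ℕ) {γ : UI → UI} (hγ : IsCell γ) : rho j ∘ γ ∈ Ns := by
  refine ⟨Nodes.comp (rho_mem j) hγ, ?_⟩
  have h1 := (γ UI.one).2.2
  have : (0 : ℝ) < 2 ^ j := by positivity
  simp only [rho, spine, Function.comp, hL_val]
  intro h
  have h2 : (1 - ((γ UI.one : UI) : ℝ) / 2) / 2 ^ j = 0 := by linarith
  rw [div_eq_zero_iff] at h2
  rcases h2 with h2 | h2
  · linarith
  · exact this.ne' h2

lemma rho_mem_Ns (j : ℕ) : rho j ∈ Ns := rho_comp_mem j isCell_id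

/-- Every node is a spine node or lies below a unique `rho j`. -/
lemma Nodes.spine_or_rho {u : UI → ℝ} (hu : u ∈ Nodes) :
    (∃ k, u = spine k) ∨ ∃ j γ, IsCell γ ∧ u = rho j ∘ γ := by
  obtain ⟨k, m, hm, rfl⟩ := hu
  have key : ∀ k j m, m < 2 ^ k → ∀ γ : UI → UI, (∀ s, (γ s : ℝ) = node k m s) →
      (∃ i, spine j ∘ γ = spine i) ∨ ∃ i δ, IsCell δ ∧ spine j ∘ γ = rho i ∘ δ := by
    intro k
    induction k with
    | zero =>
      intro j m hm γ hγ
      left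
      refine ⟨j, ?_⟩
      have : γ = id := by
        funext s; apply UI.ext'; rw [hγ s]
        have : m = 0 := by simpa using hm
        simp [node, this]
      rw [this]; rfl
    | succ k ih =>
      intro j m hm γ hγ
      have hk : (0 : ℝ) < 2 ^ k := by positivity
      rcases lt_or_ge m (2 ^ k) with h | h
      · right
        have h' : (m : ℝ) + 1 ≤ 2 ^ k := by exact_mod_cast h
        refine ⟨j, fun s => ⟨node k m s, Nodes.pos (node_mem h) s, Nodes.le_one (node_mem h) s⟩,
          node_mem h, ?_⟩
        funext s
        simp only [Function.comp, rho]
        congr 1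
        apply UI.ext'
        rw [hγ]
        simp only [node, hL_val, pow_succ]; field_simp
      · obtain ⟨c, rfl⟩ := Nat.exists_eq_add_of_le h
        have hc : c < 2 ^ k := by rw [pow_succ] at hm; omega
        have := ih (j + 1) c hc
          (fun s => ⟨node k c s, Nodes.pos (node_mem hc) s, Nodes.le_one (node_mem hc) s⟩)
          (fun s => rfl)
        have e : spine j ∘ γ = spine (j + 1) ∘ (fun s => (⟨node k c s, Nodes.pos (node_mem hc) s,
            Nodes.le_one (node_mem hc) s⟩ : UI)) := by
          rw [spine_succ]
          funext s
          simp only [Function.comp]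
          congr 1
          apply UI.ext'
          rw [hγ]
          simp only [node, hR_val, pow_succ]; push_cast; field_simp; ring
        rwa [e]
  have := key k 0 m hm
    (fun s => ⟨node k m s, Nodes.pos (node_mem hm) s, Nodes.le_one (node_mem hm) s⟩) (fun s => rfl)
  rw [spine_zero] at this
  exact this

lemma Ns.eq_rho {u : UI → ℝ} (hu : u ∈ Ns) : ∃ j γ, IsCell γ ∧ u = rho j ∘ γ := by
  rcases Nodes.spine_or_rho hu.1 with ⟨k, rfl⟩ | h
  · exact absurd (spine_one k) hu.2
  · exact h

lemma Nodes.eq_spine {u : UI → ℝ} (hu : u ∈ Nodes) (h : u UI.one = 1) : ∃ k, u = spine k := by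
  rcases Nodes.spine_or_rho hu with h1 | ⟨j, γ, hγ, rfl⟩
  · exact h1
  · exact absurd h (rho_comp_mem j hγ).2

lemma rho_val (j : ℕ) (s : UI) : rho j s = 1 - (1 - (s : ℝ) / 2) / 2 ^ j := rfl

/-- The `i`-th infinite generator of Thompson's group. -/
def xi : ℕ → Equiv.Perm ℝ
  | 0 => x0
  | i + 1 => x0⁻¹ ^ i * x1 * x0 ^ i

lemma xi_one : xi 1 = x1 := by simp [xi]

lemma xi_succ_succ (i : ℕ) : xi (i + 2) = x0⁻¹ * xi (i + 1) * x0 := by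
  simp only [xi, pow_succ' x0⁻¹, pow_succ x0, mul_assoc]

lemma x0_rho_zero : x0 • rho 0 = rho 0 ∘ hL := by
  funext s
  have := s.2.1; have := s.2.2
  show x0fun (rho 0 s) = _
  simp only [rho_val, Function.comp, hL_val, x0fun]
  norm_num
  split_ifs <;> linarith

lemma x0_rho_one : x0 • rho 1 = rho 0 ∘ hR := by
  funext s
  have := s.2.1; have := s.2.2
  show x0fun (rho 1 s) = _
  simp only [rho_val, Function.comp, hR_val, x0fun]
  norm_num
  split_ifs <;> linarith

lemma x0_spine (k : ℕ) : x0 • spine (k + 2) = spine (k + 1) := by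
  funext s
  have := s.2.1; have := s.2.2
  have h1 : (1 - (s : ℝ)) / 2 ^ k ≤ 1 - s := div_le_self (by linarith) (one_le_pow₀ (by norm_num))
  have h2 : 0 ≤ (1 - (s : ℝ)) / 2 ^ k := div_nonneg (by linarith) (by positivity)
  have e2 : (1 - (s : ℝ)) / 2 ^ (k + 2) = (1 - (s : ℝ)) / 2 ^ k / 4 := by
    rw [pow_add]; field_simp; norm_num
  have e1 : (1 - (s : ℝ)) / 2 ^ (k + 1) = (1 - (s : ℝ)) / 2 ^ k / 2 := by
    rw [pow_add]; field_simp
  show x0fun (spine (k + 2) s) = _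
  simp only [spine, x0fun, e1, e2]
  split_ifs <;> linarith

lemma x1_rho_zero : x1 • rho 0 = rho 0 := by
  funext s
  have := s.2.1; have := s.2.2
  show x1fun (rho 0 s) = _
  simp only [rho_val, x1fun, pow_zero, div_one]
  split_ifs <;> linarith

lemma x1_rho_one : x1 • rho 1 = rho 1 ∘ hL := by
  funext s
  have := s.2.1; have := s.2.2
  show x1fun (rho 1 s) = _
  simp only [rho_val, Function.comp, hL_val, x1fun]
  norm_num
  split_ifs <;> linarith

lemma x1_rho_two : x1 • rho 2 = rho 1 ∘ hR := by
  funext s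
  have := s.2.1; have := s.2.2
  show x1fun (rho 2 s) = _
  simp only [rho_val, Function.comp, hR_val, x1fun]
  norm_num
  split_ifs <;> linarith

lemma x1_spine (k : ℕ) : x1 • spine (k + 3) = spine (k + 2) := by
  funext s
  have := s.2.1; have := s.2.2
  have h1 : (1 - (s : ℝ)) / 2 ^ k ≤ 1 - s := div_le_self (by linarith) (one_le_pow₀ (by norm_num))
  have h2 : 0 ≤ (1 - (s : ℝ)) / 2 ^ k := div_nonneg (by linarith) (by positivity)
  have e2 : (1 - (s : ℝ)) / 2 ^ (k + 3) = (1 - (s : ℝ)) / 2 ^ k / 8 := by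
    rw [pow_add]; field_simp; norm_num
  have e1 : (1 - (s : ℝ)) / 2 ^ (k + 2) = (1 - (s : ℝ)) / 2 ^ k / 4 := by
    rw [pow_add]; field_simp; norm_num
  show x1fun (spine (k + 3) s) = _
  simp only [spine, x1fun, e1, e2]
  split_ifs <;> linarith

lemma x0_rho (k : ℕ) : x0 • rho (k + 2) = rho (k + 1) := by
  rw [rho, smul_comp, x0_spine]; rfl

lemma xi_rho_lt {i j : ℕ} (h : j < i) : xi i • rho j = rho j := by
  obtain ⟨i, rfl⟩ : ∃ i', i = i' + 1 := ⟨i - 1, by omega⟩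
  induction i generalizing j with
  | zero =>
    have : j = 0 := by omega
    subst this
    rw [xi_one, x1_rho_zero]
  | succ i ih =>
    rw [xi_succ_succ, mul_smul, mul_smul, inv_smul_eq_iff]
    rcases j with _ | _ | j
    · rw [x0_rho_zero, smul_comp, ih (by omega)]
    · rw [x0_rho_one, smul_comp, ih (by omega)]
    · rw [x0_rho, ih (by omega)]

lemma xi_rho_self (i : ℕ) : xi i • rho i = rho i ∘ hL := by
  rcases i with _ | i
  · exact x0_rho_zero
  induction i with
  | zero => rw [xi_one, x1_rho_one]
  | succ i ih => rw [xi_succ_succ, mul_smul, mul_smul, inv_smul_eq_iff, x0_rho, ih, smul_comp, x0_rho]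

lemma xi_rho_succ (i : ℕ) : xi i • rho (i + 1) = rho i ∘ hR := by
  rcases i with _ | i
  · exact x0_rho_one
  induction i with
  | zero => rw [xi_one, x1_rho_two]
  | succ i ih => rw [xi_succ_succ, mul_smul, mul_smul, inv_smul_eq_iff, x0_rho, ih, smul_comp, x0_rho]

lemma xi_spine {i k : ℕ} (h : i + 1 ≤ k) : xi i • spine (k + 1) = spine k := by
  obtain ⟨k, rfl⟩ := Nat.exists_eq_add_of_le h
  rcases i with _ | i
  · have := x0_spine k
    simpa [xi, add_comm, add_left_comm, add_assoc] using this
  induction i with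
  | zero => rw [xi_one]; have := x1_spine k; simpa [add_comm, add_left_comm, add_assoc] using this
  | succ i ih =>
    have e1 : i + 1 + 1 + 1 + k + 1 = (i + k + 2) + 2 := by ring
    have e2 : i + 1 + 1 + 1 + k = (i + k + 1) + 2 := by ring
    have e3 : i + 1 + 1 + k + 1 = i + k + 2 + 1 := by ring
    have e4 : i + 1 + 1 + k = i + k + 1 + 1 := by ring
    rw [e3, e4] at ih
    rw [xi_succ_succ, mul_smul, mul_smul, inv_smul_eq_iff, e1, x0_spine, ih (by omega), e2, x0_spine]

lemma xi_rho_gt {i k : ℕ} (h : i + 1 ≤ k) : xi i • rho (k + 1) = rho k := by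
  rw [rho, smul_comp, xi_spine h]; rfl

lemma xi_smul_rho_mem (i j : ℕ) : ∃ j' δ, IsCell δ ∧ xi i • rho j = rho j' ∘ δ := by
  rcases lt_trichotomy j i with h | rfl | h
  · exact ⟨j, id, isCell_id, xi_rho_lt h⟩
  · exact ⟨j, hL, isCell_hL, xi_rho_self j⟩
  · obtain ⟨k, rfl⟩ := Nat.exists_eq_add_of_lt h
    rcases k with _ | k
    · exact ⟨i, hR, isCell_hR, xi_rho_succ i⟩
    · exact ⟨i + (k + 1), id, isCell_id, xi_rho_gt (by omega)⟩

lemma xi_smul_Ns (i : ℕ) {u : UI → ℝ} (hu : u ∈ Ns) : xi i • u ∈ Ns := by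
  obtain ⟨j, γ, hγ, rfl⟩ := Ns.eq_rho hu
  obtain ⟨j', δ, hδ, e⟩ := xi_smul_rho_mem i j
  rw [smul_comp, e, Function.comp_assoc]
  exact rho_comp_mem j' (hδ.comp hγ)

lemma xi_inv_smul_Ns (i : ℕ) {u : UI → ℝ} (hu : u ∈ Ns) (hne : u ≠ rho i) : (xi i)⁻¹ • u ∈ Ns := by
  obtain ⟨j, γ, hγ, rfl⟩ := Ns.eq_rho hu
  rw [smul_comp]
  rcases lt_trichotomy j i with h | rfl | h
  · rw [inv_smul_eq_iff.2 (xi_rho_lt h).symm]; exact rho_comp_mem j hγ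
  · rcases hγ.cases with rfl | ⟨δ, hδ, rfl⟩ | ⟨δ, hδ, rfl⟩
    · exact absurd (Function.comp_id _) hne
    · rw [← smul_comp, ← Function.comp_assoc, ← xi_rho_self, smul_comp, inv_smul_smul]
      exact rho_comp_mem j hδ
    · rw [← smul_comp, ← Function.comp_assoc, ← xi_rho_succ, smul_comp, inv_smul_smul]
      exact rho_comp_mem _ hδ
  · rw [inv_smul_eq_iff.2 (xi_rho_gt h).symm]; exact rho_comp_mem _ hγ

lemma D_xi (i : ℕ) : D (xi i) = ∅ := by
  ext u; simp only [D, mem_ofPred_eq, mem_empty_iff_false, iff_false, not_and, not_not]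
  exact xi_smul_Ns i

lemma D_xi_inv (i : ℕ) : D (xi i)⁻¹ ⊆ {rho i} := by
  rintro u ⟨hu, h⟩
  by_contra hne
  exact h (xi_inv_smul_Ns i hu hne)

lemma D_mul (f g : Equiv.Perm ℝ) : D (f * g) ⊆ D g ∪ (fun u => g⁻¹ • u) '' D f := by
  rintro u ⟨hu, h⟩
  by_cases hg : g • u ∈ Ns
  · exact Or.inr ⟨g • u, ⟨hg, by rwa [← mul_smul]⟩, inv_smul_smul g u⟩
  · exact Or.inl ⟨hu, hg⟩

lemma T_mul (f g : Equiv.Perm ℝ) : T (f * g) ⊆ T g ∪ (fun u => g⁻¹ • u) '' T f := by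
  rintro u ⟨hu, h⟩
  by_cases hg : g • u ∈ Nodes
  · exact Or.inr ⟨g • u, ⟨hg, by rwa [← mul_smul]⟩, inv_smul_smul g u⟩
  · exact Or.inl ⟨hu, hg⟩

/-- Bookkeeping for the number of carets of a word of length `n`. -/
structure Complexity (f : Equiv.Perm ℝ) (n : ℕ) : Prop where
  finD : (D f).Finite
  finE : (D f⁻¹).Finite
  sum_le : (D f).ncard + (D f⁻¹).ncard ≤ n
  spine : ∃ K K', f • spine K = spine K' ∧ 2 ≤ K ∧ 2 ≤ K' ∧ (D f).ncard + K ≤ n + 2 ∧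
    (D f⁻¹).ncard + K' ≤ n + 2

lemma Complexity.one : Complexity 1 0 := by
  have h : D 1 = ∅ := by
    ext u; simp only [D, one_smul, mem_ofPred_eq, mem_empty_iff_false]; tauto
  refine ⟨?_, ?_, ?_, 2, 2, ?_⟩ <;> simp [h]

lemma Complexity.inv {f : Equiv.Perm ℝ} {n : ℕ} (h : Complexity f n) : Complexity f⁻¹ n := by
  obtain ⟨K, K', e, h1, h2, h3, h4⟩ := h.spine
  refine ⟨h.finE, by simpa using h.finD, by simpa [add_comm] using h.sum_le, K', K, ?_, h2, h1, h4,
    by simpa using h3⟩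
  rw [← e, inv_smul_smul]

lemma D_mul_finite {f g : Equiv.Perm ℝ} (hf : (D f).Finite) (hg : (D g).Finite) :
    (D (f * g)).Finite := (hg.union (hf.image _)).subset (D_mul f g)

lemma D_mul_ncard {f g : Equiv.Perm ℝ} (hf : (D f).Finite) (hg : (D g).Finite) :
    (D (f * g)).ncard ≤ (D g).ncard + (D f).ncard :=
  (ncard_le_ncard (D_mul f g) (hg.union (hf.image _))).trans
    ((ncard_union_le _ _).trans (Nat.add_le_add_left (ncard_image_le hf) _))

lemma D_xi_inv_finite (i : ℕ) : (D (xi i)⁻¹).Finite := (finite_singleton _).subset (D_xi_inv i)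

lemma D_xi_inv_ncard (i : ℕ) : (D (xi i)⁻¹).ncard ≤ 1 :=
  (ncard_le_ncard (D_xi_inv i) (finite_singleton _)).trans (ncard_singleton _).le

lemma smul_spine_add {f : Equiv.Perm ℝ} {K K' : ℕ} (h : f • spine K = spine K') (d : ℕ) :
    f • spine (K + d) = spine (K' + d) := by
  induction d with
  | zero => exact h
  | succ d ih => rw [← add_assoc, spine_succ, smul_comp, ih, ← spine_succ]; rfl

lemma Complexity.xi_mul {f : Equiv.Perm ℝ} {n i : ℕ} (hi : i ≤ 1) (h : Complexity f n) :
    Complexity (xi i * f) (n + 1) := by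
  have hx : (D (xi i)).Finite := by rw [D_xi]; exact finite_empty
  have hxn : (D (xi i)).ncard = 0 := by rw [D_xi, ncard_empty]
  have h1 := D_mul_ncard hx h.finD
  have h2 := D_mul_ncard h.finE (D_xi_inv_finite i)
  have h3 := D_xi_inv_ncard i
  rw [← mul_inv_rev] at h2
  have hs := h.sum_le
  refine ⟨D_mul_finite hx h.finD, ?_, by omega, ?_⟩
  · rw [mul_inv_rev]; exact D_mul_finite h.finE (D_xi_inv_finite i)
  · obtain ⟨K, K', e, hK, hK', h4, h5⟩ := h.spine
    rcases eq_or_lt_of_le hK' with e2 | hlt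
    · subst e2
      refine ⟨K + 1, 2, ?_, by omega, le_rfl, by omega, by omega⟩
      rw [mul_smul, smul_spine_add e, xi_spine (by omega)]
    · obtain ⟨k, rfl⟩ : ∃ k, K' = k + 1 := ⟨K' - 1, by omega⟩
      refine ⟨K, k, ?_, by omega, by omega, by omega, by omega⟩
      rw [mul_smul, e, xi_spine (by omega)]

lemma Complexity.xi_inv_mul {f : Equiv.Perm ℝ} {n i : ℕ} (hi : i ≤ 1) (h : Complexity f n) :
    Complexity ((xi i)⁻¹ * f) (n + 1) := by
  have hx : (D (xi i)).Finite := by rw [D_xi]; exact finite_empty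
  have hxn : (D (xi i)).ncard = 0 := by rw [D_xi, ncard_empty]
  have h1 := D_mul_ncard (D_xi_inv_finite i) h.finD
  have h2 := D_mul_ncard h.finE hx
  have h3 := D_xi_inv_ncard i
  have e' : ((xi i)⁻¹ * f)⁻¹ = f⁻¹ * xi i := by simp
  rw [← e'] at h2
  have hs := h.sum_le
  refine ⟨D_mul_finite (D_xi_inv_finite i) h.finD, ?_, by omega, ?_⟩
  · rw [e']; exact D_mul_finite h.finE hx
  · obtain ⟨K, K', e, hK, hK', h4, h5⟩ := h.spine
    refine ⟨K, K' + 1, ?_, by omega, by omega, by omega, by omega⟩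
    rw [mul_smul, e, inv_smul_eq_iff, xi_spine (by omega)]

abbrev Gens : Set (Equiv.Perm ℝ) := {x0, x1, x0⁻¹, x1⁻¹}

lemma Complexity.of_word (w : List (Equiv.Perm ℝ)) (hw : ∀ g ∈ w, g ∈ Gens) :
    Complexity w.prod w.length := by
  induction w with
  | nil => exact Complexity.one
  | cons a w ih =>
    have ih' := ih fun g hg => hw g (List.mem_cons_of_mem _ hg)
    rw [List.prod_cons, List.length_cons]
    rcases hw a List.mem_cons_self with rfl | rfl | rfl | rfl
    · exact ih'.xi_mul (i := 0) (by omega)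
    · rw [← xi_one]; exact ih'.xi_mul (i := 1) (by omega)
    · exact ih'.xi_inv_mul (i := 0) (by omega)
    · rw [← xi_one]; exact ih'.xi_inv_mul (i := 1) (by omega)

lemma exists_word {f : Equiv.Perm ℝ} (hf : f ∈ ThompsonF) :
    ∃ w : List (Equiv.Perm ℝ), w.length = wordLength f ∧ (∀ g ∈ w, g ∈ Gens) ∧ w.prod = f := by
  have hne : {n | ∃ w : List (Equiv.Perm ℝ), w.length = n ∧
      (∀ g ∈ w, g ∈ ({x0, x1, x0⁻¹, x1⁻¹} : Set (Equiv.Perm ℝ))) ∧ w.prod = f}.Nonempty := by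
    have hf' : f ∈ (Subgroup.closure ({x0, x1} : Set (Equiv.Perm ℝ))).toSubmonoid := hf
    rw [Subgroup.closure_toSubmonoid] at hf'
    obtain ⟨l, hl, rfl⟩ := Submonoid.exists_list_of_mem_closure hf'
    refine ⟨l.length, l, rfl, fun g hg => ?_, rfl⟩
    rcases hl g hg with h | h
    · rcases h with rfl | rfl <;> simp
    · rcases h with h | h
      · right; right; left; rw [← h, inv_inv]
      · right; right; right; rw [mem_singleton_iff] at h ⊢; rw [← h, inv_inv]
  exact Nat.sInf_mem hne

lemma Complexity.of_mem {f : Equiv.Perm ℝ} (hf : f ∈ ThompsonF) : Complexity f (wordLength f) := by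
  obtain ⟨w, h1, h2, h3⟩ := exists_word hf
  have := Complexity.of_word w h2
  rwa [h1, h3] at this

lemma T_subset {f : Equiv.Perm ℝ} {K K' : ℕ} (h : f • spine K = spine K') :
    T f ⊆ D f ∪ spine '' (Finset.range K) := by
  rintro u ⟨hu, hf⟩
  by_cases h1 : u UI.one = 1
  · obtain ⟨k, rfl⟩ := Nodes.eq_spine hu h1
    right
    refine ⟨k, ?_, rfl⟩
    by_contra hk
    simp only [Finset.coe_range, mem_Iio, not_lt] at hk
    obtain ⟨d, rfl⟩ := Nat.exists_eq_add_of_le hk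
    rw [smul_spine_add h] at hf
    exact hf (spine_mem _)
  · exact Or.inl ⟨⟨hu, h1⟩, fun h' => hf h'.1⟩

lemma Complexity.T_finite {f : Equiv.Perm ℝ} {n : ℕ} (h : Complexity f n) : (T f).Finite := by
  obtain ⟨K, K', e, -⟩ := h.spine
  exact (h.finD.union ((Finset.finite_toSet _).image _)).subset (T_subset e)

lemma Complexity.T_ncard {f : Equiv.Perm ℝ} {n : ℕ} (h : Complexity f n) : (T f).ncard ≤ n + 2 := by
  obtain ⟨K, K', e, -, -, h1, -⟩ := h.spine
  have h2 := ncard_le_ncard (T_subset e) (h.finD.union ((Finset.finite_toSet _).image _))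
  have h3 := ncard_union_le (D f) (_root_.spine '' (Finset.range K))
  have h4 : (_root_.spine '' (Finset.range K : Set ℕ)).ncard ≤ K := by
    refine (ncard_image_le (Finset.finite_toSet _)).trans ?_
    rw [ncard_coe_finset, Finset.card_range]
  omega

lemma word_le {f : Equiv.Perm ℝ} (w : List (Equiv.Perm ℝ)) (hw : ∀ g ∈ w, g ∈ Gens)
    (h : w.prod = f) : wordLength f ≤ w.length :=
  Nat.sInf_le ⟨w, rfl, hw, h⟩

/-- The basic regularity shared by elements of Thompson's group and the maps built from them. -/
structure Reg (f : Equiv.Perm ℝ) : Prop where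
  mono : StrictMono f
  nonpos : ∀ x ≤ 0, f x = x
  one_le : ∀ x, 1 ≤ x → f x = x
  finT : (T f).Finite
  finT' : (T f⁻¹).Finite

lemma strictMono_inv {f : Equiv.Perm ℝ} (h : StrictMono f) : StrictMono (f⁻¹ : Equiv.Perm ℝ) := by
  intro x y hxy
  rw [← h.lt_iff_lt]
  simpa using hxy

lemma Reg.inv {f : Equiv.Perm ℝ} (h : Reg f) : Reg f⁻¹ where
  mono := strictMono_inv h.mono
  nonpos x hx := by rw [Equiv.Perm.inv_eq_iff_eq, h.nonpos x hx]
  one_le x hx := by rw [Equiv.Perm.inv_eq_iff_eq, h.one_le x hx]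
  finT := h.finT'
  finT' := by simpa using h.finT

lemma Reg.mul {f g : Equiv.Perm ℝ} (hf : Reg f) (hg : Reg g) : Reg (f * g) where
  mono := hf.mono.comp hg.mono
  nonpos x hx := by rw [Equiv.Perm.mul_apply, hg.nonpos x hx, hf.nonpos x hx]
  one_le x hx := by rw [Equiv.Perm.mul_apply, hg.one_le x hx, hf.one_le x hx]
  finT := (hg.finT.union (hf.finT.image _)).subset (T_mul f g)
  finT' := by
    rw [mul_inv_rev]
    exact (hf.finT'.union (hg.finT'.image _)).subset (T_mul _ _)

lemma x0_strictMono : StrictMono x0 := by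
  intro x y hxy
  show x0fun x < x0fun y
  unfold x0fun
  split_ifs <;> linarith

lemma x1_strictMono : StrictMono x1 := by
  intro x y hxy
  show x1fun x < x1fun y
  unfold x1fun
  split_ifs <;> linarith

lemma Reg.one : Reg 1 where
  mono := strictMono_id
  nonpos _ _ := rfl
  one_le _ _ := rfl
  finT := Complexity.one.T_finite
  finT' := by simpa using Complexity.one.T_finite

lemma Reg.of_mem {f : Equiv.Perm ℝ} (hf : f ∈ ThompsonF) : Reg f := by
  have h0 : Complexity x0 1 := by simpa using Complexity.of_word [x0] (by simp)
  have h1 : Complexity x1 1 := by simpa using Complexity.of_word [x1] (by simp)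
  induction hf using Subgroup.closure_induction with
  | mem x hx =>
    rcases hx with rfl | rfl
    · refine ⟨x0_strictMono, fun x hx => ?_, fun x hx => ?_, h0.T_finite, h0.inv.T_finite⟩
      · show x0fun x = x
        unfold x0fun; split_ifs <;> linarith
      · show x0fun x = x
        unfold x0fun; split_ifs <;> linarith
    · refine ⟨x1_strictMono, fun x hx => ?_, fun x hx => ?_, h1.T_finite, h1.inv.T_finite⟩
      · show x1fun x = x
        unfold x1fun; split_ifs <;> linarith
      · show x1fun x = x
        unfold x1fun; split_ifs <;> linarith
  | one => exact Reg.one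
  | mul x y _ _ hx hy => exact hx.mul hy
  | inv x _ hx => exact hx.inv

/-- `f` is a product of at most `n` letters. -/
def WL (f : Equiv.Perm ℝ) (n : ℕ) : Prop :=
  ∃ w : List (Equiv.Perm ℝ), w.length ≤ n ∧ (∀ g ∈ w, g ∈ Gens) ∧ w.prod = f

lemma WL.one : WL 1 0 := ⟨[], by simp, by simp, by simp⟩

lemma WL.gen {g : Equiv.Perm ℝ} (hg : g ∈ Gens) : WL g 1 :=
  ⟨[g], by simp, by simpa using hg, by simp⟩

lemma WL.mul {f g : Equiv.Perm ℝ} {m n : ℕ} (hf : WL f m) (hg : WL g n) : WL (f * g) (m + n) := by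
  obtain ⟨w, h1, h2, h3⟩ := hf
  obtain ⟨w', h1', h2', h3'⟩ := hg
  refine ⟨w ++ w', by rw [List.length_append]; omega, fun g hg => ?_, by rw [List.prod_append, h3, h3']⟩
  rcases List.mem_append.1 hg with h | h
  · exact h2 g h
  · exact h2' g h

lemma Gens.inv {g : Equiv.Perm ℝ} (hg : g ∈ Gens) : g⁻¹ ∈ Gens := by
  rcases hg with rfl | rfl | rfl | rfl <;> simp

lemma WL.inv {f : Equiv.Perm ℝ} {m : ℕ} (hf : WL f m) : WL f⁻¹ m := by
  obtain ⟨w, h1, h2, rfl⟩ := hf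
  refine ⟨(w.map (·⁻¹)).reverse, by simpa using h1, fun g hg => ?_, by
    rw [List.prod_inv_reverse]⟩
  rw [List.mem_reverse, List.mem_map] at hg
  obtain ⟨a, ha, rfl⟩ := hg
  exact Gens.inv (h2 a ha)

lemma WL.mono {f : Equiv.Perm ℝ} {m n : ℕ} (hf : WL f m) (h : m ≤ n) : WL f n := by
  obtain ⟨w, h1, h2⟩ := hf
  exact ⟨w, h1.trans h, h2⟩

lemma WL.pow_x0_inv (n : ℕ) : WL (x0⁻¹ ^ n) n := by
  induction n with
  | zero => exact WL.one
  | succ n ih => rw [pow_succ]; exact ih.mul (WL.gen (by simp))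

lemma WL.wordLength_le {f : Equiv.Perm ℝ} {m : ℕ} (hf : WL f m) : wordLength f ≤ m := by
  obtain ⟨w, h1, h2, h3⟩ := hf
  exact (word_le w h2 h3).trans h1

lemma WL.mem {f : Equiv.Perm ℝ} {m : ℕ} (hf : WL f m) : f ∈ ThompsonF := by
  obtain ⟨w, -, h2, rfl⟩ := hf
  refine Subgroup.list_prod_mem _ fun g hg => ?_
  have h0 : x0 ∈ ThompsonF := Subgroup.subset_closure (by simp)
  have h1 : x1 ∈ ThompsonF := Subgroup.subset_closure (by simp)
  rcases h2 g hg with rfl | rfl | rfl | rfl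
  exacts [h0, h1, inv_mem h0, inv_mem h1]

lemma Ns.comp {u : UI → ℝ} (hu : u ∈ Ns) {γ : UI → UI} (hγ : IsCell γ) : u ∘ γ ∈ Ns := by
  obtain ⟨j, δ, hδ, rfl⟩ := Ns.eq_rho hu
  rw [Function.comp_assoc]; exact rho_comp_mem j (hδ.comp hγ)

lemma exists_rho_mem_D {h : Equiv.Perm ℝ} (hD : (D h).Nonempty) : ∃ j, rho j ∈ D h := by
  obtain ⟨u, hu, hhu⟩ := hD
  obtain ⟨j, γ, hγ, rfl⟩ := Ns.eq_rho hu
  exact ⟨j, rho_mem_Ns j, fun h' => hhu (by rw [smul_comp]; exact Ns.comp h' hγ)⟩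

lemma rho_mem_D_lt {h : Equiv.Perm ℝ} {K K' i : ℕ} (hK : h • spine K = spine K')
    (hi : rho i ∈ D h) : i < K := by
  by_contra hlt
  obtain ⟨d, rfl⟩ := Nat.exists_eq_add_of_le (not_lt.1 hlt)
  apply hi.2
  rw [rho, smul_comp, smul_spine_add hK]
  exact rho_mem_Ns _

lemma xi_smul_ne_rho (i : ℕ) {u : UI → ℝ} (hu : u ∈ Ns) : xi i • u ≠ rho i := by
  intro h
  have h1 : u ∘ hL = rho i := by
    have := xi_rho_self i
    rw [← h, ← smul_comp] at this
    rw [← h]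
    have h2 := MulAction.injective (xi i) this
    rw [← h2]
  have h2 : u = spine i := by
    have e : (hL UI.one) ≠ hL UI.half := fun e => by
      have := congrArg (fun s : UI => (s : ℝ)) e
      norm_num at this
    exact Nodes.eq_of_eq_two hu.1 (spine_mem i) e (congrFun h1 UI.one) (congrFun h1 UI.half)
  exact hu.2 (by rw [h2, spine_one])

lemma xi_conj (i : ℕ) : ∃ y ∈ Gens, xi i = x0⁻¹ ^ (i - 1) * y * x0 ^ (i - 1) := by
  rcases i with _ | i
  · exact ⟨x0, by simp, by simp [xi]⟩
  · exact ⟨x1, by simp, by simp [xi]⟩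

/-- Removing all carets from the domain side of `h`. -/
lemma exists_reduce (n : ℕ) : ∀ (h : Equiv.Perm ℝ) (a K K' : ℕ), (D h).Finite →
    (D h).ncard ≤ n → h • spine K = spine K' → (∀ j, rho j ∈ D h → a ≤ j - 1) → a ≤ K →
    ∃ p k, k ≤ (D h).ncard ∧ D (h * p) = ∅ ∧ D (h * p)⁻¹ ⊆ D h⁻¹ ∧
      (h * p) • spine (K + k) = spine K' ∧
      ∀ M, K + k ≤ M → WL (x0 ^ a * p * x0⁻¹ ^ M) (k + (M - a)) := by
  induction n with
  | zero =>
    intro h a K K' hfin hn hK ha haK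
    have hD : D h = ∅ := by rwa [Nat.le_zero, ncard_eq_zero hfin] at hn
    refine ⟨1, 0, by omega, by rwa [mul_one], by rw [mul_one], by rwa [mul_one, add_zero],
      fun M hM => ?_⟩
    obtain ⟨d, rfl⟩ := Nat.exists_eq_add_of_le (show a ≤ M by omega)
    have : x0 ^ a * 1 * x0⁻¹ ^ (a + d) = x0⁻¹ ^ d := by
      rw [mul_one, pow_add, ← mul_assoc, inv_pow, mul_inv_cancel, one_mul]
    rw [this]
    exact (WL.pow_x0_inv d).mono (by omega)
  | succ n ih =>
    intro h a K K' hfin hn hK ha haK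
    rcases (D h).eq_empty_or_nonempty with hD | hD
    · refine ⟨1, 0, by omega, by rwa [mul_one], by rw [mul_one], by rwa [mul_one, add_zero],
        fun M hM => ?_⟩
      obtain ⟨d, rfl⟩ := Nat.exists_eq_add_of_le (show a ≤ M by omega)
      have : x0 ^ a * 1 * x0⁻¹ ^ (a + d) = x0⁻¹ ^ d := by
        rw [mul_one, pow_add, ← mul_assoc, inv_pow, mul_inv_cancel, one_mul]
      rw [this]
      exact (WL.pow_x0_inv d).mono (by omega)
    classical
    have hex := exists_rho_mem_D hD
    obtain ⟨i, hi, hmin⟩ : ∃ i, rho i ∈ D h ∧ ∀ j, rho j ∈ D h → i ≤ j :=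
      ⟨Nat.find hex, Nat.find_spec hex, fun j hj => Nat.find_min' hex hj⟩
    have hiK := rho_mem_D_lt hK hi
    have hsub : (fun u => xi i • u) '' D (h * xi i) ⊆ D h \ {rho i} := by
      rintro _ ⟨u, ⟨hu, hu'⟩, rfl⟩
      exact ⟨⟨xi_smul_Ns i hu, by rwa [mul_smul] at hu'⟩, xi_smul_ne_rho i hu⟩
    have hinj : InjOn (fun u : UI → ℝ => xi i • u) (D (h * xi i)) :=
      (MulAction.injective (xi i)).injOn
    have hfin' : (D (h * xi i)).Finite :=
      Finite.of_finite_image (hfin.sdiff.subset hsub) hinj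
    have hcard : (D (h * xi i)).ncard + 1 ≤ (D h).ncard := by
      rw [← hinj.ncard_image]
      have h1 := ncard_le_ncard hsub hfin.sdiff
      have h2 := ncard_sdiff_singleton_add_one hi hfin
      omega
    have hK1 : (h * xi i) • spine (K + 1) = spine K' := by
      rw [mul_smul, xi_spine (by omega), hK]
    have hroots : ∀ j, rho j ∈ D (h * xi i) → i - 1 ≤ j - 1 := by
      intro j hj
      by_contra hlt
      have hji : j < i := by omega
      have h1 := hj.2
      rw [mul_smul, xi_rho_lt hji] at h1
      exact absurd (hmin j ⟨rho_mem_Ns j, h1⟩) (by omega)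
    obtain ⟨p, k, hk, hp1, hp2, hp3, hp4⟩ := ih (h * xi i) (i - 1) (K + 1) K' hfin' (by omega) hK1
      hroots (by omega)
    refine ⟨xi i * p, k + 1, by omega, by rwa [← mul_assoc], ?_, ?_, ?_⟩
    · rw [← mul_assoc]
      refine hp2.trans ?_
      rintro u ⟨hu, hu'⟩
      refine ⟨hu, fun h1 => hu' ?_⟩
      rw [mul_inv_rev, mul_smul]
      refine xi_inv_smul_Ns i h1 fun e => hi.2 ?_
      rw [← e, smul_inv_smul]; exact hu
    · rw [← mul_assoc, show K + (k + 1) = K + 1 + k by ring]; exact hp3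
    · intro M hM
      obtain ⟨y, hy, e⟩ := xi_conj i
      have hai := ha i hi
      obtain ⟨d, hd⟩ := Nat.exists_eq_add_of_le hai
      have e2 : x0 ^ a * (xi i * p) * x0⁻¹ ^ M = x0⁻¹ ^ d * y * (x0 ^ (i - 1) * p * x0⁻¹ ^ M) := by
        have e3 : x0 ^ a * x0⁻¹ ^ (i - 1) = x0⁻¹ ^ d := by
          rw [hd, pow_add, ← mul_assoc, inv_pow, mul_inv_cancel, one_mul]
        rw [e, ← e3]; simp only [mul_assoc]
      rw [e2]
      exact (((WL.pow_x0_inv d).mul (WL.gen hy)).mul (hp4 M (by omega))).mono (by omega)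

lemma rho_lt {i j : ℕ} (h : i < j) (s t : UI) : rho i s < rho j t := by
  obtain ⟨d, rfl⟩ := Nat.exists_eq_add_of_lt h
  have h1 := s.2.2; have h2 := t.2.1
  have hi : (0 : ℝ) < 2 ^ i := by positivity
  have hd : (1 : ℝ) ≤ 2 ^ d := one_le_pow₀ (by norm_num)
  rw [rho_val, rho_val]
  have : (1 - (t : ℝ) / 2) / 2 ^ (i + d + 1) < (1 - (s : ℝ) / 2) / 2 ^ i := by
    have e : (1 - (t : ℝ) / 2) / 2 ^ (i + d + 1) = ((1 - (t : ℝ) / 2) / (2 ^ d * 2)) / 2 ^ i := by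
      rw [show i + d + 1 = d + 1 + i by ring, pow_add, pow_succ, div_div]
    rw [e, div_lt_div_iff_of_pos_right hi, div_lt_iff₀ (by positivity)]
    nlinarith
  linarith

lemma rho_index {i j : ℕ} {s t : UI} (h : rho i s = rho j t) : i = j := by
  rcases lt_trichotomy i j with h1 | h1 | h1
  · exact absurd h (rho_lt h1 s t).ne
  · exact h1
  · exact absurd h (rho_lt h1 t s).ne'

lemma IsCell.eq_id_of_comp {γ δ : UI → UI} (hγ : IsCell γ) (hδ : IsCell δ) (h : δ ∘ γ = id) :
    γ = id := by
  obtain ⟨a, w, hw, ha, haw, e⟩ := Nodes.affine hγ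
  obtain ⟨a', w', hw', ha', haw', e'⟩ := Nodes.affine hδ
  have h1 := e' (γ UI.one)
  have h2 := e' (γ UI.half)
  have h3 : δ (γ UI.one) = UI.one := congrFun h _
  have h4 : δ (γ UI.half) = UI.half := congrFun h _
  have h5 := e UI.one
  have h6 := e UI.half
  simp only [h3, h4, h5, h6, UI.one_val, UI.half_val] at h1 h2
  have hww : w' * w = 1 := by linarith
  have hw1 : w = 1 := by nlinarith
  have ha0 : a = 0 := by linarith
  funext s
  apply UI.ext'
  have := e s
  simp only [this, ha0, hw1]
  simp

/-- A monotone permutation preserving `Ns` in both directions is the identity. -/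
lemma eq_one_of_D_empty {h : Equiv.Perm ℝ} (hm : StrictMono h) (h0 : ∀ x ≤ 0, h x = x)
    (h1 : ∀ x, 1 ≤ x → h x = x) (hD : D h = ∅) (hE : D h⁻¹ = ∅) : h = 1 := by
  have key : ∀ h : Equiv.Perm ℝ, D h = ∅ → D h⁻¹ = ∅ → ∀ j, ∃ j', h • rho j = rho j' := by
    intro h hD hE j
    have a1 : h • rho j ∈ Ns := by
      by_contra hn
      exact (hD ▸ (show rho j ∈ D h from ⟨rho_mem_Ns j, hn⟩) : rho j ∈ (∅ : Set (UI → ℝ)))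
    obtain ⟨j', γ, hγ, e⟩ := Ns.eq_rho a1
    have a2 : h⁻¹ • rho j' ∈ Ns := by
      by_contra hn
      exact (hE ▸ (show rho j' ∈ D h⁻¹ from ⟨rho_mem_Ns j', hn⟩) : rho j' ∈ (∅ : Set (UI → ℝ)))
    obtain ⟨j'', δ, hδ, e'⟩ := Ns.eq_rho a2
    have e2 : rho j = rho j'' ∘ (δ ∘ γ) := by
      rw [← Function.comp_assoc, ← e', ← smul_comp, ← e, inv_smul_smul]
    have hj : j = j'' := rho_index (congrFun e2 UI.one)
    subst hj
    have hid : δ ∘ γ = id := by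
      funext s
      exact ((Nodes.strictMono (rho_mem j)).injective (congrFun e2 s)).symm
    rw [hγ.eq_id_of_comp hδ hid] at e
    exact ⟨j', e⟩
  choose σ hσ using key h hD hE
  choose τ hτ using key h⁻¹ hE (by rwa [inv_inv])
  have mono : ∀ (h : Equiv.Perm ℝ) (σ : ℕ → ℕ), StrictMono h → (∀ j, h • rho j = rho (σ j)) →
      StrictMono σ := by
    intro h σ hm hσ i j hij
    by_contra hle
    have h2 := hm (rho_lt hij UI.one UI.one)
    rw [← perm_smul_apply, ← perm_smul_apply, hσ, hσ] at h2
    rcases eq_or_lt_of_le (not_lt.1 hle) with e | hl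
    · rw [e] at h2; exact lt_irrefl _ h2
    · exact absurd (rho_lt hl UI.one UI.one) (not_lt.2 h2.le)
  have fix : ∀ j, h • rho j = rho j := by
    intro j
    have a1 := (mono h σ hm hσ).id_le j
    have a2 := (mono h⁻¹ τ (strictMono_inv hm) hτ).id_le (σ j)
    have a3 : τ (σ j) = j := by
      have : rho (τ (σ j)) = rho j := by rw [← hτ, ← hσ, inv_smul_smul]
      exact rho_index (congrFun this UI.one)
    simp only [id] at a1 a2
    rw [hσ, show σ j = j by omega]
  ext x
  rw [Equiv.Perm.one_apply]
  rcases le_or_gt x 0 with hx | hx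
  · exact h0 x hx
  rcases le_or_gt 1 x with hx' | hx'
  · exact h1 x hx'
  · obtain ⟨N, hN⟩ := exists_pow_lt_of_lt_one (sub_pos.2 hx') (show (1 / 2 : ℝ) < 1 by norm_num)
    obtain ⟨m, hm', hxm⟩ := exists_node_mem hx hx'.le (N + 1)
    have hNs : node (N + 1) m ∈ Ns := by
      refine ⟨node_mem hm', fun e => ?_⟩
      have := node_sub_lt hxm ⟨UI.one, e⟩
      rw [div_pow, one_pow] at hN
      have h3 : (1 : ℝ) / 2 ^ (N + 1) ≤ 1 / 2 ^ N := by
        apply one_div_le_one_div_of_le (by positivity)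
        exact pow_le_pow_right₀ (by norm_num) (by omega)
      linarith
    obtain ⟨j, γ, hγ, e⟩ := Ns.eq_rho hNs
    obtain ⟨s, rfl⟩ := hxm
    rw [e]
    exact congrFun (fix j) (γ s)

lemma spine_inj {k k' : ℕ} (h : spine k = spine k') : k = k' := by
  have : rho k = rho k' := by rw [rho, rho, h]
  exact rho_index (congrFun this UI.one)

/-- A monotone permutation with finitely many carets lies in Thompson's group, with an explicit
length bound. -/
theorem mem_and_wordLength_le {h : Equiv.Perm ℝ} (hm : StrictMono h) (h0 : ∀ x ≤ 0, h x = x)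
    (h1 : ∀ x, 1 ≤ x → h x = x) (hD : (D h).Finite) (hE : (D h⁻¹).Finite) {K K' : ℕ}
    (hK : h • spine K = spine K') :
    h ∈ ThompsonF ∧ wordLength h ≤ 2 * ((D h).ncard + (D h⁻¹).ncard) + K + K' := by
  obtain ⟨p, k, hk, a1, a2, a3, a4⟩ :=
    exists_reduce _ h 0 K K' hD le_rfl hK (fun _ _ => Nat.zero_le _) (Nat.zero_le _)
  have hD1 : (D (h * p)⁻¹).Finite := hE.subset a2
  obtain ⟨q, k', hk', b1, b2, b3, b4⟩ :=
    exists_reduce _ (h * p)⁻¹ 0 K' (K + k) hD1 le_rfl (by rw [← a3, inv_smul_smul])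
      (fun _ _ => Nat.zero_le _) (Nat.zero_le _)
  have hle := ncard_le_ncard a2 hE
  have wp : WL (p * x0⁻¹ ^ (K + k)) (k + (K + k)) := by simpa using a4 (K + k) le_rfl
  have wq : WL (q * x0⁻¹ ^ (K' + k')) (k' + (K' + k')) := by simpa using b4 (K' + k') le_rfl
  have hx0 : x0 ∈ ThompsonF := Subgroup.subset_closure (by simp)
  have hp : p ∈ ThompsonF := by
    have := mul_mem wp.mem (pow_mem hx0 (K + k))
    rwa [mul_assoc, inv_pow, inv_mul_cancel, mul_one] at this
  have hq : q ∈ ThompsonF := by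
    have := mul_mem wq.mem (pow_mem hx0 (K' + k'))
    rwa [mul_assoc, inv_pow, inv_mul_cancel, mul_one] at this
  have rp := Reg.of_mem hp
  have rq := Reg.of_mem hq
  have hone : (h * p)⁻¹ * q = 1 := by
    apply eq_one_of_D_empty _ _ _ b1
    · rw [inv_inv, a1] at b2
      exact subset_empty_iff.1 b2
    · exact (strictMono_inv (f := h * p) (hm.comp rp.mono)).comp rq.mono
    · intro x hx
      rw [Equiv.Perm.mul_apply, rq.nonpos x hx, Equiv.Perm.inv_eq_iff_eq, Equiv.Perm.mul_apply,
        rp.nonpos x hx, h0 x hx]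
    · intro x hx
      rw [Equiv.Perm.mul_apply, rq.one_le x hx, Equiv.Perm.inv_eq_iff_eq, Equiv.Perm.mul_apply,
        rp.one_le x hx, h1 x hx]
  have hM : K' + k' = K + k := by
    rw [hone, one_smul] at b3
    exact spine_inj b3
  have hq' : q = h * p := by rw [inv_mul_eq_one] at hone; exact hone.symm
  have he : h = (q * x0⁻¹ ^ (K' + k')) * (p * x0⁻¹ ^ (K + k))⁻¹ := by
    rw [hq', hM]; group
  have hw : WL h (k' + (K' + k') + (k + (K + k))) := by
    conv => arg 1; rw [he]
    exact wq.mul wp.inv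
  exact ⟨hw.mem, hw.wordLength_le.trans (by omega)⟩

/-- `x` and `y` lie in a common node which `f` maps to a node. -/
def Near (f : Equiv.Perm ℝ) (x y : ℝ) : Prop :=
  ∃ t ∈ Nodes, x ∈ range t ∧ y ∈ range t ∧ f • t ∈ Nodes

/-- Midpoints of the nodes that `f` does not map to nodes. -/
def Mid (f : Equiv.Perm ℝ) : Set ℝ := image (fun u : UI → ℝ => u UI.half) (T f)

/-- Nodes whose forward and backward iterates both leave the set of nodes. -/
def Pf (f : Equiv.Perm ℝ) : Set (UI → ℝ) :=
  {u | u ∈ Nodes ∧ (∃ i : ℕ, f ^ i • u ∉ Nodes) ∧ ∃ j : ℕ, f⁻¹ ^ j • u ∉ Nodes}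

lemma Reg.finMid {f : Equiv.Perm ℝ} (hf : Reg f) : (Mid f).Finite := hf.finT.image _

lemma Near.symm {f : Equiv.Perm ℝ} {x y : ℝ} (h : Near f x y) : Near f y x := by
  obtain ⟨t, h1, h2, h3, h4⟩ := h
  exact ⟨t, h1, h3, h2, h4⟩

lemma near_comm {f : Equiv.Perm ℝ} {x y : ℝ} : Near f x y ↔ Near f y x :=
  ⟨Near.symm, Near.symm⟩

lemma Near.sub {f : Equiv.Perm ℝ} {x y a b : ℝ} (h : Near f x y) (ha : a ∈ Icc x y)
    (hb : b ∈ Icc x y) : Near f a b := by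
  obtain ⟨t, h1, h2, h3, h4⟩ := h
  exact ⟨t, h1, Nodes.convex h1 h2 h3 ha.1 ha.2, Nodes.convex h1 h2 h3 hb.1 hb.2, h4⟩

lemma mem_range_smul {f : Equiv.Perm ℝ} {t : UI → ℝ} {x : ℝ} (h : x ∈ range t) :
    f x ∈ range (f • t) := by
  obtain ⟨s, rfl⟩ := h
  exact ⟨s, rfl⟩

lemma Near.map {f : Equiv.Perm ℝ} {x y : ℝ} (h : Near f x y) : Near f⁻¹ (f x) (f y) := by
  obtain ⟨t, h1, h2, h3, h4⟩ := h
  exact ⟨f • t, h4, mem_range_smul h2, mem_range_smul h3, by rwa [inv_smul_smul]⟩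

lemma near_inv_iff {f : Equiv.Perm ℝ} {x y : ℝ} : Near f⁻¹ (f x) (f y) ↔ Near f x y := by
  refine ⟨fun h => ?_, Near.map⟩
  have := h.map
  simpa using this

lemma not_near_iff {f : Equiv.Perm ℝ} {x y : ℝ} (h0 : 0 < x) (hxy : x < y) (h1 : y ≤ 1) :
    ¬ Near f x y ↔ ∃ m ∈ Mid f, x ≤ m ∧ m < y := by
  constructor
  · intro h
    obtain ⟨u, hu, hx, hy, hxm, hmy⟩ := exists_split_node h0 hxy h1
    exact ⟨u UI.half, ⟨u, ⟨hu, fun h' => h ⟨u, hu, hx, hy, h'⟩⟩, rfl⟩, hxm, hmy⟩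
  · rintro ⟨_, ⟨t, ⟨ht, hft⟩, rfl⟩, hxm, hmy⟩ ⟨r, hr, hx, hy, hfr⟩
    simp only at hxm hmy
    have hm : t UI.half ∈ range r := Nodes.convex hr hx hy hxm hmy.le
    rcases Nodes.comparable hr ht hm (mem_range_self _) with ⟨γ, hγ, e⟩ | ⟨γ, hγ, rfl⟩
    · rcases hγ.cases with rfl | ⟨δ, hδ, rfl⟩ | ⟨δ, hδ, rfl⟩
      · rw [Function.comp_id] at e; rw [e] at hfr; exact hft hfr
      · obtain ⟨s, rfl⟩ := hy
        have := Nodes.le_half ht (x := r s) ⟨δ s, by rw [e]; rfl⟩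
        linarith
      · obtain ⟨s, rfl⟩ := hx
        have := Nodes.half_lt ht (x := r s) ⟨δ s, by rw [e]; rfl⟩
        linarith
    · exact hft (by rw [smul_comp]; exact Nodes.comp hfr hγ)

lemma node_depth_inj {k m k' m' : ℕ} (h : node k m = node k' m') : k = k' := by
  have h1 := congrFun h UI.one
  have h2 := congrFun h UI.half
  simp only [node, UI.one_val, UI.half_val] at h1 h2
  have h3 : (1 / 2 : ℝ) / 2 ^ k = (1 / 2) / 2 ^ k' := by
    have e : ∀ (c : ℕ) (a b d : ℝ), (a + 1) / 2 ^ c - (a + 1 / 2) / 2 ^ c = (1 / 2) / 2 ^ c := by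
      intro c a _ _; rw [← sub_div]; ring
    rw [← e k m 0 0, ← e k' m' 0 0, h1, h2]
  have h4 : (2 : ℝ) ^ k = 2 ^ k' := by
    field_simp at h3; exact h3.symm
  exact Nat.pow_right_injective le_rfl (by exact_mod_cast h4)

/-- Small nodes around a point are mapped to nodes. -/
lemma Reg.exists_good {f : Equiv.Perm ℝ} (hf : Reg f) {x ε : ℝ} (h0 : 0 < x) (h1 : x ≤ 1)
    (hε : 0 < ε) : ∃ t ∈ Nodes, x ∈ range t ∧ f • t ∈ Nodes ∧ ∀ y ∈ range t, |y - x| < ε := by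
  obtain ⟨N, hN⟩ := exists_pow_lt_of_lt_one hε (show (1 / 2 : ℝ) < 1 by norm_num)
  choose m hm hx using fun k => exists_node_mem h0 h1 (N + k)
  have hinj : Function.Injective fun k => node (N + k) (m k) := by
    intro a b hab
    have := node_depth_inj hab
    omega
  obtain ⟨k, hk⟩ : ∃ k, node (N + k) (m k) ∉ T f := by
    by_contra! H
    exact (infinite_of_injective_forall_mem hinj H) hf.finT
  refine ⟨node (N + k) (m k), node_mem (hm k), hx k, ?_, fun y hy => ?_⟩
  · by_contra h; exact hk ⟨node_mem (hm k), h⟩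
  · have h2 := node_sub_lt (hx k) hy
    have h3 := node_sub_lt hy (hx k)
    have h4 : (1 : ℝ) / 2 ^ (N + k) ≤ 1 / 2 ^ N :=
      one_div_le_one_div_of_le (by positivity) (pow_le_pow_right₀ (by norm_num) (by omega))
    rw [div_pow, one_pow] at hN
    rw [abs_lt]
    constructor <;> linarith

lemma Reg.near_self {f : Equiv.Perm ℝ} (hf : Reg f) {x : ℝ} (h0 : 0 < x) (h1 : x ≤ 1) :
    Near f x x := by
  obtain ⟨t, ht, hx, hft, -⟩ := hf.exists_good h0 h1 one_pos
  exact ⟨t, ht, hx, hx, hft⟩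

lemma Reg.pos {f : Equiv.Perm ℝ} (hf : Reg f) {x : ℝ} (h : 0 < x) : 0 < f x := by
  have := hf.mono h
  rwa [hf.nonpos 0 le_rfl] at this

lemma Reg.lt_one {f : Equiv.Perm ℝ} (hf : Reg f) {x : ℝ} (h : x < 1) : f x < 1 := by
  have := hf.mono h
  rwa [hf.one_le 1 le_rfl] at this

lemma Reg.le_one {f : Equiv.Perm ℝ} (hf : Reg f) {x : ℝ} (h : x ≤ 1) : f x ≤ 1 := by
  have := hf.mono.monotone h
  rwa [hf.one_le 1 le_rfl] at this

lemma Reg.pow {f : Equiv.Perm ℝ} (hf : Reg f) (n : ℕ) : Reg (f ^ n) := by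
  induction n with
  | zero => rw [pow_zero]; exact Reg.one
  | succ n ih => rw [pow_succ]; exact ih.mul hf

lemma Reg.zpow {f : Equiv.Perm ℝ} (hf : Reg f) (n : ℤ) : Reg (f ^ n) := by
  rcases n with n | n
  · rw [Int.ofNat_eq_natCast, zpow_natCast]; exact hf.pow n
  · rw [zpow_negSucc]; exact (hf.pow _).inv

lemma zpow_succ_apply (f : Equiv.Perm ℝ) (k : ℤ) (x : ℝ) : (f ^ (k + 1)) x = f ((f ^ k) x) := by
  rw [add_comm, zpow_add, zpow_one, Equiv.Perm.mul_apply]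

lemma zpow_add_apply (f : Equiv.Perm ℝ) (k l : ℤ) (x : ℝ) :
    (f ^ (k + l)) x = (f ^ k) ((f ^ l) x) := by
  rw [zpow_add, Equiv.Perm.mul_apply]

lemma Reg.orbit_strictMono {f : Equiv.Perm ℝ} (hf : Reg f) {x : ℝ} (h : x < f x) :
    StrictMono fun k : ℤ => (f ^ k) x := by
  apply strictMono_int_of_lt_succ
  intro k
  have := (hf.zpow k).mono h
  rwa [show (f ^ k) (f x) = (f ^ (k + 1)) x by rw [zpow_add_apply, zpow_one]] at this

/-- Pairwise disjoint half-open intervals meeting a finite set are at most as many as its points. -/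
lemma card_le_of_crossed {y : ℤ → ℝ} (hy : Monotone y) {M : Set ℝ} (hM : M.Finite) (S : Finset ℤ)
    (h : ∀ k ∈ S, ∃ m ∈ M, y k ≤ m ∧ m < y (k + 1)) : S.card ≤ M.ncard := by
  choose! φ h1 h2 h3 using h
  have hinj : InjOn φ (S : Set ℤ) := by
    intro a ha b hb hab
    rcases lt_trichotomy a b with hl | hl | hl
    · have e1 := hy (show a + 1 ≤ b by omega)
      have e2 := h3 a ha
      have e3 := h2 b hb
      rw [hab] at e2
      linarith
    · exact hl
    · have e1 := hy (show b + 1 ≤ a by omega)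
      have e2 := h3 b hb
      have e3 := h2 a ha
      rw [hab] at e3
      linarith
  rw [← ncard_coe_finset S, ← hinj.ncard_image]
  exact ncard_le_ncard (by rintro _ ⟨k, hk, rfl⟩; exact h1 k hk) hM

lemma pow_smul_add (f : Equiv.Perm ℝ) (a b : ℕ) (u : UI → ℝ) : f ^ (a + b) • u = f ^ a • f ^ b • u := by
  rw [pow_add, mul_smul]

/-- A chain of consecutive images of a node that starts and ends by leaving the nodes has length
bounded by the number of break points. -/
lemma Reg.chain_le {f : Equiv.Perm ℝ} (hf : Reg f) {v : UI → ℝ} {L : ℕ}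
    (hv : ∀ k ≤ L, f ^ k • v ∈ Nodes) (hstart : f⁻¹ • v ∉ Nodes) (hend : f ^ (L + 1) • v ∉ Nodes) :
    L ≤ (Mid f).ncard := by
  have hv0 : v ∈ Nodes := by simpa using hv 0 (Nat.zero_le _)
  set x := v UI.half with hx
  have hxv : ∀ k : ℕ, (f ^ k) x ∈ range (f ^ k • v) := fun k => ⟨UI.half, rfl⟩
  have hbad : ∀ k ≤ L, ∀ r γ, IsCell γ → r ∈ Nodes → f ^ k • v = r ∘ γ →
      ((∃ γ, IsCell γ ∧ f • r = r ∘ γ) ∨ (∃ γ, IsCell γ ∧ f⁻¹ • r = r ∘ γ)) → False := by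
    intro k hk r γ hγ hr e h
    rcases h with ⟨δ, hδ, e'⟩ | ⟨δ, hδ, e'⟩
    · apply hend
      rw [show L + 1 = (L + 1 - k) + k by omega, pow_smul_add, e, smul_comp]
      exact Nodes.comp (Nodes.pow_smul_mem hr hδ e' _) hγ
    · apply hstart
      have : f⁻¹ • v = f⁻¹ ^ (k + 1) • (f ^ k • v) := by
        rw [← mul_smul, pow_succ', mul_assoc, inv_pow, inv_mul_cancel, mul_one]
      rw [this, e, smul_comp]
      exact Nodes.comp (Nodes.pow_smul_mem hr hδ e' _) hγ
  have hnear : ∀ k < L, ¬ Near f ((f ^ k) x) ((f ^ (k + 1)) x) := by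
    rintro k hk ⟨r, hr, h1, h2, hfr⟩
    have e1 : (f ^ (k + 1)) x ∈ range (f • r) := by
      rw [pow_succ', Equiv.Perm.mul_apply]; exact mem_range_smul h1
    rcases Nodes.comparable (hv k hk.le) hr (hxv k) h1 with ⟨γ, hγ, e⟩ | ⟨γ, hγ, e⟩
    · exact hbad k hk.le r γ hγ hr e (Nodes.nested hr hfr h2 e1)
    · have h3 : (f ^ (k + 1)) x ∈ range (f ^ k • v) := by
        obtain ⟨s, hs⟩ := h2
        rw [e] at hs
        exact ⟨γ s, hs⟩
      have h4 : f • (f ^ k • v) = f ^ (k + 1) • v := by rw [pow_succ', mul_smul]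
      refine hbad k hk.le (f ^ k • v) id isCell_id (hv k hk.le) rfl
        (Nodes.nested (hv k hk.le) ?_ h3 ?_)
      · rw [h4]; exact hv (k + 1) hk
      · rw [h4]; exact hxv (k + 1)
  rcases Nat.eq_zero_or_pos L with rfl | hL
  · exact Nat.zero_le _
  have x0' := Nodes.pos hv0 UI.half
  have x1' := Nodes.le_one hv0 UI.half
  rw [← hx] at x0' x1'
  rcases lt_trichotomy x (f x) with hlt | heq | hgt
  · have hmono := hf.orbit_strictMono hlt
    have := card_le_of_crossed hmono.monotone hf.finMid
      ((Finset.range L).map ⟨fun n : ℕ => (n : ℤ), fun a b h => by simpa using h⟩) (by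
        intro k hk
        simp only [Finset.mem_map, Finset.mem_range] at hk
        obtain ⟨n, hn, rfl⟩ := hk
        have h5 := hnear n hn
        have h6 : (f ^ n) x < (f ^ (n + 1)) x := by
          have := hmono (show (n : ℤ) < n + 1 by omega)
          exact_mod_cast this
        rw [not_near_iff ((hf.pow n).pos x0') h6 ((hf.pow _).le_one x1')] at h5
        exact_mod_cast h5)
    simpa using this
  · exfalso
    apply hnear 0 hL
    simp only [pow_zero, zero_add, pow_one, Equiv.Perm.one_apply, ← heq]
    exact hf.near_self x0' x1'
  · have hlt' : x < f⁻¹ x := by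
      rw [← hf.mono.lt_iff_lt]; simpa using hgt
    have hmono := hf.inv.orbit_strictMono hlt'
    have := card_le_of_crossed hmono.monotone hf.finMid
      ((Finset.range L).map ⟨fun n : ℕ => -(n : ℤ) - 1, fun a b h => by simpa using h⟩) (by
        intro k hk
        simp only [Finset.mem_map, Finset.mem_range] at hk
        obtain ⟨n, hn, rfl⟩ := hk
        have h5 := hnear n hn
        have e1 : (f⁻¹ ^ (-(n : ℤ) - 1)) x = (f ^ (n + 1)) x := by
          rw [inv_zpow', neg_sub, sub_neg_eq_add, add_comm]; norm_cast
        have e2 : (f⁻¹ ^ (-(n : ℤ) - 1 + 1)) x = (f ^ n) x := by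
          rw [sub_add_cancel, inv_zpow', neg_neg]; norm_cast
        have h6 : (f ^ (n + 1)) x < (f ^ n) x := by
          have := hmono (show -(n : ℤ) - 1 < -(n : ℤ) - 1 + 1 by omega)
          simp only at this
          rwa [e1, e2] at this
        rw [near_comm, not_near_iff ((hf.pow _).pos x0') h6 ((hf.pow _).le_one x1')] at h5
        obtain ⟨m, hm, h7, h8⟩ := h5
        exact ⟨m, hm, e1.trans_le h7, h8.trans_eq e2.symm⟩)
    simpa using this

lemma Pf_inv (f : Equiv.Perm ℝ) : Pf f⁻¹ = Pf f := by
  ext u; simp only [Pf, mem_ofPred_eq, inv_inv]; tauto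

lemma exists_last {P : ℕ → Prop} (h0 : P 0) (h : ∃ n, ¬ P n) :
    ∃ i, (∀ k ≤ i, P k) ∧ ¬ P (i + 1) := by
  classical
  have hs := Nat.find_spec h
  have hpos : Nat.find h ≠ 0 := fun e => by rw [e] at hs; exact hs h0
  refine ⟨Nat.find h - 1, fun k hk => ?_, ?_⟩
  · by_contra hk'
    have := Nat.find_min' h hk'
    omega
  · rwa [Nat.sub_add_cancel (Nat.one_le_iff_ne_zero.2 hpos)]

lemma Reg.Pf_subset {f : Equiv.Perm ℝ} (hf : Reg f) :
    Pf f ∩ Ns ⊆ (fun p : ℕ × (UI → ℝ) => f⁻¹ ^ p.1 • p.2) ''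
      ((Finset.range ((Mid f).ncard + 1) : Set ℕ) ×ˢ D f) := by
  rintro u ⟨⟨hu, hi, hj⟩, hNs⟩
  obtain ⟨i, hi1, hi2⟩ := exists_last (P := fun i => f ^ i • u ∈ Nodes) (by simpa using hu) hi
  obtain ⟨j, hj1, hj2⟩ := exists_last (P := fun i => f⁻¹ ^ i • u ∈ Nodes) (by simpa using hu) hj
  have hcancel : ∀ a : ℕ, f⁻¹ ^ a • f ^ a • u = u := fun a => by
    rw [← mul_smul, inv_pow, inv_mul_cancel, one_smul]
  have hcancel' : ∀ a : ℕ, f ^ a • f⁻¹ ^ a • u = u := fun a => by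
    rw [← mul_smul, inv_pow, mul_inv_cancel, one_smul]
  have hlen : j + i ≤ (Mid f).ncard := by
    apply hf.chain_le (v := f⁻¹ ^ j • u)
    · intro k hk
      rcases le_total k j with h | h
      · obtain ⟨d, rfl⟩ := Nat.exists_eq_add_of_le h
        have : f ^ k • f⁻¹ ^ (k + d) • u = f⁻¹ ^ d • u := by
          rw [pow_add, ← mul_smul, ← mul_assoc, inv_pow, mul_inv_cancel, one_mul]
        rw [this]; exact hj1 d (by omega)
      · obtain ⟨d, rfl⟩ := Nat.exists_eq_add_of_le h
        rw [show j + d = d + j by ring, pow_smul_add, hcancel']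
        exact hi1 d (by omega)
    · rwa [← mul_smul, ← pow_succ']
    · rw [show j + i + 1 = i + 1 + j by ring, pow_smul_add, hcancel']
      exact hi2
  refine ⟨(i, f ^ i • u), ⟨?_, ⟨hi1 i le_rfl, ?_⟩, ?_⟩, hcancel i⟩
  · simp only [Finset.coe_range, mem_Iio]; omega
  · intro h
    apply hNs.2
    have h2 := (hf.pow i).one_le 1 le_rfl
    exact (f ^ i).injective (h.trans h2.symm)
  · intro h
    apply hi2
    rw [pow_succ', mul_smul]
    exact h.1

lemma Pf_finite {f : Equiv.Perm ℝ} {n : ℕ} (hf : Reg f) (hc : Complexity f n) :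
    (Pf f ∩ Ns).Finite :=
  (((Finset.finite_toSet _).prod hc.finD).image _).subset hf.Pf_subset

lemma Complexity.Mid_ncard {f : Equiv.Perm ℝ} {n : ℕ} (hc : Complexity f n) :
    (Mid f).ncard ≤ n + 2 := (ncard_image_le hc.T_finite).trans hc.T_ncard

lemma Pf_ncard_aux {f : Equiv.Perm ℝ} {n : ℕ} (hf : Reg f) (hc : Complexity f n) :
    (Pf f ∩ Ns).ncard ≤ (n + 3) * (D f).ncard := by
  have h1 := ncard_le_ncard hf.Pf_subset (((Finset.finite_toSet _).prod hc.finD).image _)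
  have h2 := ncard_image_le (f := fun p : ℕ × (UI → ℝ) => f⁻¹ ^ p.1 • p.2)
    ((Finset.finite_toSet (Finset.range ((Mid f).ncard + 1))).prod hc.finD)
  rw [ncard_prod, ncard_coe_finset, Finset.card_range] at h2
  have h3 := hc.Mid_ncard
  exact h1.trans (h2.trans (Nat.mul_le_mul_right _ (by omega)))

/-- The number of nodes with two-sided finite orbit is quadratic in the word length. -/
lemma Pf_ncard {f : Equiv.Perm ℝ} {n : ℕ} (hf : Reg f) (hc : Complexity f n) :
    2 * (Pf f ∩ Ns).ncard ≤ (n + 3) * n := by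
  have h1 := Pf_ncard_aux hf hc
  have h2 := Pf_ncard_aux hf.inv hc.inv
  rw [Pf_inv] at h2
  have h3 := Nat.mul_le_mul_left (n + 3) hc.sum_le
  rw [mul_add] at h3
  omega

/-- A maximal interval without fixed points, with fixed end points. -/
structure Bump (f : Equiv.Perm ℝ) (z z' : ℝ) : Prop where
  nonneg : 0 ≤ z
  lt : z < z'
  le_one : z' ≤ 1
  left : f z = z
  right : f z' = z'
  ne : ∀ w, z < w → w < z' → f w ≠ w

/-- `y` is an orbit of `f`, run through forwards or backwards. -/
def IsOrb (f : Equiv.Perm ℝ) (y : ℤ → ℝ) : Prop :=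
  (∀ k, y (k + 1) = f (y k)) ∨ (∀ k, y k = f (y (k + 1)))

/-- An increasing orbit inside the interval `(z, z')`, converging to the end points. -/
structure IncOrb (f : Equiv.Perm ℝ) (z z' : ℝ) (y : ℤ → ℝ) : Prop where
  orb : IsOrb f y
  mono : StrictMono y
  gt : ∀ k, z < y k
  lt : ∀ k, y k < z'
  cof : ∀ w < z', ∃ k, w < y k
  cof' : ∀ w, z < w → ∃ k, y k < w

lemma Bump.inv {f : Equiv.Perm ℝ} {z z' : ℝ} (h : Bump f z z') : Bump f⁻¹ z z' where
  nonneg := h.nonneg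
  lt := h.lt
  le_one := h.le_one
  left := by rw [Equiv.Perm.inv_eq_iff_eq, h.left]
  right := by rw [Equiv.Perm.inv_eq_iff_eq, h.right]
  ne w h1 h2 := by
    rw [Ne, Equiv.Perm.inv_eq_iff_eq]; exact fun e => h.ne w h1 h2 e.symm

lemma Bump.exists_incOrb_of_lt {f : Equiv.Perm ℝ} (hf : Reg f) {z z' x : ℝ} (h : Bump f z z')
    (h1 : z < x) (h2 : x < z') (hx : x < f x) :
    ∃ y, IncOrb f z z' y ∧ y 0 = x ∧ ∀ k, y (k + 1) = f (y k) := by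
  have hmono := hf.orbit_strictMono hx
  set y : ℤ → ℝ := fun k => (f ^ k) x with hy
  have hstep : ∀ k, y (k + 1) = f (y k) := fun k => zpow_succ_apply f k x
  have hstep' : ∀ k, f (y (k - 1)) = y k := fun k => by
    have := hstep (k - 1); rw [sub_add_cancel] at this; exact this.symm
  have fixz : ∀ k : ℤ, (f ^ k) z = z := fun k =>
    Function.IsFixedPt.perm_zpow (show Function.IsFixedPt f z from h.left) k
  have fixz' : ∀ k : ℤ, (f ^ k) z' = z' := fun k =>
    Function.IsFixedPt.perm_zpow (show Function.IsFixedPt f z' from h.right) k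
  have hgt : ∀ k, z < y k := fun k => by
    have := (hf.zpow k).mono h1; rwa [fixz] at this
  have hlt : ∀ k, y k < z' := fun k => by
    have := (hf.zpow k).mono h2; rwa [fixz'] at this
  refine ⟨y, ⟨Or.inl hstep, hmono, hgt, hlt, ?_, ?_⟩, by simp [hy], hstep⟩
  · by_contra! H
    obtain ⟨w, hw, hyw⟩ := H
    have hlub := isLUB_csSup (range_nonempty y) ⟨w, by rintro _ ⟨k, rfl⟩; exact hyw k⟩
    set s := sSup (range y)
    have hs1 : z < s := (hgt 0).trans_le (hlub.1 (mem_range_self 0))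
    have hs2 : s < z' := (hlub.2 (by rintro _ ⟨k, rfl⟩; exact hyw k)).trans_lt hw
    rcases lt_or_gt_of_ne (h.ne s hs1 hs2) with hl | hl
    · obtain ⟨_, ⟨k, rfl⟩, hk⟩ := (lt_isLUB_iff hlub).1 hl
      have h3 := hk.trans (hmono (show k < k + 1 by omega))
      change f s < y (k + 1) at h3
      rw [hstep, hf.mono.lt_iff_lt] at h3
      exact absurd (hlub.1 (mem_range_self k)) (not_le.2 h3)
    · have hl' : f⁻¹ s < s := by rw [← hf.mono.lt_iff_lt]; simpa using hl
      obtain ⟨_, ⟨k, rfl⟩, hk⟩ := (lt_isLUB_iff hlub).1 hl'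
      rw [← hf.mono.lt_iff_lt, ← hstep] at hk
      rw [show f (f⁻¹ s) = s by simp] at hk
      exact absurd (hlub.1 (mem_range_self (k + 1))) (not_le.2 hk)
  · by_contra! H
    obtain ⟨w, hw, hyw⟩ := H
    have hglb := isGLB_csInf (range_nonempty y) ⟨w, by rintro _ ⟨k, rfl⟩; exact hyw k⟩
    set s := sInf (range y)
    have hs1 : s < z' := (hglb.1 (mem_range_self 0)).trans_lt (hlt 0)
    have hs2 : z < s := hw.trans_le (hglb.2 (by rintro _ ⟨k, rfl⟩; exact hyw k))
    rcases lt_or_gt_of_ne (h.ne s hs2 hs1) with hl | hl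
    · have hl' : s < f⁻¹ s := by rw [← hf.mono.lt_iff_lt]; simpa using hl
      obtain ⟨_, ⟨k, rfl⟩, hk⟩ := (isGLB_lt_iff hglb).1 hl'
      rw [← hf.mono.lt_iff_lt, ← hstep] at hk
      rw [show f (f⁻¹ s) = s by simp] at hk
      have h3 := (hmono (show k < k + 1 by omega)).trans hk
      exact absurd (hglb.1 (mem_range_self k)) (not_le.2 h3)
    · obtain ⟨_, ⟨k, rfl⟩, hk⟩ := (isGLB_lt_iff hglb).1 hl
      rw [← hstep', hf.mono.lt_iff_lt] at hk
      exact absurd (hglb.1 (mem_range_self (k - 1))) (not_le.2 hk)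

lemma lt_inv_of_lt {f : Equiv.Perm ℝ} (hf : Reg f) {x : ℝ} (h : f x < x) : x < f⁻¹ x := by
  rw [← hf.mono.lt_iff_lt]; simpa using h

lemma Bump.exists_incOrb_of_gt {f : Equiv.Perm ℝ} (hf : Reg f) {z z' x : ℝ} (h : Bump f z z')
    (h1 : z < x) (h2 : x < z') (hx : f x < x) :
    ∃ y, IncOrb f z z' y ∧ y 0 = x ∧ ∀ k, y k = f (y (k + 1)) := by
  obtain ⟨y, hy, hy0, hstep⟩ := h.inv.exists_incOrb_of_lt hf.inv h1 h2 (lt_inv_of_lt hf hx)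
  have hstep' : ∀ k, y k = f (y (k + 1)) := fun k => by rw [hstep]; simp
  exact ⟨y, ⟨Or.inr hstep', hy.mono, hy.gt, hy.lt, hy.cof, hy.cof'⟩, hy0, hstep'⟩

lemma Bump.exists_incOrb {f : Equiv.Perm ℝ} (hf : Reg f) {z z' x : ℝ} (h : Bump f z z')
    (h1 : z < x) (h2 : x < z') : ∃ y, IncOrb f z z' y ∧ y 0 = x := by
  rcases lt_or_gt_of_ne (h.ne x h1 h2) with hl | hl
  · obtain ⟨y, hy, hy0, -⟩ := h.exists_incOrb_of_gt hf h1 h2 hl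
    exact ⟨y, hy, hy0⟩
  · obtain ⟨y, hy, hy0, -⟩ := h.exists_incOrb_of_lt hf h1 h2 hl
    exact ⟨y, hy, hy0⟩

lemma orbit_forward {f : Equiv.Perm ℝ} {y : ℤ → ℝ} (h : ∀ k, y (k + 1) = f (y k)) (k : ℤ) (n : ℕ) :
    (f ^ n) (y k) = y (k + n) := by
  induction n with
  | zero => simp
  | succ n ih => rw [pow_succ', Equiv.Perm.mul_apply, ih, ← h]; congr 1; push_cast; ring

lemma orbit_backward {f : Equiv.Perm ℝ} {y : ℤ → ℝ} (h : ∀ k, y (k + 1) = f (y k)) (k : ℤ) (n : ℕ) :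
    (f⁻¹ ^ n) (y k) = y (k - n) := by
  rw [inv_pow, Equiv.Perm.inv_eq_iff_eq, orbit_forward h]; congr 1; ring

/-- Once consecutive orbit points are near, they stay near in one of the two directions. -/
lemma idle_nested_forward {f : Equiv.Perm ℝ} {y : ℤ → ℝ} (h : ∀ k, y (k + 1) = f (y k)) {k : ℤ}
    (hk : Near f (y k) (y (k + 1))) :
    (∀ j, k ≤ j → Near f (y j) (y (j + 1))) ∨ (∀ j, j ≤ k → Near f (y j) (y (j + 1))) := by
  obtain ⟨r, hr, h1, h2, hfr⟩ := hk
  rcases Nodes.nested hr hfr h2 (by rw [h]; exact mem_range_smul h1) with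
    ⟨γ, hγ, e⟩ | ⟨γ, hγ, e⟩
  · left
    intro j hj
    obtain ⟨n, rfl⟩ := Int.le.dest hj
    refine ⟨f ^ n • r, Nodes.pow_smul_mem hr hγ e n, ?_, ?_, ?_⟩
    · rw [← orbit_forward h]; exact mem_range_smul h1
    · rw [show k + n + 1 = k + 1 + n by ring, ← orbit_forward h]; exact mem_range_smul h2
    · rw [← mul_smul, ← pow_succ']; exact Nodes.pow_smul_mem hr hγ e _
  · right
    intro j hj
    obtain ⟨n, hn⟩ := Int.le.dest hj
    obtain rfl : j = k - n := by omega
    refine ⟨f⁻¹ ^ n • r, Nodes.pow_smul_mem hr hγ e n, ?_, ?_, ?_⟩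
    · rw [← orbit_backward h]; exact mem_range_smul h1
    · rw [show k - n + 1 = k + 1 - n by ring, ← orbit_backward h]; exact mem_range_smul h2
    · rcases n with _ | n
      · simpa using hfr
      · rw [pow_succ', mul_smul, smul_inv_smul]; exact Nodes.pow_smul_mem hr hγ e _

lemma idle_nested {f : Equiv.Perm ℝ} {y : ℤ → ℝ} (h : IsOrb f y) {k : ℤ}
    (hk : Near f (y k) (y (k + 1))) :
    (∀ j, k ≤ j → Near f (y j) (y (j + 1))) ∨ (∀ j, j ≤ k → Near f (y j) (y (j + 1))) := by
  rcases h with h | h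
  · exact idle_nested_forward h hk
  · have h' : ∀ k, (fun k => y (-k)) (k + 1) = f ((fun k => y (-k)) k) := by
      intro k
      have := h (-(k + 1))
      rw [show -(k + 1) + 1 = -k by ring] at this
      exact this
    have hk' : Near f (y (-(-k - 1))) (y (-(-k - 1 + 1))) := by
      rw [show -(-k - 1) = k + 1 by ring, show -(-k - 1 + 1) = k by ring]; exact hk.symm
    rcases idle_nested_forward (y := fun k => y (-k)) (k := -k - 1) h' hk' with H | H
    · right
      intro j hj
      have := H (-j - 1) (by omega)
      simp only [show -(-j - 1) = j + 1 by ring, show -(-j - 1 + 1) = j by ring] at this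
      exact this.symm
    · left
      intro j hj
      have := H (-j - 1) (by omega)
      simp only [show -(-j - 1) = j + 1 by ring, show -(-j - 1 + 1) = j by ring] at this
      exact this.symm

/-- A bounded increasing two-sided sequence cannot have geometric increments. -/
lemma not_geometric {y : ℤ → ℝ} (hy : StrictMono y) (h0 : ∀ k, 0 ≤ y k) (h1 : ∀ k, y k ≤ 1)
    (h : ∀ k, (y (k + 2) - y (k + 1)) ^ 2 = (y (k + 1) - y k) * (y (k + 3) - y (k + 2))) : False := by
  have hd : ∀ k, 0 < y (k + 1) - y k := fun k => sub_pos.2 (hy (by omega))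
  set ρ := (y 2 - y 1) / (y 1 - y 0) with hρ
  have hd0 : 0 < y 1 - y 0 := hd 0
  have hd1 : 0 < y 2 - y 1 := hd 1
  have key : ∀ k : ℤ, y (k + 2) - y (k + 1) = ρ * (y (k + 1) - y k) := by
    intro k
    induction k using Int.induction_on with
    | zero => rw [hρ]; norm_num; field_simp
    | succ i ih =>
      have h2 := h i
      have h3 := hd i
      have h4 := hd (i + 1)
      rw [show (i : ℤ) + 1 + 1 = i + 2 by ring] at h4 ⊢
      rw [show (i : ℤ) + 1 + 2 = i + 3 by ring]
      apply mul_left_cancel₀ h3.ne'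
      rw [← h2, sq]; nth_rewrite 1 [ih]; ring
    | pred i ih =>
      have h2 := h (-i - 1)
      have h3 := hd (-i)
      have h4 := hd (-i + 1)
      have h5 := hd (-i - 1)
      rw [show -(i : ℤ) + 1 + 1 = -i + 2 by ring] at h4
      rw [show -(i : ℤ) - 1 + 1 = -i by ring] at h2 h5 ⊢
      rw [show -(i : ℤ) - 1 + 2 = -i + 1 by ring] at h2 ⊢
      rw [show -(i : ℤ) - 1 + 3 = -i + 2 by ring] at h2
      rw [ih] at h2
      apply mul_left_cancel₀ h3.ne'
      rw [← sq, h2]; ring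
  have hρ0 : 0 < ρ := div_pos hd1 hd0
  obtain ⟨N, hN⟩ := exists_nat_gt (1 / (y 1 - y 0))
  rw [div_lt_iff₀ hd0] at hN
  rcases le_total 1 ρ with hle | hle
  · have hge : ∀ n : ℕ, y 1 - y 0 ≤ y (n + 1) - y n := by
      intro n
      induction n with
      | zero => simp
      | succ n ih =>
        have := key n
        have := hd n
        push_cast
        rw [show (n : ℤ) + 1 + 1 = n + 2 by ring, key n]
        nlinarith
    have hsum : ∀ n : ℕ, y 0 + n * (y 1 - y 0) ≤ y n := by
      intro n
      induction n with
      | zero => simp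
      | succ n ih => have := hge n; push_cast; linarith
    have := hsum N
    linarith [h1 N, h0 0]
  · have hge : ∀ n : ℕ, y 1 - y 0 ≤ y (-n + 1) - y (-n) := by
      intro n
      induction n with
      | zero => simp
      | succ n ih =>
        have h2 := key (-n - 1)
        have h3 := hd (-n - 1)
        rw [show -(n : ℤ) - 1 + 2 = -n + 1 by ring, show -(n : ℤ) - 1 + 1 = -n by ring] at h2
        rw [show -(n : ℤ) - 1 + 1 = -n by ring] at h3
        push_cast
        rw [show -((n : ℤ) + 1) + 1 = -n by ring, show -((n : ℤ) + 1) = -n - 1 by ring]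
        nlinarith
    have hsum : ∀ n : ℕ, y (-n) ≤ y 0 - n * (y 1 - y 0) := by
      intro n
      induction n with
      | zero => simp
      | succ n ih =>
        have h3 := hge (n + 1)
        push_cast at h3 ⊢
        rw [show -((n : ℤ) + 1) + 1 = -n by ring] at h3
        linarith
    have := hsum N
    linarith [h0 (-N), h1 0]

lemma IncOrb.pos {f : Equiv.Perm ℝ} {z z' : ℝ} {y : ℤ → ℝ} (h : Bump f z z')
    (hy : IncOrb f z z' y) (k : ℤ) : 0 < y k := h.nonneg.trans_lt (hy.gt k)

lemma IncOrb.le_one {f : Equiv.Perm ℝ} {z z' : ℝ} {y : ℤ → ℝ} (h : Bump f z z')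
    (hy : IncOrb f z z' y) (k : ℤ) : y k ≤ 1 := (hy.lt k).le.trans h.le_one

lemma IncOrb.not_near_iff {f : Equiv.Perm ℝ} {z z' : ℝ} {y : ℤ → ℝ} (h : Bump f z z')
    (hy : IncOrb f z z' y) (k : ℤ) :
    ¬ Near f (y k) (y (k + 1)) ↔ ∃ m ∈ Mid f, y k ≤ m ∧ m < y (k + 1) :=
  _root_.not_near_iff (hy.pos h k) (hy.mono (by omega)) (hy.le_one h _)

/-- Some step of an increasing orbit is not near. -/
lemma IncOrb.exists_not_near {f : Equiv.Perm ℝ} {z z' : ℝ} {y : ℤ → ℝ} (h : Bump f z z')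
    (hy : IncOrb f z z' y) : ∃ k, ¬ Near f (y k) (y (k + 1)) := by
  by_contra! H
  have H' : ∀ k, Near f (y k) (y (k + 3)) := by
    intro k
    by_contra hn
    rw [_root_.not_near_iff (hy.pos h k) (hy.mono (by omega)) (hy.le_one h _)] at hn
    obtain ⟨m, hm, h1, h2⟩ := hn
    have hk : ∀ j, ¬ (y j ≤ m ∧ m < y (j + 1)) := fun j hj =>
      (hy.not_near_iff h j).2 ⟨m, hm, hj⟩ (H j)
    have a1 := hk k
    have a2 := hk (k + 1)
    have a3 := hk (k + 2)
    rw [show k + 1 + 1 = k + 2 by ring] at a2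
    rw [show k + 2 + 1 = k + 3 by ring] at a3
    have b1 : y (k + 1) ≤ m := not_lt.1 fun hh => a1 ⟨h1, hh⟩
    have b2 : y (k + 2) ≤ m := not_lt.1 fun hh => a2 ⟨b1, hh⟩
    exact a3 ⟨b2, h2⟩
  refine not_geometric hy.mono (fun k => (hy.pos h k).le) (hy.le_one h) ?_
  have hmem : ∀ k, ∃ ρ > 0, f (y (k + 1)) - f (y k) = ρ * (y (k + 1) - y k) ∧
      f (y (k + 2)) - f (y (k + 1)) = ρ * (y (k + 2) - y (k + 1)) := by
    intro k
    obtain ⟨t, ht, a, b, hft⟩ := H' k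
    obtain ⟨ρ, hρ, hs⟩ := Nodes.slope ht hft
    have c1 : y (k + 1) ∈ range t := Nodes.convex ht a b (hy.mono.monotone (by omega))
      (hy.mono.monotone (by omega))
    have c2 : y (k + 2) ∈ range t := Nodes.convex ht a b (hy.mono.monotone (by omega))
      (hy.mono.monotone (by omega))
    exact ⟨ρ, hρ, hs _ a _ c1, hs _ c1 _ c2⟩
  intro k
  rcases hy.orb with ho | ho
  · obtain ⟨ρ, -, e1, e2⟩ := hmem k
    rw [← ho, ← ho, show k + 1 + 1 = k + 2 by ring] at e1
    rw [← ho, ← ho, show k + 1 + 1 = k + 2 by ring, show k + 2 + 1 = k + 3 by ring] at e2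
    rw [e2, sq]; nth_rewrite 1 [e1]; ring
  · obtain ⟨ρ, -, e1, e2⟩ := hmem (k + 1)
    have o1 := ho k
    have o2 := ho (k + 1)
    have o3 := ho (k + 2)
    rw [show k + 1 + 1 = k + 2 by ring] at o2 e1
    rw [show k + 2 + 1 = k + 3 by ring] at o3
    rw [show k + 1 + 2 = k + 3 by ring, show k + 1 + 1 = k + 2 by ring] at e2
    rw [← o1, ← o2] at e1
    rw [← o2, ← o3] at e2
    rw [e1, sq]; nth_rewrite 1 [e2]; ring

/-- The steps of an increasing orbit that are not near form a nonempty window, which also governs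
nearness to the end points. -/
lemma IncOrb.window {f : Equiv.Perm ℝ} (hf : Reg f) {z z' : ℝ} {y : ℤ → ℝ} (h : Bump f z z')
    (hy : IncOrb f z z' y) :
    ∃ α β : ℤ, α < β ∧ (∀ k, ¬ Near f (y k) (y (k + 1)) ↔ α ≤ k ∧ k < β) ∧
      β - α ≤ (Mid f ∩ Ioo z z').ncard ∧ (∀ k, Near f (y k) z' ↔ β ≤ k) ∧
      (0 < z → z ∉ Mid f → ∀ k, Near f z (y k) ↔ k ≤ α) := by
  classical
  have hMfin : (Mid f ∩ Ioo z z').Finite := hf.finMid.subset inter_subset_left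
  have hcard : ∀ S : Finset ℤ, (∀ k ∈ S, ¬ Near f (y k) (y (k + 1))) →
      S.card ≤ (Mid f ∩ Ioo z z').ncard := by
    intro S hS
    refine card_le_of_crossed hy.mono.monotone hMfin S fun k hk => ?_
    obtain ⟨m, hm, h1, h2⟩ := (hy.not_near_iff h k).1 (hS k hk)
    exact ⟨m, ⟨hm, (hy.gt k).trans_le h1, h2.trans (hy.lt _)⟩, h1, h2⟩
  have hfin : {k | ¬ Near f (y k) (y (k + 1))}.Finite := by
    by_contra hinf
    obtain ⟨S, hS, hc⟩ := Set.Infinite.exists_subset_card_eq hinf ((Mid f ∩ Ioo z z').ncard + 1)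
    have := hcard S fun k hk => hS hk
    omega
  have hne : {k | ¬ Near f (y k) (y (k + 1))}.Nonempty := hy.exists_not_near h
  obtain ⟨α, hα, hαmin⟩ := exists_min_image _ id hfin hne
  obtain ⟨β, hβ, hβmax⟩ := exists_max_image _ id hfin hne
  simp only [mem_ofPred_eq, id] at hα hαmin hβ hβmax
  have hiff : ∀ k, ¬ Near f (y k) (y (k + 1)) ↔ α ≤ k ∧ k < β + 1 := by
    intro k
    refine ⟨fun hk => ⟨hαmin k hk, by have := hβmax k hk; omega⟩, fun hk hn => ?_⟩
    rcases idle_nested hy.orb hn with H | H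
    · exact hβ (H β (by omega))
    · exact hα (H α hk.1)
  have hfind : ∀ m, z < m → m < z' → ∃ j, y j ≤ m ∧ m < y (j + 1) := by
    intro m h1 h2
    obtain ⟨a, ha⟩ := hy.cof' m h1
    obtain ⟨b, hb⟩ := hy.cof m h2
    obtain ⟨j, hj, hjmax⟩ := Int.exists_greatest_of_bdd (P := fun j => y j ≤ m)
      ⟨b, fun j hj => by
        by_contra hlt
        have := hy.mono.monotone (show b ≤ j by omega)
        linarith⟩ ⟨a, ha.le⟩
    refine ⟨j, hj, ?_⟩
    by_contra hle
    have := hjmax (j + 1) (not_lt.1 hle)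
    omega
  refine ⟨α, β + 1, by have := hαmin β hβ; omega, hiff, ?_, ?_, ?_⟩
  · have := hcard (Finset.Ico α (β + 1)) fun k hk => by
      rw [Finset.mem_Ico] at hk; exact (hiff k).2 hk
    rw [Int.card_Ico] at this
    omega
  · intro k
    constructor
    · intro hn
      by_contra hlt
      apply (hiff β).2 ⟨hαmin β hβ, by omega⟩
      exact hn.sub ⟨hy.mono.monotone (by omega), (hy.lt _).le⟩
        ⟨hy.mono.monotone (by omega), (hy.lt _).le⟩
    · intro hk
      by_contra hn
      rw [_root_.not_near_iff (hy.pos h k) (hy.lt k) h.le_one] at hn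
      obtain ⟨m, hm, h1, h2⟩ := hn
      obtain ⟨j, hj1, hj2⟩ := hfind m ((hy.gt k).trans_le h1) h2
      have := (hiff j).1 ((hy.not_near_iff h j).2 ⟨m, hm, hj1, hj2⟩)
      have hkj : k < j + 1 := hy.mono.lt_iff_lt.1 (h1.trans_lt hj2)
      omega
  · intro hz0 hzM k
    constructor
    · intro hn
      by_contra hlt
      apply hα
      exact hn.sub ⟨(hy.gt _).le, hy.mono.monotone (by omega)⟩
        ⟨(hy.gt _).le, hy.mono.monotone (by omega)⟩
    · intro hk
      by_contra hn
      rw [_root_.not_near_iff hz0 (hy.gt k) (hy.le_one h k)] at hn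
      obtain ⟨m, hm, h1, h2⟩ := hn
      have h1' : z < m := lt_of_le_of_ne h1 fun e => hzM (e ▸ hm)
      obtain ⟨j, hj1, hj2⟩ := hfind m h1' (h2.trans (hy.lt k))
      have := (hiff j).1 ((hy.not_near_iff h j).2 ⟨m, hm, hj1, hj2⟩)
      have hkj : j < k := hy.mono.lt_iff_lt.1 (hj1.trans_lt h2)
      omega

/-- The points `y k` are near `z` exactly from the index `p` on. -/
def Thr (f : Equiv.Perm ℝ) (z : ℝ) (y : ℤ → ℝ) (p : ℤ) : Prop := ∀ k, Near f (y k) z ↔ p ≤ k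

lemma exists_common_node {f : Equiv.Perm ℝ} {x x' z : ℝ} (h : Near f x z) (h' : Near f x' z) :
    ∃ t ∈ Nodes, x ∈ range t ∧ x' ∈ range t ∧ z ∈ range t ∧ f • t ∈ Nodes := by
  obtain ⟨t, ht, hx, hz, hft⟩ := h
  obtain ⟨t', ht', hx', hz', hft'⟩ := h'
  rcases Nodes.comparable ht ht' hz hz' with ⟨γ, -, rfl⟩ | ⟨γ, -, rfl⟩
  · exact ⟨t', ht', range_comp_subset_range _ _ hx, hx', hz', hft'⟩
  · exact ⟨t, ht, hx, range_comp_subset_range _ _ hx', hz, hft⟩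

lemma mem_range_smul_iff {f : Equiv.Perm ℝ} {t : UI → ℝ} {x : ℝ} :
    f x ∈ range (f • t) ↔ x ∈ range t := by
  refine ⟨fun ⟨s, hs⟩ => ⟨s, f.injective hs⟩, mem_range_smul⟩

lemma Thr.shrinks {f : Equiv.Perm ℝ} {z : ℝ} (fz : f z = z) {y : ℤ → ℝ} {p : ℤ}
    (hy : ∀ k, y (k + 1) = f (y k)) (h : Thr f z y p) {t : UI → ℝ} (ht : t ∈ Nodes)
    (hft : f • t ∈ Nodes) (hz : z ∈ range t) (hyt : y p ∈ range t) :
    ∃ γ, IsCell γ ∧ f • t = t ∘ γ := by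
  rcases Nodes.nested ht hft hz (by rw [← fz]; exact mem_range_smul hz) with H | ⟨γ, hγ, e⟩
  · exact H
  · have : y (p - 1) ∈ range t := by
      have h1 : f⁻¹ (y p) ∈ range (f⁻¹ • t) := mem_range_smul hyt
      rw [e] at h1
      have h2 := range_comp_subset_range _ _ h1
      have h3 := hy (p - 1)
      rw [sub_add_cancel] at h3
      rw [h3] at h2
      simpa using h2
    have := (h (p - 1)).1 ⟨t, ht, this, hz, hft⟩
    omega

lemma Thr.not_mem {f : Equiv.Perm ℝ} {z : ℝ} {y : ℤ → ℝ} {p : ℤ} (h : Thr f z y p) {t : UI → ℝ}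
    (ht : t ∈ Nodes) (hft : f • t ∈ Nodes) (hz : z ∈ range t) {k : ℤ} (hk : k < p) :
    y k ∉ range t := fun hm => by
  have := (h k).1 ⟨t, ht, hm, hz, hft⟩
  omega

lemma cross_forward {f g b : Equiv.Perm ℝ} (hb : (T b).Finite) (hc : ∀ x, b (f x) = g (b x)) {z : ℝ}
    (fz : f z = z) {y y' : ℤ → ℝ} (hy : ∀ k, y (k + 1) = f (y k)) (hy' : ∀ k, y' (k + 1) = f (y' k))
    {p p' q q' : ℤ} (hp : Thr f z y p) (hp' : Thr f z y' p')
    (hq : Thr g (b z) (fun k => b (y k)) q) (hq' : Thr g (b z) (fun k => b (y' k)) q') :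
    q' - p' ≤ q - p + 1 := by
  by_contra! H
  obtain ⟨t, ht, hyt, hyt', hz, hft⟩ := exists_common_node ((hp p).2 le_rfl) ((hp' p').2 le_rfl)
  obtain ⟨γ, hγ, e⟩ := hp.shrinks fz hy ht hft hz hyt
  have hbz : ∀ n : ℕ, (f ^ n) z = z := fun n =>
    Function.IsFixedPt.perm_pow (show Function.IsFixedPt f z from fz) n
  have gz : g (b z) = b z := by rw [← hc, fz]
  have gbz : ∀ n : ℕ, (g ^ n) (b z) = b z := fun n =>
    Function.IsFixedPt.perm_pow (show Function.IsFixedPt g (b z) from gz) n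
  have hgy : ∀ k, (fun k => b (y k)) (k + 1) = g ((fun k => b (y k)) k) := fun k => by
    simp only [hy, hc]
  have hgy' : ∀ k, (fun k => b (y' k)) (k + 1) = g ((fun k => b (y' k)) k) := fun k => by
    simp only [hy', hc]
  obtain ⟨s, hs, hys, hzs, hgs⟩ := (hq q).2 le_rfl
  obtain ⟨δ, hδ, e'⟩ := hq.shrinks gz hgy hs hgs hzs hys
  have hinj : Function.Injective fun L : ℕ => f ^ L • t := by
    have key : ∀ a d : ℕ, f ^ (a + (d + 1)) • t ≠ f ^ a • t := by
      intro a d hEq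
      rw [pow_add, mul_smul, smul_left_cancel_iff] at hEq
      refine hp.not_mem ht hft hz (k := p - (d + 1 : ℕ)) (by push_cast; omega) ?_
      have h1 := orbit_forward hy (p - (d + 1 : ℕ)) (d + 1)
      rw [sub_add_cancel] at h1
      rwa [← mem_range_smul_iff (f := f ^ (d + 1)), h1, hEq]
    intro a a' haa
    rcases lt_trichotomy a a' with hl | hl | hl
    · obtain ⟨d, rfl⟩ := Nat.exists_eq_add_of_lt hl
      exact absurd haa.symm (key a d)
    · exact hl
    · obtain ⟨d, rfl⟩ := Nat.exists_eq_add_of_lt hl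
      exact absurd haa (key a' d)
  obtain ⟨L, hL, hbL⟩ : ∃ L : ℕ, (q - p + 1).toNat ≤ L ∧ b • f ^ L • t ∈ Nodes := by
    by_contra! hno
    have hinf : ((fun L : ℕ => f ^ L • t) '' Ici (q - p + 1).toNat).Infinite :=
      (Ici_infinite _).image hinj.injOn
    refine hinf (hb.subset ?_)
    rintro _ ⟨L, hL, rfl⟩
    exact ⟨Nodes.pow_smul_mem ht hγ e L, hno L hL⟩
  obtain ⟨m, hm⟩ : ∃ m : ℕ, q + m = p + L - 1 := ⟨(p + L - 1 - q).toNat, by omega⟩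
  have hz1 : b z ∈ range (b • f ^ L • t) :=
    mem_range_smul (by rw [← hbz L]; exact mem_range_smul hz)
  have hz2 : b z ∈ range (g ^ m • s) := by
    have := mem_range_smul (f := g ^ m) hzs; rwa [gbz] at this
  rcases Nodes.comparable hbL (Nodes.pow_smul_mem hs hδ e' m) hz1 hz2 with
    ⟨η, -, hη⟩ | ⟨η, -, hη⟩
  · have h1 : b (y' (p' + L)) ∈ range (b • f ^ L • t) :=
      mem_range_smul (by rw [← orbit_forward hy']; exact mem_range_smul hyt')
    rw [hη] at h1
    have h2 := range_comp_subset_range _ _ h1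
    have h3 := orbit_forward (y := fun k => b (y' k)) hgy' (p' + L - m) m
    rw [sub_add_cancel] at h3
    rw [← h3, mem_range_smul_iff] at h2
    exact hq'.not_mem hs hgs hzs (k := p' + L - m) (by omega) h2
  · have h1 : b (y (p + L - 1)) ∈ range (g ^ m • s) := by
      have := orbit_forward (y := fun k => b (y k)) hgy q m
      simp only [hm] at this
      rw [← this]; exact mem_range_smul hys
    rw [hη] at h1
    have h2 := range_comp_subset_range _ _ h1
    have h3 := orbit_forward hy (p - 1) L
    rw [show p - 1 + L = p + L - 1 by ring] at h3
    rw [mem_range_smul_iff, ← h3, mem_range_smul_iff] at h2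
    exact hp.not_mem ht hft hz (by omega) h2

lemma Thr.inv {f : Equiv.Perm ℝ} {z : ℝ} (fz : f z = z) {y : ℤ → ℝ} {p : ℤ}
    (hy : ∀ k, y k = f (y (k + 1))) (h : Thr f z y p) : Thr f⁻¹ z y (p - 1) := by
  intro k
  have h1 : Near f⁻¹ (f (y (k + 1))) (f z) ↔ Near f (y (k + 1)) z := near_inv_iff
  rw [fz, ← hy] at h1
  rw [h1, h]; omega

lemma orb_direction {f : Equiv.Perm ℝ} {z : ℝ} (fz : f z = z) {y y' : ℤ → ℝ} {p p' : ℤ}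
    (hp : Thr f z y p) (hp' : Thr f z y' p') (hy : ∀ k, y (k + 1) = f (y k))
    (hy' : ∀ k, y' k = f (y' (k + 1))) : False := by
  obtain ⟨t, ht, hyt, hyt', hz, hft⟩ := exists_common_node ((hp p).2 le_rfl) ((hp' p').2 le_rfl)
  obtain ⟨γ, hγ, e⟩ := hp.shrinks fz hy ht hft hz hyt
  refine hp'.not_mem ht hft hz (k := p' - 1) (by omega) ?_
  have h1 := hy' (p' - 1)
  rw [sub_add_cancel] at h1
  rw [h1]
  have h2 : f (y' p') ∈ range (f • t) := mem_range_smul hyt'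
  rw [e] at h2
  exact range_comp_subset_range _ _ h2

/-- The shift between the two thresholds of an orbit converging to a fixed point, measured for `f`
and for its conjugate `g`, is almost independent of the orbit. -/
lemma cross {f g b : Equiv.Perm ℝ} (hb : (T b).Finite) (hc : ∀ x, b (f x) = g (b x)) {z : ℝ}
    (fz : f z = z) {y y' : ℤ → ℝ} (hy : IsOrb f y) (hy' : IsOrb f y')
    {p p' q q' : ℤ} (hp : Thr f z y p) (hp' : Thr f z y' p')
    (hq : Thr g (b z) (fun k => b (y k)) q) (hq' : Thr g (b z) (fun k => b (y' k)) q') :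
    q' - p' ≤ q - p + 1 := by
  have gz : g (b z) = b z := by rw [← hc, fz]
  rcases hy with hy | hy <;> rcases hy' with hy' | hy'
  · exact cross_forward hb hc fz hy hy' hp hp' hq hq'
  · exact (orb_direction fz hp hp' hy hy').elim
  · exact (orb_direction fz hp' hp hy' hy).elim
  · have hstep : ∀ {w : ℤ → ℝ}, (∀ k, w k = f (w (k + 1))) → ∀ k, w (k + 1) = f⁻¹ (w k) :=
      fun hw k => by rw [hw k]; simp
    have := cross_forward (f := f⁻¹) (g := g⁻¹) hb
      (fun x => by rw [Equiv.Perm.eq_inv_iff_eq, ← hc]; simp)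
      (by rw [Equiv.Perm.inv_eq_iff_eq, fz]) (hstep hy) (hstep hy') (hp.inv fz hy) (hp'.inv fz hy')
      (hq.inv gz fun k => by rw [← hc, ← hy]) (hq'.inv gz fun k => by rw [← hc, ← hy'])
    omega

lemma Reg.nonneg {f : Equiv.Perm ℝ} (hf : Reg f) {x : ℝ} (h : 0 ≤ x) : 0 ≤ f x := by
  have := hf.mono.monotone h
  rwa [hf.nonpos 0 le_rfl] at this

lemma Reg.inv_lt {f : Equiv.Perm ℝ} (hf : Reg f) {x y : ℝ} : f⁻¹ x < y ↔ x < f y := by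
  rw [← hf.mono.lt_iff_lt]; simp

lemma Reg.lt_inv {f : Equiv.Perm ℝ} (hf : Reg f) {x y : ℝ} : x < f⁻¹ y ↔ f x < y := by
  rw [← hf.mono.lt_iff_lt]; simp

lemma conj_fixed_iff {f g b : Equiv.Perm ℝ} (hc : ∀ x, b (f x) = g (b x)) {x : ℝ} :
    g (b x) = b x ↔ f x = x := by
  rw [← hc, b.injective.eq_iff]

lemma Bump.conj {f g b : Equiv.Perm ℝ} (hb : Reg b) (hc : ∀ x, b (f x) = g (b x)) {z z' : ℝ}
    (h : Bump f z z') : Bump g (b z) (b z') where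
  nonneg := hb.nonneg h.nonneg
  lt := hb.mono h.lt
  le_one := hb.le_one h.le_one
  left := by rw [← hc, h.left]
  right := by rw [← hc, h.right]
  ne w h1 h2 hw := by
    refine h.ne (b⁻¹ w) (hb.lt_inv.2 h1) (hb.inv_lt.2 h2) ?_
    rw [← conj_fixed_iff hc]; simpa using hw

lemma IsOrb.conj {f g b : Equiv.Perm ℝ} (hc : ∀ x, b (f x) = g (b x)) {y : ℤ → ℝ}
    (h : IsOrb f y) : IsOrb g fun k => b (y k) := by
  rcases h with h | h
  · exact Or.inl fun k => by simp only [h, hc]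
  · exact Or.inr fun k => by simp only [← hc, ← h]

lemma IncOrb.conj {f g b : Equiv.Perm ℝ} (hb : Reg b) (hc : ∀ x, b (f x) = g (b x)) {z z' : ℝ}
    {y : ℤ → ℝ} (h : IncOrb f z z' y) : IncOrb g (b z) (b z') fun k => b (y k) where
  orb := h.orb.conj hc
  mono := hb.mono.comp h.mono
  gt k := hb.mono (h.gt k)
  lt k := hb.mono (h.lt k)
  cof w hw := by
    obtain ⟨k, hk⟩ := h.cof (b⁻¹ w) (hb.inv_lt.2 hw)
    exact ⟨k, hb.inv_lt.1 hk⟩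
  cof' w hw := by
    obtain ⟨k, hk⟩ := h.cof' (b⁻¹ w) (hb.lt_inv.2 hw)
    exact ⟨k, hb.lt_inv.1 hk⟩

/-- `b` conjugates `f` to `g`, and `(c, e)` is an interval on which `f` has no interval of fixed
points and no dyadic fixed points; `b` is normalized at a reference orbit next to `e`. -/
structure Comp (f g b : Equiv.Perm ℝ) (c e : ℝ) : Prop where
  regf : Reg f
  regg : Reg g
  regb : Reg b
  conj : ∀ x, b (f x) = g (b x)
  nonneg : 0 ≤ c
  lt : c < e
  le_one : e ≤ 1
  left : f c = c
  right : f e = e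
  active : ∀ x y, c < x → x < y → y ≤ e → ∃ w, x < w ∧ w < y ∧ f w ≠ w
  dy : ∀ z, c < z → z < e → f z = z → ¬ Dy z ∧ ¬ Dy (b z)
  ref : ∃ z y p, Bump f z e ∧ IncOrb f z e y ∧ Thr f e y p ∧ Thr g (b e) (fun k => b (y k)) p

lemma dy_of_mem_Mid {f : Equiv.Perm ℝ} {z : ℝ} (h : z ∈ Mid f) : Dy z := by
  obtain ⟨u, hu, rfl⟩ := h
  exact ⟨u, hu.1, rfl⟩

lemma not_near_of_fixed {f : Equiv.Perm ℝ} {c e : ℝ}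
    (h : ∀ x y, c < x → x < y → y ≤ e → ∃ w, x < w ∧ w < y ∧ f w ≠ w) {x y : ℝ} (hx : c < x)
    (hxy : x < y) (hy : y ≤ e) (fx : f x = x) (fy : f y = y) : ¬ Near f x y := by
  rintro ⟨t, ht, h1, h2, hft⟩
  have e1 := Nodes.fixed_of_two ht hft h1 h2 hxy.ne fx fy
  obtain ⟨w, hw1, hw2, hw⟩ := h x y hx hxy hy
  obtain ⟨s, rfl⟩ := Nodes.convex ht h1 h2 hw1.le hw2.le
  exact hw (congrFun e1 s)

lemma fixed_finite {f : Equiv.Perm ℝ} (hf : Reg f) {c e : ℝ} (hc : 0 ≤ c) (he : e ≤ 1)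
    (h : ∀ x y, c < x → x < y → y ≤ e → ∃ w, x < w ∧ w < y ∧ f w ≠ w) :
    {x | c < x ∧ x ≤ e ∧ f x = x}.Finite := by
  have key : ∀ x y, c < x → x < y → y ≤ e → f x = x → f y = y → Mid f ∩ Iio x ≠ Mid f ∩ Iio y := by
    intro x y hx hxy hy fx fy heq
    obtain ⟨m, hm, h1, h2⟩ := (not_near_iff (hc.trans_lt hx) hxy (hy.trans he)).1
      (not_near_of_fixed h hx hxy hy fx fy)
    have : m ∈ Mid f ∩ Iio x := heq ▸ ⟨hm, h2⟩
    exact absurd this.2 (not_lt.2 h1)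
  refine Finite.of_finite_image (f := fun x => Mid f ∩ Iio x)
    (hf.finMid.finite_subsets.subset ?_) ?_
  · rintro _ ⟨x, -, rfl⟩
    exact inter_subset_left
  · rintro x ⟨h1, h2, h3⟩ y ⟨h1', h2', h3'⟩ hxy
    rcases lt_trichotomy x y with hl | hl | hl
    · exact absurd hxy (key x y h1 hl h2' h3 h3')
    · exact hl
    · exact absurd hxy.symm (key y x h1' hl h2 h3' h3)

lemma exists_next_fixed {f : Equiv.Perm ℝ} (hf : Reg f) {c e : ℝ} (hc : 0 ≤ c) (he : e ≤ 1)
    (fe : f e = e) (h : ∀ x y, c < x → x < y → y ≤ e → ∃ w, x < w ∧ w < y ∧ f w ≠ w) {a : ℝ}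
    (hca : c ≤ a) (hae : a < e) :
    ∃ z, a < z ∧ z ≤ e ∧ f z = z ∧ ∀ w, a < w → w < z → f w ≠ w := by
  have hfin : {x | a < x ∧ x ≤ e ∧ f x = x}.Finite := (fixed_finite hf hc he h).subset
    fun x hx => ⟨hca.trans_lt hx.1, hx.2⟩
  obtain ⟨z, ⟨h1, h2, h3⟩, hmin⟩ := exists_min_image _ id hfin ⟨e, hae, le_rfl, fe⟩
  refine ⟨z, h1, h2, h3, fun w hw1 hw2 hw => ?_⟩
  exact absurd (hmin w ⟨hw1, hw2.le.trans h2, hw⟩) (not_le.2 hw2)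

lemma exists_bump {f : Equiv.Perm ℝ} (hf : Reg f) {c e : ℝ} (hc : 0 ≤ c) (he : e ≤ 1)
    (fc : f c = c) (fe : f e = e)
    (h : ∀ x y, c < x → x < y → y ≤ e → ∃ w, x < w ∧ w < y ∧ f w ≠ w) {x : ℝ}
    (hx : c < x) (hxe : x < e) (fx : f x ≠ x) :
    ∃ z z', c ≤ z ∧ z' ≤ e ∧ Bump f z z' ∧ z < x ∧ x < z' := by
  obtain ⟨z', h1, h2, h3, h4⟩ := exists_next_fixed hf hc he fe h hx.le hxe
  have hfin : {w | w = c ∨ (c < w ∧ w < x ∧ f w = w)}.Finite :=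
    ((fixed_finite hf hc he h).insert c).subset fun w hw => by
      rcases hw with rfl | ⟨a, b, d⟩
      · exact Or.inl rfl
      · exact Or.inr ⟨a, b.le.trans hxe.le, d⟩
  obtain ⟨z, hz, hmax⟩ := exists_max_image _ id hfin ⟨c, Or.inl rfl⟩
  have hcz : c ≤ z := hmax c (Or.inl rfl)
  have hzx : z < x := by rcases hz with rfl | hz; exacts [hx, hz.2.1]
  have fz : f z = z := by rcases hz with rfl | hz; exacts [fc, hz.2.2]
  refine ⟨z, z', hcz, h2, ⟨hc.trans hcz, hzx.trans h1, h2.trans he, fz, h3, ?_⟩, hzx, h1⟩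
  intro w hw1 hw2 hw
  rcases lt_trichotomy w x with hl | rfl | hl
  · exact absurd (hmax w (Or.inr ⟨hcz.trans_lt hw1, hl, hw⟩)) (not_le.2 hw1)
  · exact fx hw
  · exact h4 w hl hw2 hw

namespace Comp

variable {f g b : Equiv.Perm ℝ} {c e : ℝ}

lemma conj' (h : Comp f g b c e) (x : ℝ) : b⁻¹ (g x) = f (b⁻¹ x) := by
  rw [Equiv.Perm.inv_eq_iff_eq, h.conj]; simp

lemma symm (h : Comp f g b c e) : Comp g f b⁻¹ (b c) (b e) where
  regf := h.regg
  regg := h.regf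
  regb := h.regb.inv
  conj := h.conj'
  nonneg := h.regb.nonneg h.nonneg
  lt := h.regb.mono h.lt
  le_one := h.regb.le_one h.le_one
  left := (conj_fixed_iff h.conj).2 h.left
  right := (conj_fixed_iff h.conj).2 h.right
  active x y h1 h2 h3 := by
    obtain ⟨w, hw1, hw2, hw⟩ := h.active (b⁻¹ x) (b⁻¹ y) (h.regb.lt_inv.2 h1)
      (h.regb.inv.mono h2) (by rw [← h.regb.mono.le_iff_le]; simpa using h3)
    exact ⟨b w, h.regb.inv_lt.1 hw1, h.regb.lt_inv.1 hw2, fun hh => hw ((conj_fixed_iff h.conj).1 hh)⟩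
  dy z h1 h2 h3 := by
    have := h.dy (b⁻¹ z) (h.regb.lt_inv.2 h1) (h.regb.inv_lt.2 h2)
      ((conj_fixed_iff h.conj).1 (by simpa using h3))
    exact ⟨by simpa using this.2, this.1⟩
  ref := by
    obtain ⟨z, y, p, hB, hy, hp, hq⟩ := h.ref
    exact ⟨b z, fun k => b (y k), p, hB.conj h.regb h.conj, hy.conj h.regb h.conj, hq,
      by simpa using hp⟩

lemma inv_conj {f g b : Equiv.Perm ℝ} (h : ∀ x, b (f x) = g (b x)) (x : ℝ) :
    b (f⁻¹ x) = g⁻¹ (b x) := by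
  rw [Equiv.Perm.eq_inv_iff_eq, ← h]; simp

lemma inv (h : Comp f g b c e) : Comp f⁻¹ g⁻¹ b c e where
  regf := h.regf.inv
  regg := h.regg.inv
  regb := h.regb
  conj := inv_conj h.conj
  nonneg := h.nonneg
  lt := h.lt
  le_one := h.le_one
  left := by rw [Equiv.Perm.inv_eq_iff_eq, h.left]
  right := by rw [Equiv.Perm.inv_eq_iff_eq, h.right]
  active x y h1 h2 h3 := by
    obtain ⟨w, hw1, hw2, hw⟩ := h.active x y h1 h2 h3
    exact ⟨w, hw1, hw2, fun hh => hw (Equiv.Perm.inv_eq_iff_eq.1 hh).symm⟩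
  dy z h1 h2 h3 := h.dy z h1 h2 (Equiv.Perm.inv_eq_iff_eq.1 h3).symm
  ref := by
    obtain ⟨z, y, p, hB, hy, hp, hq⟩ := h.ref
    have gz : g (b e) = b e := by rw [← h.conj, h.right]
    rcases hy.orb with ho | ho
    · have hinv : ∀ k, y k = f⁻¹ (y (k + 1)) := fun k => by rw [ho]; simp
      have hy' : IncOrb f⁻¹ z e y := ⟨Or.inr hinv, hy.mono, hy.gt, hy.lt, hy.cof, hy.cof'⟩
      refine ⟨z, y, p + 1, hB.inv, hy', fun k => ?_, fun k => ?_⟩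
      · have h1 : Near f⁻¹ (f (y (k - 1))) (f e) ↔ Near f (y (k - 1)) e := near_inv_iff
        rw [h.right, ← ho, sub_add_cancel] at h1
        rw [h1, hp]; omega
      · have h1 : Near g⁻¹ (g (b (y (k - 1)))) (g (b e)) ↔ Near g (b (y (k - 1))) (b e) :=
          near_inv_iff
        rw [gz, ← h.conj, ← ho, sub_add_cancel] at h1
        rw [h1, hq]; omega
    · have hinv : ∀ k, y (k + 1) = f⁻¹ (y k) := fun k => by rw [ho k]; simp
      have hy' : IncOrb f⁻¹ z e y := ⟨Or.inl hinv, hy.mono, hy.gt, hy.lt, hy.cof, hy.cof'⟩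
      exact ⟨z, y, p - 1, hB.inv, hy', hp.inv h.right ho,
        hq.inv gz fun k => by rw [← h.conj, ← ho]⟩

/-- Shifts at a fixed point are controlled by the break points on its right. -/
lemma shift_le (h : Comp f g b c e) : ∀ N : ℕ, ∀ z z' y β β', (Mid f ∩ Ioo z' e).ncard = N →
    c ≤ z → z' ≤ e → Bump f z z' → IncOrb f z z' y → Thr f z' y β →
    Thr g (b z') (fun k => b (y k)) β' →
    |β - β'| ≤ 1 + (Mid f ∩ Ioo z' e).ncard + (Mid g ∩ Ioo (b z') (b e)).ncard := by
  intro N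
  induction N using Nat.strong_induction_on with
  | _ N ih =>
    intro z z' y β β' hN hcz hz'e hB hy hβ hβ'
    rcases hz'e.eq_or_lt with rfl | hlt
    · obtain ⟨z0, y0, p, hB0, hy0, hp, hq⟩ := h.ref
      have h1 := cross h.regb.finT h.conj h.right hy0.orb hy.orb hp hβ hq hβ'
      have h2 := cross h.regb.finT h.conj h.right hy.orb hy0.orb hβ hp hβ' hq
      simp
      rw [abs_le]; omega
    · have hcz' : c < z' := hcz.trans_lt hB.lt
      obtain ⟨z'', a1, a2, a3, a4⟩ := exists_next_fixed h.regf h.nonneg h.le_one h.right h.active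
        hcz'.le hlt
      have hB' : Bump f z' z'' := ⟨(h.nonneg.trans hcz'.le), a1, a2.trans h.le_one, hB.right, a3, a4⟩
      obtain ⟨y', hy', -⟩ := hB'.exists_incOrb h.regf (x := (z' + z'') / 2) (by linarith)
        (by linarith)
      have hm := h.dy z' hcz' hlt hB.right
      have hz0 : 0 < z' := h.nonneg.trans_lt hcz'
      obtain ⟨α₁, β₁, w1, -, w3, w4, w5⟩ := hy'.window h.regf hB'
      obtain ⟨α₂, β₂, v1, -, v3, v4, v5⟩ := (hy'.conj h.regb h.conj).window h.regg
        (hB'.conj h.regb h.conj)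
      have t1 : Thr f z' (fun k => y' (-k)) (-α₁) := fun k => by
        rw [near_comm, w5 hz0 fun hh => hm.1 (dy_of_mem_Mid hh)]; omega
      have t2 : Thr g (b z') (fun k => b (y' (-k))) (-α₂) := fun k => by
        rw [near_comm, v5 (h.regb.pos hz0) fun hh => hm.2 (dy_of_mem_Mid hh)]; omega
      have horb : IsOrb f fun k => y' (-k) := by
        rcases hy'.orb with ho | ho
        · right; intro k
          have := ho (-(k + 1))
          rwa [show -(k + 1) + 1 = -k by ring] at this
        · left; intro k
          have := ho (-(k + 1))
          rwa [show -(k + 1) + 1 = -k by ring] at this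
      have c1 := cross h.regb.finT h.conj hB.right hy.orb horb hβ t1 hβ' t2
      have c2 := cross h.regb.finT h.conj hB.right horb hy.orb t1 hβ t2 hβ'
      have split : ∀ {M : Set ℝ} {p q r : ℝ}, M.Finite → p < q → q ≤ r →
          (M ∩ Ioo p q).ncard + (M ∩ Ioo q r).ncard ≤ (M ∩ Ioo p r).ncard := by
        intro M p q r hM hpq hqr
        rw [← ncard_union_eq _ (hM.subset inter_subset_left) (hM.subset inter_subset_left)]
        · refine ncard_le_ncard ?_ (hM.subset inter_subset_left)
          rintro m (⟨hm, h1, h2⟩ | ⟨hm, h1, h2⟩)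
          · exact ⟨hm, h1, h2.trans_le hqr⟩
          · exact ⟨hm, hpq.trans h1, h2⟩
        · rw [Set.disjoint_left]
          rintro m ⟨-, -, h2⟩ ⟨-, h1, -⟩
          exact lt_asymm h1 h2
      have s1 := split h.regf.finMid a1 a2
      have s2 := split h.regg.finMid (h.regb.mono a1) (h.regb.mono.monotone a2)
      have hr := ih (Mid f ∩ Ioo z'' e).ncard (by omega) z' z'' y' β₁ β₂ rfl hcz'.le a2 hB' hy' w4 v4
      rw [abs_le] at hr ⊢
      omega

/-- The steps of the orbits of `x` under `f` and of `b x` under `g` that are not near all lie in a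
window of bounded length. -/
lemma spread (h : Comp f g b c e) {x : ℝ} (h1 : c < x) (h2 : x < e) (hx : f x ≠ x) :
    (∃ k : ℤ, ¬ Near f ((f ^ k) x) ((f ^ (k + 1)) x)) ∧
    (∀ k k' : ℤ, ¬ Near f ((f ^ k) x) ((f ^ (k + 1)) x) →
      ¬ Near g ((g ^ k') (b x)) ((g ^ (k' + 1)) (b x)) →
      |k - k'| ≤ ((Mid f).ncard + (Mid g).ncard : ℕ)) ∧
    ∀ k k' : ℤ, ¬ Near g ((g ^ k) (b x)) ((g ^ (k + 1)) (b x)) →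
      ¬ Near g ((g ^ k') (b x)) ((g ^ (k' + 1)) (b x)) →
      |k - k'| ≤ ((Mid f).ncard + (Mid g).ncard : ℕ) := by
  obtain ⟨z, z', a1, a2, hB, a3, a4⟩ := exists_bump h.regf h.nonneg h.le_one h.left h.right
    h.active h1 h2 hx
  obtain ⟨y, hy, hy0⟩ := hB.exists_incOrb h.regf a3 a4
  obtain ⟨α₁, β₁, w1, w2, w3, w4, -⟩ := hy.window h.regf hB
  obtain ⟨α₂, β₂, v1, v2, v3, v4, -⟩ := (hy.conj h.regb h.conj).window h.regg
    (hB.conj h.regb h.conj)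
  have hr := h.shift_le _ z z' y β₁ β₂ rfl a1 a2 hB hy w4 v4
  have sum : ∀ {M : Set ℝ} {p q r : ℝ}, M.Finite →
      (M ∩ Ioo p q).ncard + (M ∩ Ioo q r).ncard ≤ M.ncard := by
    intro M p q r hM
    rw [← ncard_union_eq _ (hM.subset inter_subset_left) (hM.subset inter_subset_left)]
    · exact ncard_le_ncard (union_subset inter_subset_left inter_subset_left) hM
    · rw [Set.disjoint_left]
      rintro m ⟨-, -, h2⟩ ⟨-, h1, -⟩
      exact lt_asymm h1 h2
  have s1 := sum (p := z) (q := z') (r := e) h.regf.finMid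
  have s2 := sum (p := b z) (q := b z') (r := b e) h.regg.finMid
  rw [abs_le] at hr
  rcases hy.orb with ho | ho
  · have hf : ∀ k : ℤ, (f ^ k) x = y k := by
      intro k
      rcases Int.eq_nat_or_neg k with ⟨n, rfl | rfl⟩
      · rw [zpow_natCast, ← hy0, orbit_forward ho, zero_add]
      · rw [zpow_neg, zpow_natCast, ← inv_pow, ← hy0, orbit_backward ho, zero_sub]
    have hg : ∀ k : ℤ, (g ^ k) (b x) = b (y k) := by
      have ho' : ∀ k, (fun k => b (y k)) (k + 1) = g ((fun k => b (y k)) k) := fun k => by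
        simp only [ho, h.conj]
      intro k
      rcases Int.eq_nat_or_neg k with ⟨n, rfl | rfl⟩
      · have := orbit_forward (y := fun k => b (y k)) ho' 0 n
        simp only [hy0, zero_add] at this
        rw [zpow_natCast, this]
      · have := orbit_backward (y := fun k => b (y k)) ho' 0 n
        simp only [hy0, zero_sub] at this
        rw [zpow_neg, zpow_natCast, ← inv_pow, this]
    simp only [hf, hg, w2, v2]
    refine ⟨⟨α₁, by omega⟩, fun k k' hk hk' => ?_, fun k k' hk hk' => ?_⟩ <;>
    · rw [abs_le]; push_cast; omega
  · have ho1 : ∀ k, (fun k => y (-k)) (k + 1) = f ((fun k => y (-k)) k) := fun k => by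
      have := ho (-(k + 1))
      rwa [show -(k + 1) + 1 = -k by ring] at this
    have hf : ∀ k : ℤ, (f ^ k) x = y (-k) := by
      intro k
      rcases Int.eq_nat_or_neg k with ⟨n, rfl | rfl⟩
      · have := orbit_forward (y := fun k => y (-k)) ho1 0 n
        simp only [neg_zero, hy0, zero_add] at this
        rw [zpow_natCast, this]
      · have := orbit_backward (y := fun k => y (-k)) ho1 0 n
        simp only [neg_zero, hy0, zero_sub] at this
        rw [zpow_neg, zpow_natCast, ← inv_pow, this]
    have hg : ∀ k : ℤ, (g ^ k) (b x) = b (y (-k)) := by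
      have ho' : ∀ k, (fun k => b (y (-k))) (k + 1) = g ((fun k => b (y (-k))) k) := fun k => by
        have := ho1 k
        simp only at this
        simp only [this, h.conj]
      intro k
      rcases Int.eq_nat_or_neg k with ⟨n, rfl | rfl⟩
      · have := orbit_forward (y := fun k => b (y (-k))) ho' 0 n
        simp only [neg_zero, hy0, zero_add] at this
        rw [zpow_natCast, this]
      · have := orbit_backward (y := fun k => b (y (-k))) ho' 0 n
        simp only [neg_zero, hy0, zero_sub] at this
        rw [zpow_neg, zpow_natCast, ← inv_pow, this]
    have n1 : ∀ k : ℤ, ¬ Near f (y (-k)) (y (-(k + 1))) ↔ α₁ ≤ -(k + 1) ∧ -(k + 1) < β₁ := by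
      intro k
      rw [← w2, near_comm, show -(k + 1) + 1 = -k by ring]
    have n2 : ∀ k : ℤ, ¬ Near g (b (y (-k))) (b (y (-(k + 1)))) ↔
        α₂ ≤ -(k + 1) ∧ -(k + 1) < β₂ := by
      intro k
      rw [← v2, near_comm, show -(k + 1) + 1 = -k by ring]
    simp only [hf, hg, n1, n2]
    refine ⟨⟨-α₁ - 1, by omega⟩, fun k k' hk hk' => ?_, fun k k' hk hk' => ?_⟩ <;>
    · rw [abs_le]; push_cast; omega

end Comp

lemma Reg.zpow_apply_injective {f : Equiv.Perm ℝ} (hf : Reg f) {x : ℝ} (hx : f x ≠ x) :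
    Function.Injective fun k : ℤ => (f ^ k) x := by
  rcases lt_or_gt_of_ne hx with h | h
  · have h1 := (hf.inv.orbit_strictMono (lt_inv_of_lt hf h)).injective
    intro a a' haa
    have := @h1 (-a) (-a') (by simpa using haa)
    omega
  · exact (hf.orbit_strictMono h).injective

/-- A node which is not mapped to a node separates its points from the other points. -/
lemma not_near_of_bad {g : Equiv.Perm ℝ} {v : UI → ℝ} (hv : v ∈ Nodes) (hgv : g • v ∉ Nodes)
    {x x' : ℝ} (hx : x ∈ range v) (hx' : x' ∉ range v) : ¬ Near g x x' := by
  rintro ⟨r, hr, h1, h2, hgr⟩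
  rcases Nodes.comparable hv hr hx h1 with ⟨γ, hγ, rfl⟩ | ⟨γ, hγ, rfl⟩
  · exact hgv (by rw [smul_comp]; exact Nodes.comp hgr hγ)
  · exact hx' (range_comp_subset_range _ _ h2)

namespace Comp

variable {f g b : Equiv.Perm ℝ} {c e : ℝ}

lemma exists_not_fixed (h : Comp f g b c e) {u : UI → ℝ} (hu : u ∈ Nodes)
    (huc : range u ⊆ Ioc c e) : ∃ s, f (u s) ≠ u s := by
  obtain ⟨w, h1, h2, h3⟩ := h.active (u UI.half) (u UI.one) (huc (mem_range_self _)).1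
    (Nodes.strictMono hu (show (UI.half : ℝ) < UI.one by norm_num)) (huc (mem_range_self _)).2
  obtain ⟨s, rfl⟩ := Nodes.convex hu (mem_range_self _) (mem_range_self _) h1.le h2.le
  exact ⟨s, h3⟩

lemma zpow_mem (h : Comp f g b c e) {x : ℝ} (hx : x ∈ Ioc c e) (k : ℤ) : (f ^ k) x ∈ Ioc c e := by
  have fc : (f ^ k) c = c := Function.IsFixedPt.perm_zpow (show Function.IsFixedPt f c from h.left) k
  have fe : (f ^ k) e = e := Function.IsFixedPt.perm_zpow (show Function.IsFixedPt f e from h.right) k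
  have h1 := (h.regf.zpow k).mono hx.1
  have h2 := (h.regf.zpow k).mono.monotone hx.2
  rw [fc] at h1
  rw [fe] at h2
  exact ⟨h1, h2⟩

/-- A node with all backward iterates nodes but with image under `b` no node comes from a bad node
of `g` after a bounded number of steps. -/
lemma exists_source (h : Comp f g b c e) {u : UI → ℝ} (huc : range u ⊆ Ioc c e)
    (hu : ∀ n : ℤ, n ≤ 0 → f ^ n • u ∈ Nodes) (hbu : b • u ∉ Nodes) :
    ∃ w ∈ T g, ∃ j : ℕ, 1 ≤ j ∧ j ≤ (Mid f).ncard + (Mid g).ncard ∧ u = f ^ j • b⁻¹ • w := by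
  set S := (Mid f).ncard + (Mid g).ncard with hS
  have hu0 : u ∈ Nodes := by simpa using hu 0 le_rfl
  obtain ⟨s₀, hs₀⟩ := h.exists_not_fixed hu0 huc
  have hsemi : SemiconjBy b f g := Equiv.ext h.conj
  set U : ℤ → UI → ℝ := fun n => f ^ n • u with hU
  have U0 : U 0 = u := by simp [hU]
  have hUadd : ∀ k n : ℤ, f ^ k • U n = U (k + n) := fun k n => by
    simp only [hU, smul_smul, zpow_add]
  have hbUadd : ∀ k n : ℤ, g ^ k • b • U n = b • U (k + n) := fun k n => by
    rw [← hUadd, ← mul_smul (g ^ k) b, ← mul_smul b (f ^ k), (hsemi.zpow_right k).eq]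
  have hUinj : Function.Injective U := fun a a' haa =>
    h.regf.zpow_apply_injective hs₀ (congrFun haa s₀)
  have hbad : {i | U i ∈ Nodes ∧ b • U i ∉ Nodes}.Finite :=
    h.regb.finT.preimage hUinj.injOn
  obtain ⟨m, hm, hmax⟩ := Int.exists_greatest_of_bdd (P := fun m => ∀ i ≤ m, b • U i ∈ Nodes)
    ⟨0, fun m hm => by
      by_contra! h0
      exact hbu (by rw [← U0]; exact hm 0 h0.le)⟩ (by
      obtain ⟨N, hN⟩ := hbad.bddBelow
      refine ⟨min (N - 1) 0, fun i hi => ?_⟩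
      by_contra hb
      have := hN ⟨hu i (by omega), hb⟩
      omega)
  have hm0 : m < 0 := by
    by_contra! h0
    exact hbu (by rw [← U0]; exact hm 0 h0)
  have hm1 : b • U (m + 1) ∉ Nodes := by
    intro hn
    have := hmax (m + 1) fun i hi => by
      rcases (show i ≤ m ∨ i = m + 1 by omega) with h1 | rfl
      exacts [hm i h1, hn]
    omega
  set w := b • U m with hw
  have hwN : w ∈ Nodes := hm m le_rfl
  have hgw : g • w = b • U (m + 1) := by
    have := hbUadd 1 m; rwa [zpow_one, add_comm 1 m] at this
  have hgw' : g⁻¹ • w = b • U (m - 1) := by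
    have := hbUadd (-1) m; rwa [zpow_neg_one, neg_add_eq_sub] at this
  have hgwN : g • w ∉ Nodes := hgw ▸ hm1
  refine ⟨w, ⟨hwN, hgwN⟩, (-m).toNat, by omega, ?_, ?_⟩
  swap
  · rw [hw, inv_smul_smul, ← zpow_natCast, hUadd, Int.toNat_of_nonneg (by omega)]; simp [U0]
  have hmem : ∀ {x}, x ∈ range (U m) → ∀ k, (f ^ k) x ∈ range (U (k + m)) := fun hx k => by
    rw [← hUadd]; exact mem_range_smul hx
  have spr : ∀ x, x ∈ range (U m) → ¬ Near g (g⁻¹ (b x)) (b x) →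
      (∃ k : ℤ, ¬ Near f ((f ^ k) x) ((f ^ (k + 1)) x)) ∧
      (∀ k : ℤ, ¬ Near f ((f ^ k) x) ((f ^ (k + 1)) x) → k + 1 ≤ (S : ℕ)) ∧
      ∀ k : ℤ, ¬ Near g ((g ^ k) (b x)) ((g ^ (k + 1)) (b x)) → k + 1 ≤ (S : ℕ) := by
    intro x hx hnear
    have hxc : x ∈ Ioc c e := by
      obtain ⟨s, rfl⟩ := hx
      exact h.zpow_mem (huc (mem_range_self s)) m
    have hxb : b x ∈ range w := mem_range_smul hx
    have hfx : f x ≠ x := by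
      intro hf
      have : g⁻¹ (b x) = b x := by rw [Equiv.Perm.inv_eq_iff_eq, ← h.conj, hf]
      rw [this] at hnear
      obtain ⟨s, hs⟩ := hxb
      exact hnear (h.regg.near_self (hs ▸ Nodes.pos hwN s) (hs ▸ Nodes.le_one hwN s))
    have hxe : x < e := lt_of_le_of_ne hxc.2 fun hh => hfx (hh ▸ h.right)
    obtain ⟨h1, h2, h3⟩ := h.spread hxc.1 hxe hfx
    have hnear' : ¬ Near g ((g ^ (-1 : ℤ)) (b x)) ((g ^ (-1 + 1 : ℤ)) (b x)) := by
      simpa using hnear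
    refine ⟨h1, fun k hk => ?_, fun k hk => ?_⟩
    · have := (abs_le.1 (h2 k _ hk hnear')).2; omega
    · have := (abs_le.1 (h3 k _ hk hnear')).2; omega
  rw [Int.toNat_le]
  by_cases hd : ∃ p, p ∈ range w ∧ p ∈ range (g⁻¹ • w)
  · obtain ⟨p, hp1, hp2⟩ := hd
    have hN' : g⁻¹ • w ∈ Nodes := hgw' ▸ hm _ (by omega)
    obtain ⟨γ, hγ, hγe⟩ : ∃ γ, IsCell γ ∧ g⁻¹ • w = w ∘ γ := by
      rcases Nodes.comparable hN' hwN hp2 hp1 with H | ⟨γ, hγ, hγe⟩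
      · exact H
      · refine absurd ?_ hgwN
        have := congrArg (g • ·) hγe
        simp only [smul_comp, smul_inv_smul] at this
        rw [this]; exact Nodes.comp hwN hγ
    have hUγ : ∀ n, U (n - 1) = U n ∘ γ := by
      have h1 : U (m - 1) = U m ∘ γ := by
        rw [hgw', hw, ← smul_comp, smul_left_cancel_iff] at hγe
        exact hγe
      intro n
      have := congrArg (f ^ (n - m) • ·) h1
      simp only [smul_comp, hUadd] at this
      rwa [show n - m + (m - 1) = n - 1 by ring, show n - m + m = n by ring] at this
    obtain ⟨x, hx, hnear⟩ : ∃ x ∈ range (U m), ¬ Near g (g⁻¹ (b x)) (b x) := by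
      have hmid : w UI.half ∈ Mid g := ⟨w, ⟨hwN, hgwN⟩, rfl⟩
      have hval : ∀ s, g⁻¹ (b (U m s)) = w (γ s) := fun s => congrFun hγe s
      rcases hγ.cases with rfl | ⟨δ, hδ, rfl⟩ | ⟨δ, hδ, rfl⟩
      · refine absurd ?_ hgwN
        rw [Function.comp_id, inv_smul_eq_iff] at hγe
        rw [← hγe]; exact hwN
      · refine ⟨U m UI.one, mem_range_self _, ?_⟩
        rw [hval]
        have h1 : w ((hL ∘ δ) UI.one) ≤ w UI.half := Nodes.le_half hwN ⟨δ UI.one, rfl⟩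
        have h2 : w UI.half < w UI.one :=
          Nodes.strictMono hwN (show (UI.half : ℝ) < UI.one by norm_num)
        exact (not_near_iff (Nodes.pos hwN _) (h1.trans_lt h2) (Nodes.le_one hwN _)).2
          ⟨_, hmid, h1, h2⟩
      · refine ⟨U m UI.half, mem_range_self _, ?_⟩
        rw [hval, near_comm]
        have h1 : w UI.half < w ((hR ∘ δ) UI.half) := Nodes.half_lt hwN ⟨δ UI.half, rfl⟩
        exact (not_near_iff (Nodes.pos hwN _) h1 (Nodes.le_one hwN _)).2 ⟨_, hmid, le_rfl, h1⟩
    obtain ⟨⟨k, hk⟩, h2, -⟩ := spr x hx hnear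
    have := h2 k hk
    by_contra! hlt
    apply hk
    refine ⟨U (k + 1 + m), hu _ (by omega), ?_, hmem hx _, ?_⟩
    · have h3 := hmem hx k
      rw [show k + m = k + 1 + m - 1 by ring, hUγ] at h3
      exact range_comp_subset_range _ _ h3
    · have := hUadd 1 (k + 1 + m)
      rw [zpow_one] at this
      rw [this]; exact hu _ (by omega)
  · have hdis : ∀ n p, p ∈ range (U n) → p ∉ range (U (n - 1)) := by
      intro n p h1 h2
      refine hd ⟨b ((f ^ (m - n)) p), ?_, ?_⟩
      · refine mem_range_smul ?_
        have := mem_range_smul (f := f ^ (m - n)) h1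
        rwa [hUadd, sub_add_cancel] at this
      · rw [hgw']
        refine mem_range_smul ?_
        have := mem_range_smul (f := f ^ (m - n)) h2
        rwa [hUadd, show m - n + (n - 1) = m - 1 by ring] at this
    set x := U m UI.half with hx
    have hxU : x ∈ range (U m) := mem_range_self _
    have hnear : ¬ Near g (g⁻¹ (b x)) (b x) := by
      rw [near_comm]
      refine not_near_of_bad hwN hgwN (mem_range_smul hxU) fun hh => hd ⟨_, hh, ?_⟩
      exact mem_range_smul (mem_range_smul hxU)
    obtain ⟨-, h2, h3⟩ := spr x hxU hnear
    by_cases hall : ∀ n, U n ∈ Nodes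
    · have hfin : {i | b • U i ∉ Nodes}.Finite := hbad.subset fun i hi => ⟨hall i, hi⟩
      obtain ⟨i, hi, hmx⟩ := exists_max_image _ id hfin ⟨0, by
        show b • U 0 ∉ Nodes
        rwa [U0]⟩
      have hi0 : 0 ≤ i := hmx 0 (by show b • U 0 ∉ Nodes; rwa [U0])
      have hi1 : b • U (i + 1) ∈ Nodes := by
        by_contra hh
        have := hmx (i + 1) hh
        simp only [id] at this
        omega
      have := h3 (i - m) ?_
      · omega
      rw [← near_inv_iff, ← zpow_succ_apply, ← zpow_succ_apply]
      have hb1 : ∀ k, (g ^ k) (b x) ∈ range (b • U (k + m)) := fun k => by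
        rw [← hbUadd]; exact mem_range_smul (mem_range_smul hxU)
      refine not_near_of_bad hi1 ?_ ?_ ?_
      · have := hbUadd (-1) (i + 1)
        rw [zpow_neg_one, show -1 + (i + 1) = i by ring] at this
        rw [this]; exact hi
      · have := hb1 (i - m + 1)
        rwa [show i - m + 1 + m = i + 1 by ring] at this
      · have h4 := hb1 (i - m + 1 + 1)
        rw [show i - m + 1 + 1 + m = i + 2 by ring] at h4
        intro h5
        obtain ⟨s, hs⟩ := h4
        obtain ⟨s', hs'⟩ := h5
        have h6 : U (i + 1) s' = U (i + 2) s := b.injective (hs'.trans hs.symm)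
        refine hdis (i + 2) (U (i + 2) s) (mem_range_self _) ?_
        rw [← h6, show i + 2 - 1 = i + 1 by ring]; exact mem_range_self _
    · push Not at hall
      obtain ⟨n, hn, hmin⟩ := Int.exists_least_of_bdd (P := fun n => U n ∉ Nodes)
        ⟨0, fun n hn => by
          by_contra! h0
          exact hn (hu n h0.le)⟩ hall
      have hn0 : 0 < n := by
        by_contra! h0
        exact hn (hu n h0)
      have hn1 : U (n - 1) ∈ Nodes := by
        by_contra hh
        have := hmin _ hh
        omega
      have := h2 (n - 2 - m) ?_
      · omega
      rw [near_comm]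
      refine not_near_of_bad hn1 ?_ ?_ ?_
      · have := hUadd 1 (n - 1)
        rw [zpow_one, show 1 + (n - 1) = n by ring] at this
        rwa [this]
      · have := hmem hxU (n - 2 - m + 1)
        rwa [show n - 2 - m + 1 + m = n - 1 by ring] at this
      · intro hh
        have h4 := hmem hxU (n - 2 - m)
        rw [show n - 2 - m + m = n - 1 - 1 by ring] at h4
        exact hdis _ _ hh h4

end Comp

lemma mem_range_spine {k : ℕ} {x : ℝ} : x ∈ range (spine k) ↔ 1 - 1 / 2 ^ k < x ∧ x ≤ 1 := by
  have h2 : (0 : ℝ) < 2 ^ k := by positivity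
  constructor
  · rintro ⟨s, rfl⟩
    have h0 := s.2.1
    have h1 := s.2.2
    simp only [spine]
    have : (1 - (s : ℝ)) / 2 ^ k < 1 / 2 ^ k := by gcongr; linarith
    have : 0 ≤ (1 - (s : ℝ)) / 2 ^ k := div_nonneg (by linarith) h2.le
    constructor <;> linarith
  · rintro ⟨h0, h1⟩
    have hmul : (1 - x) * 2 ^ k < 1 := by
      rw [← lt_div_iff₀ h2]; linarith
    refine ⟨⟨1 - (1 - x) * 2 ^ k, by linarith, ?_⟩, ?_⟩
    · have : 0 ≤ (1 - x) * 2 ^ k := mul_nonneg (by linarith) h2.le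
      linarith
    · simp only [spine]; field_simp; ring

lemma range_spine_subset {k k' : ℕ} : range (spine k) ⊆ range (spine k') ↔ k' ≤ k := by
  constructor
  · intro h
    by_contra! hlt
    have h1 := h (mem_range_self (hL UI.one))
    rw [mem_range_spine] at h1
    have h2 : (1 : ℝ) / 2 ^ k' ≤ 1 / 2 ^ (k + 1) :=
      one_div_le_one_div_of_le (by positivity) (pow_le_pow_right₀ (by norm_num) hlt)
    have h3 : spine k (hL UI.one) = 1 - 1 / 2 ^ (k + 1) := by
      simp only [spine, hL_val, UI.one_val, pow_succ]; field_simp; norm_num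
    linarith [h1.1]
  · intro h x
    rw [mem_range_spine, mem_range_spine]
    have h2 : (1 : ℝ) / 2 ^ k ≤ 1 / 2 ^ k' :=
      one_div_le_one_div_of_le (by positivity) (pow_le_pow_right₀ (by norm_num) h)
    rintro ⟨a, b⟩
    exact ⟨by linarith, b⟩

lemma pow_smul_spine {f : Equiv.Perm ℝ} {K d : ℕ} (h : f • spine K = spine (K + d)) (n : ℕ) :
    f ^ n • spine K = spine (K + n * d) := by
  induction n with
  | zero => simp
  | succ n ih =>
    rw [pow_succ, mul_smul, h]
    have := smul_spine_add ih d
    rw [this]; congr 1; ring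

lemma lt_of_smul_spine {f : Equiv.Perm ℝ} {K K' : ℕ} (h : f • spine K = spine K') (hlt : K < K')
    {x : ℝ} (hx : x ∈ range (spine K)) (hx1 : x < 1) : x < f x := by
  obtain ⟨s, rfl⟩ := hx
  have e : f (spine K s) = spine K' s := congrFun h s
  rw [e]
  simp only [spine] at hx1 ⊢
  have h2 : (0 : ℝ) < 2 ^ K := by positivity
  have hs : 0 < 1 - (s : ℝ) := by
    by_contra! hs
    have : (1 - (s : ℝ)) / 2 ^ K ≤ 0 := div_nonpos_of_nonpos_of_nonneg hs h2.le
    linarith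
  have h3 : (2 : ℝ) ^ K < 2 ^ K' := pow_lt_pow_right₀ (by norm_num) hlt
  have : (1 - (s : ℝ)) / 2 ^ K' < (1 - s) / 2 ^ K := div_lt_div_of_pos_left hs h2 h3
  linarith

lemma le_of_smul_spine {f : Equiv.Perm ℝ} {K K' : ℕ} (h : f • spine K = spine K') (hle : K' ≤ K)
    {x : ℝ} (hx : x ∈ range (spine K)) : f x ≤ x := by
  obtain ⟨s, rfl⟩ := hx
  have e : f (spine K s) = spine K' s := congrFun h s
  rw [e]
  simp only [spine]
  have hs : 0 ≤ 1 - (s : ℝ) := by have := s.2.2; linarith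
  have h3 : (2 : ℝ) ^ K' ≤ 2 ^ K := pow_le_pow_right₀ (by norm_num) hle
  have : (1 - (s : ℝ)) / 2 ^ K ≤ (1 - s) / 2 ^ K' := div_le_div_of_nonneg_left hs (by positivity) h3
  linarith

namespace Comp

variable {f g b : Equiv.Perm ℝ} {c : ℝ}

lemma smul_spine_mem_of_lt (h : Comp f g b c 1) {K K' : ℕ} (hK : f • spine K = spine K')
    (hlt : K < K') : b • spine K' ∈ Nodes := by
  have b1 : b 1 = 1 := h.regb.one_le 1 le_rfl
  have g1 : g 1 = 1 := h.regg.one_le 1 le_rfl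
  have hup : ∀ {x}, x ∈ range (spine K) → x < 1 → x < f x := lt_of_smul_spine hK hlt
  have h1K : (1 : ℝ) ∈ range (spine K) := ⟨_, spine_one K⟩
  have hnear : ∀ x ∈ range (spine K), x < 1 → Near g (b (f x)) 1 := by
    intro x hx hx1
    have hc : c < x := by
      by_contra! hcx
      have := hup (Nodes.convex (spine_mem K) hx h1K hcx h.lt.le) h.lt
      exact absurd h.left this.ne'
    obtain ⟨z, z', a1, a2, hB, a3, a4⟩ := exists_bump h.regf h.nonneg h.le_one h.left h.right
      h.active hc hx1 (hup hx hx1).ne'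
    obtain rfl : z' = 1 := by
      by_contra hne
      have hz1 : z' < 1 := lt_of_le_of_ne a2 hne
      exact absurd hB.right (hup (Nodes.convex (spine_mem K) hx h1K a4.le a2) hz1).ne'
    obtain ⟨y, hy, hy0⟩ := hB.exists_incOrb h.regf a3 a4
    have hy1 : y 1 = f x := by
      rcases hy.orb with ho | ho
      · rw [← hy0, ← ho]; rfl
      · have e1 : x = f (y 1) := by rw [← hy0, ho 0]; rfl
        have l1 : x < y 1 := by rw [← hy0]; exact hy.mono one_pos
        have := hup (Nodes.convex (spine_mem K) hx h1K l1.le (hy.lt 1).le) (hy.lt 1)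
        linarith
    obtain ⟨α₁, β₁, -, -, -, w4, -⟩ := hy.window h.regf hB
    obtain ⟨α₂, β₂, -, -, -, v4, -⟩ := (hy.conj h.regb h.conj).window h.regg
      (hB.conj h.regb h.conj)
    have hr := h.shift_le _ z 1 y β₁ β₂ rfl a1 a2 hB hy w4 v4
    have hβ : β₁ ≤ 0 := (w4 0).1 ⟨_, spine_mem K, by rwa [hy0], h1K, by rw [hK]; exact spine_mem _⟩
    simp only [Ioo_self, inter_empty, ncard_empty] at hr
    rw [abs_le] at hr
    have := (v4 1).2 (by push_cast at hr; omega)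
    rwa [hy1, b1] at this
  have hnear' : ∀ x ∈ range (spine K), x < 1 →
      ∃ k k', g • spine k = spine k' ∧ b (f x) ∈ range (spine k) := by
    intro x hx hx1
    obtain ⟨t, ht, hxt, h1t, hgt⟩ := hnear x hx hx1
    have ht1 : t UI.one = 1 := by
      obtain ⟨s, hs⟩ := h1t
      refine le_antisymm (Nodes.le_one ht _) ?_
      rw [← hs]
      exact (Nodes.strictMono ht).monotone (UI.le_one s)
    obtain ⟨k, rfl⟩ := Nodes.eq_spine ht ht1
    obtain ⟨k', hk'⟩ := Nodes.eq_spine hgt (by rw [perm_smul_apply, spine_one, g1])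
    exact ⟨k, k', hk', hxt⟩
  have hx0 : spine K UI.half < 1 := by
    rw [← spine_one K]
    exact Nodes.strictMono (spine_mem K) (show (UI.half : ℝ) < UI.one by norm_num)
  classical
  have hex : ∃ k k', g • spine k = spine k' := by
    obtain ⟨k, k', hk, -⟩ := hnear' _ (mem_range_self UI.half) hx0
    exact ⟨k, k', hk⟩
  obtain ⟨k₁, hk₁⟩ := Nat.find_spec hex
  have hmin : ∀ k, (∃ k', g • spine k = spine k') → Nat.find hex ≤ k := fun k hk =>
    Nat.find_min' hex hk
  generalize Nat.find hex = k₀ at *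
  have hsub : range (b • spine K') ⊆ range (spine k₀) := by
    rintro _ ⟨s, rfl⟩
    rw [← hK]
    change b (f (spine K s)) ∈ _
    rcases (Nodes.le_one (spine_mem K) s).eq_or_lt with hs | hs
    · rw [hs, h.right, b1]; exact ⟨_, spine_one _⟩
    · obtain ⟨k, k', hk, hm⟩ := hnear' _ (mem_range_self s) hs
      exact range_spine_subset.2 (hmin k ⟨k', hk⟩) hm
  have hlt₁ : k₀ < k₁ := by
    by_contra! hle
    have hx' : spine K' UI.half < 1 := by
      rw [← spine_one K']
      exact Nodes.strictMono (spine_mem K') (show (UI.half : ℝ) < UI.one by norm_num)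
    have l1 := le_of_smul_spine hk₁ hle (hsub (mem_range_self UI.half))
    rw [perm_smul_apply, ← h.conj, h.regb.mono.le_iff_le] at l1
    exact absurd (hup (range_spine_subset.2 hlt.le (mem_range_self UI.half)) hx') (not_lt.2 l1)
  obtain ⟨d, rfl⟩ := Nat.exists_eq_add_of_lt hlt
  obtain ⟨d', rfl⟩ := Nat.exists_eq_add_of_lt hlt₁
  set V := K + d + 1 with hV
  have hfn : ∀ n, f ^ n • spine V = spine (V + n * (d + 1)) := by
    refine pow_smul_spine ?_
    have := smul_spine_add hK (d + 1)
    rw [← add_assoc, ← hV] at this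
    rw [this]
  obtain ⟨n, hn⟩ : ∃ n : ℕ, b • f ^ n • spine V ∈ Nodes := by
    by_contra! hno
    have hinj : Function.Injective fun n : ℕ => f ^ n • spine V := by
      intro n n' hnn
      simp only [hfn] at hnn
      have := spine_inj hnn
      exact Nat.eq_of_mul_eq_mul_right (Nat.succ_pos d) (Nat.add_left_cancel this)
    refine infinite_range_of_injective hinj (h.regb.finT.subset ?_)
    rintro _ ⟨n, rfl⟩
    refine ⟨?_, hno n⟩
    simp only [hfn]; exact spine_mem _
  have hcomm : b • f ^ n • spine V = g ^ n • b • spine V := by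
    rw [← mul_smul, ← mul_smul]
    congr 1
    exact (SemiconjBy.pow_right (show SemiconjBy b f g from Equiv.ext h.conj) n)
  obtain ⟨j, hj⟩ := Nodes.eq_spine hn (by
    rw [hfn, perm_smul_apply, spine_one, b1])
  have hgn : g ^ n • spine k₀ = spine (k₀ + n * (d' + 1)) := pow_smul_spine hk₁ n
  have hle : k₀ + n * (d' + 1) ≤ j := by
    rw [← range_spine_subset, ← hj, hcomm, ← hgn]
    rintro _ ⟨s, rfl⟩
    exact mem_range_smul (hsub (mem_range_self s))
  obtain ⟨i, rfl⟩ := Nat.exists_eq_add_of_le hle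
  rw [hcomm, ← smul_spine_add hgn, smul_left_cancel_iff] at hj
  rw [hj]; exact spine_mem _

/-- Next to an end point `1` that is not isolated from the support, `b` has few carets. -/
lemma smul_spine_mem (h : Comp f g b c 1) {K K' : ℕ} (hK : f • spine K = spine K') :
    b • spine (max K K') ∈ Nodes := by
  rcases lt_trichotomy K K' with hlt | rfl | hlt
  · rw [max_eq_right hlt.le]; exact h.smul_spine_mem_of_lt hK hlt
  · obtain ⟨w, hw1, hw2, hw⟩ := h.active (max ((c + 1) / 2) (spine K UI.half)) 1
      (lt_max_of_lt_left (by have := h.lt; linarith))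
      (max_lt (by have := h.lt; linarith) (by
        rw [← spine_one K]
        exact Nodes.strictMono (spine_mem K) (show (UI.half : ℝ) < UI.one by norm_num))) le_rfl
    obtain ⟨s, rfl⟩ := Nodes.convex (spine_mem K) (mem_range_self UI.half) ⟨_, spine_one K⟩
      ((le_max_right _ _).trans hw1.le) hw2.le
    exact absurd (congrFun hK s) hw
  · rw [max_eq_left hlt.le]
    exact h.inv.smul_spine_mem_of_lt (inv_smul_eq_iff.2 hK.symm) hlt

end Comp

/-- The permutation equal to `a` up to `p` and to `b` beyond `p`. -/
def gluePerm (p : ℝ) (a b : Equiv.Perm ℝ) (ha : StrictMono a) (hb : StrictMono b)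
    (h : a p = b p) : Equiv.Perm ℝ where
  toFun x := if x ≤ p then a x else b x
  invFun y := if y ≤ a p then a⁻¹ y else b⁻¹ y
  left_inv x := by
    by_cases hx : x ≤ p
    · simp [hx, ha.le_iff_le.2 hx]
    · have : ¬ b x ≤ a p := by rw [h, hb.le_iff_le]; exact hx
      simp [hx, this]
  right_inv y := by
    by_cases hy : y ≤ a p
    · have : a⁻¹ y ≤ p := by rw [← ha.le_iff_le]; simpa using hy
      simp only [hy, this, if_true]; simp
    · have : ¬ b⁻¹ y ≤ p := by rw [← hb.le_iff_le, ← h]; simpa using hy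
      simp only [hy, this, if_false]; simp

lemma exists_glue {p : ℝ} {a b : Equiv.Perm ℝ} (ha : StrictMono a) (hb : StrictMono b)
    (h : a p = b p) : ∃ k : Equiv.Perm ℝ, StrictMono k ∧ (∀ x ≤ p, k x = a x) ∧
      (∀ x, p ≤ x → k x = b x) ∧ (∀ y ≤ a p, k⁻¹ y = a⁻¹ y) ∧ ∀ y, a p < y → k⁻¹ y = b⁻¹ y := by
  have h1 : ∀ x ≤ p, gluePerm p a b ha hb h x = a x := fun x hx => if_pos hx
  have h2 : ∀ x, p ≤ x → gluePerm p a b ha hb h x = b x := fun x hx => by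
    rcases hx.eq_or_lt with rfl | hx
    · exact (if_pos le_rfl).trans h
    · exact if_neg (not_le.2 hx)
  refine ⟨gluePerm p a b ha hb h, fun x y hxy => ?_, h1, h2, fun y hy => if_pos hy,
    fun y hy => if_neg (not_le.2 hy)⟩
  rcases le_total y p with hy | hy
  · rw [h1 _ (hxy.le.trans hy), h1 _ hy]; exact ha hxy
  · rcases le_total p x with hx | hx
    · rw [h2 _ hx, h2 _ hy]; exact hb hxy
    · rw [h1 _ hx, h2 _ hy]
      rcases hx.eq_or_lt with rfl | hx'
      · rw [h]; exact hb hxy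
      · exact (ha hx').trans_le (h ▸ hb.monotone hy)

lemma smul_congr {a b : Equiv.Perm ℝ} {u : UI → ℝ} (h : ∀ x ∈ range u, a x = b x) :
    a • u = b • u :=
  funext fun s => h _ (mem_range_self s)

lemma Nodes.range_eq {u : UI → ℝ} (hu : u ∈ Nodes) :
    ∃ a, a < u UI.one ∧ 0 ≤ a ∧ range u = Ioc a (u UI.one) ∧
      ∀ s : UI, u s = a + (u UI.one - a) * s := by
  obtain ⟨a, w, hw, h0, h1, h⟩ := Nodes.affine hu
  have e : u UI.one = a + w := by rw [h]; simp
  refine ⟨a, by linarith, h0, ?_, fun s => by rw [e, h]; ring⟩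
  ext x
  constructor
  · rintro ⟨s, rfl⟩
    have h2 := s.2.1
    have h3 := s.2.2
    rw [mem_Ioc, e, h]
    constructor <;> nlinarith
  · rintro ⟨h2, h3⟩
    refine ⟨⟨(x - a) / w, div_pos (by linarith) hw, ?_⟩, ?_⟩
    · rw [div_le_one hw]; linarith
    · rw [h]; field_simp; ring

lemma Nodes.affine_of_range {u : UI → ℝ} (hu : u ∈ Nodes) {a m : ℝ} (h : range u = Ioc a m) :
    a < m ∧ u UI.one = m ∧ ∀ s : UI, u s = a + (m - a) * s := by
  obtain ⟨a', h1, h0, h2, h3⟩ := Nodes.range_eq hu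
  have ham : a < m := by
    have := mem_range_self (f := u) UI.one
    rw [h] at this
    exact this.1.trans_le this.2
  rw [h] at h2
  obtain ⟨rfl, rfl⟩ := (Ioc_eq_Ioc_iff (Or.inl ham)).1 h2
  exact ⟨ham, rfl, h3⟩

lemma Nodes.range_of_affine {u : UI → ℝ} (hu : u ∈ Nodes) {a w : ℝ}
    (h : ∀ s : UI, u s = a + w * s) : range u = Ioc a (u UI.one) := by
  obtain ⟨a', -, -, h1, h2⟩ := Nodes.range_eq hu
  have e1 := h UI.one
  have e2 := h UI.half
  have e3 := h2 UI.half
  simp only [UI.one_val, UI.half_val] at e1 e2 e3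
  rw [h1]; congr 1; linarith

lemma Nodes.eq_of_range {u v : UI → ℝ} (hu : u ∈ Nodes) (hv : v ∈ Nodes)
    (h : range u = range v) : u = v := by
  obtain ⟨a, -, -, h1, h2⟩ := Nodes.range_eq hv
  obtain ⟨-, h3, h4⟩ := Nodes.affine_of_range hu (h.trans h1)
  exact funext fun s => (h4 s).trans (h2 s).symm

/-- `L` is a list of consecutive nodes that partition `(a, e]`. -/
def Tiling (a : ℝ) : List (UI → ℝ) → ℝ → Prop
  | [], e => a = e
  | t :: L, e => t ∈ Nodes ∧ range t = Ioc a (t UI.one) ∧ Tiling (t UI.one) L e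

/-- The subnodes of the nodes in `L` that `b` does not map to nodes. -/
def Bad (L : List (UI → ℝ)) (b : Equiv.Perm ℝ) : Set (UI → ℝ) :=
  {u | ∃ t ∈ L, ∃ γ, IsCell γ ∧ u = t ∘ γ ∧ b • u ∉ Nodes}

lemma Tiling.range_subset {L : List (UI → ℝ)} : ∀ {a e : ℝ}, Tiling a L e → a ≤ e ∧
    ∀ t ∈ L, t ∈ Nodes ∧ range t ⊆ Ioc a e := by
  induction L with
  | nil => intro a e h; exact ⟨h.le, by simp⟩
  | cons t L ih =>
    rintro a e ⟨h1, h2, h3⟩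
    obtain ⟨i1, i2⟩ := ih h3
    have h4 := (Nodes.affine_of_range h1 h2).1
    refine ⟨h4.le.trans i1, fun s hs => ?_⟩
    rcases List.mem_cons.1 hs with rfl | hs
    · exact ⟨h1, h2.le.trans (Ioc_subset_Ioc_right i1)⟩
    · exact ⟨(i2 s hs).1, (i2 s hs).2.trans (Ioc_subset_Ioc_left h4.le)⟩

lemma exists_affine {t t' : UI → ℝ} (ht : t ∈ Nodes) (ht' : t' ∈ Nodes) {a m a' m' : ℝ}
    (h : range t = Ioc a m) (h' : range t' = Ioc a' m') :
    ∃ b : Equiv.Perm ℝ, StrictMono b ∧ b a = a' ∧ b m = m' ∧ b • t = t' := by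
  obtain ⟨h1, h2, h3⟩ := Nodes.affine_of_range ht h
  obtain ⟨h1', h2', h3'⟩ := Nodes.affine_of_range ht' h'
  have hp : 0 < m - a := by linarith
  have hp' : 0 < m' - a' := by linarith
  refine ⟨⟨fun x => a' + (x - a) / (m - a) * (m' - a'), fun x => a + (x - a') / (m' - a') * (m - a),
    fun x => by field_simp; ring, fun x => by field_simp; ring⟩, ?_, ?_, ?_, ?_⟩
  · intro x y hxy
    change a' + (x - a) / (m - a) * (m' - a') < a' + (y - a) / (m - a) * (m' - a')
    gcongr
  · change a' + (a - a) / (m - a) * (m' - a') = a'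
    simp
  · change a' + (m - a) / (m - a) * (m' - a') = m'
    field_simp; ring
  · funext s
    change a' + (t s - a) / (m - a) * (m' - a') = t' s
    rw [h3, h3']; field_simp; ring

lemma bad_singleton {t : UI → ℝ} {b : Equiv.Perm ℝ} (h : b • t ∈ Nodes) : Bad [t] b = ∅ := by
  rw [eq_empty_iff_forall_notMem]
  rintro u ⟨s, hs, γ, hγ, rfl, hb⟩
  obtain rfl := List.mem_singleton.1 hs
  exact hb (Nodes.comp h hγ)

lemma Bad.congr {L : List (UI → ℝ)} {a b : Equiv.Perm ℝ}
    (h : ∀ t ∈ L, ∀ x ∈ range t, a x = b x) : Bad L a = Bad L b := by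
  ext u
  refine exists_congr fun t => and_congr_right fun ht => exists_congr fun γ =>
    and_congr_right fun _ => and_congr_right fun hu => ?_
  rw [smul_congr (a := a) (b := b)]
  rintro x hx
  rw [hu] at hx
  exact h t ht x (range_comp_subset_range _ _ hx)

lemma Bad.cons (t : UI → ℝ) (L : List (UI → ℝ)) (b : Equiv.Perm ℝ) :
    Bad (t :: L) b = Bad [t] b ∪ Bad L b := by
  ext u
  constructor
  · rintro ⟨s, hs, h⟩
    rcases List.mem_cons.1 hs with rfl | hs
    · exact Or.inl ⟨s, List.mem_singleton.2 rfl, h⟩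
    · exact Or.inr ⟨s, hs, h⟩
  · rintro (⟨s, hs, h⟩ | ⟨s, hs, h⟩)
    · exact ⟨s, List.mem_cons.2 (Or.inl (List.mem_singleton.1 hs)), h⟩
    · exact ⟨s, List.mem_cons.2 (Or.inr hs), h⟩

lemma Bad.split (t : UI → ℝ) (b : Equiv.Perm ℝ) :
    Bad [t] b ⊆ insert t (Bad [t ∘ hL, t ∘ hR] b) := by
  rintro u ⟨s, hs, γ, hγ, rfl, hb⟩
  obtain rfl := List.mem_singleton.1 hs
  rcases hγ.cases with rfl | ⟨δ, hδ, rfl⟩ | ⟨δ, hδ, rfl⟩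
  · exact Or.inl rfl
  · exact Or.inr ⟨s ∘ hL, by simp, δ, hδ, rfl, hb⟩
  · exact Or.inr ⟨s ∘ hR, by simp, δ, hδ, rfl, hb⟩

/-- A map between two tiled intervals, with control on the nodes that are not mapped to nodes. -/
structure Match (L L' : List (UI → ℝ)) (a e a' e' : ℝ) (n : ℕ) (b : Equiv.Perm ℝ) : Prop where
  mono : StrictMono b
  left : b a = a'
  right : b e = e'
  fin : (Bad L b).Finite
  fin' : (Bad L' b⁻¹).Finite
  card : (Bad L b).ncard + (Bad L' b⁻¹).ncard ≤ n

lemma Match.symm {L L' : List (UI → ℝ)} {a e a' e' : ℝ} {n : ℕ} {b : Equiv.Perm ℝ}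
    (h : Match L L' a e a' e' n b) : Match L' L a' e' a e n b⁻¹ where
  mono := strictMono_inv h.mono
  left := by rw [← h.left]; simp
  right := by rw [← h.right]; simp
  fin := h.fin'
  fin' := by rw [inv_inv]; exact h.fin
  card := by rw [inv_inv, add_comm]; exact h.card

lemma Match.cons {t t' : UI → ℝ} {L L' : List (UI → ℝ)} {a e a' e' : ℝ} {n : ℕ}
    {b : Equiv.Perm ℝ} (hL : Tiling a (t :: L) e) (hL' : Tiling a' (t' :: L') e')
    (h : Match L L' (t UI.one) e (t' UI.one) e' n b) :
    ∃ b', Match (t :: L) (t' :: L') a e a' e' n b' := by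
  obtain ⟨h1, h2, h3⟩ := hL
  obtain ⟨h1', h2', h3'⟩ := hL'
  obtain ⟨k, k1, k2, k3, k4⟩ := exists_affine h1 h1' h2 h2'
  obtain ⟨r, r1, r2, r3, r4, r5⟩ := exists_glue k1 h.mono (k3.trans h.left.symm)
  rw [k3] at r4 r5
  have hk : k⁻¹ • t' = t := inv_smul_eq_iff.2 k4.symm
  have e1 : Bad [t] r = ∅ := by
    rw [Bad.congr (b := k), bad_singleton (by rw [k4]; exact h1')]
    intro s hs x hx
    rw [List.mem_singleton.1 hs, h2] at hx
    exact r2 x hx.2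
  have e2 : Bad [t'] r⁻¹ = ∅ := by
    rw [Bad.congr (b := k⁻¹), bad_singleton (by rw [hk]; exact h1)]
    intro s hs x hx
    rw [List.mem_singleton.1 hs, h2'] at hx
    exact r4 x hx.2
  have e3 : Bad (t :: L) r = Bad L b := by
    rw [Bad.cons, e1, empty_union]
    exact Bad.congr fun s hs x hx => r3 x (h3.range_subset.2 s hs |>.2 hx).1.le
  have e4 : Bad (t' :: L') r⁻¹ = Bad L' b⁻¹ := by
    rw [Bad.cons, e2, empty_union]
    exact Bad.congr fun s hs x hx => r5 x (h3'.range_subset.2 s hs |>.2 hx).1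
  refine ⟨r, r1, ?_, ?_, ?_, ?_, ?_⟩
  · rw [r2 _ (Nodes.affine_of_range h1 h2).1.le, k2]
  · rw [r3 _ h3.range_subset.1, h.right]
  · rw [e3]; exact h.fin
  · rw [e4]; exact h.fin'
  · rw [e3, e4]; exact h.card

lemma Tiling.split {t : UI → ℝ} {a e : ℝ} (h : Tiling a [t] e) :
    Tiling a [t ∘ hL, t ∘ hR] e := by
  obtain ⟨h1, h2, rfl⟩ := h
  obtain ⟨h3, -, h4⟩ := Nodes.affine_of_range h1 h2
  have eR : (t ∘ hR) UI.one = t UI.one := by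
    simp only [Function.comp, h4 (hR _), hR_val, UI.one_val]; ring
  have eL : (t ∘ hL) UI.one = (a + t UI.one) / 2 := by
    simp only [Function.comp, h4 (hL _), hL_val, UI.one_val]; ring
  refine ⟨Nodes.comp h1 isCell_hL, ?_, Nodes.comp h1 isCell_hR, ?_, eR⟩
  · refine Nodes.range_of_affine (w := (t UI.one - a) / 2) (Nodes.comp h1 isCell_hL) fun s => ?_
    simp only [Function.comp, h4 (hL _), hL_val]; ring
  · rw [eL]
    refine Nodes.range_of_affine (w := (t UI.one - a) / 2) (Nodes.comp h1 isCell_hR) fun s => ?_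
    simp only [Function.comp, h4 (hR _), hR_val]; ring

lemma exists_match : ∀ N : ℕ, ∀ {L L' : List (UI → ℝ)} {a e a' e' : ℝ},
    L.length + L'.length = N → L ≠ [] → L' ≠ [] → Tiling a L e → Tiling a' L' e' →
    ∃ b, Match L L' a e a' e' (L.length - 1 + (L'.length - 1)) b := by
  intro N
  induction N using Nat.strong_induction_on with
  | _ N ih =>
    have single : ∀ {t t' s' : UI → ℝ} {L' : List (UI → ℝ)} {a e a' e' : ℝ},
        1 + (s' :: L').length < N → Tiling a [t] e → Tiling a' (t' :: s' :: L') e' →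
        ∃ b, Match [t] (t' :: s' :: L') a e a' e' (L'.length + 1) b := by
      intro t t' s' L' a e a' e' hN h h'
      have hs := h.split
      obtain ⟨b, hb⟩ := ih _ hN (L := [t ∘ hR]) rfl (by simp) (by simp) hs.2.2 h'.2.2
      obtain ⟨b', hb'⟩ := hb.cons hs h'
      refine ⟨b', hb'.mono, hb'.left, hb'.right, (hb'.fin.insert t).subset (Bad.split t b'),
        hb'.fin', ?_⟩
      have h1 := ncard_le_ncard (Bad.split t b') (hb'.fin.insert t)
      have h2 := ncard_insert_le t (Bad [t ∘ hL, t ∘ hR] b')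
      have h3 := hb'.card
      simp at h3
      omega
    intro L L' a e a' e' hN hne hne' h h'
    match L, L' with
    | [], _ => exact absurd rfl hne
    | _ :: _, [] => exact absurd rfl hne'
    | [t], [t'] =>
      obtain ⟨h1, h2, rfl⟩ := h
      obtain ⟨h1', h2', rfl⟩ := h'
      obtain ⟨k, k1, k2, k3, k4⟩ := exists_affine h1 h1' h2 h2'
      have hk : k⁻¹ • t' = t := inv_smul_eq_iff.2 k4.symm
      have e1 : Bad [t] k = ∅ := bad_singleton (by rw [k4]; exact h1')
      have e2 : Bad [t'] k⁻¹ = ∅ := bad_singleton (by rw [hk]; exact h1)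
      exact ⟨k, k1, k2, k3, by simp [e1], by simp [e2], by simp [e1, e2]⟩
    | [t], t' :: s' :: L' =>
      obtain ⟨b, hb⟩ := single (by simp at hN ⊢; omega) h h'
      exact ⟨b, by simpa using hb⟩
    | t :: s :: L, [t'] =>
      obtain ⟨b, hb⟩ := single (by simp at hN ⊢; omega) h' h
      exact ⟨b⁻¹, by simpa using hb.symm⟩
    | t :: s :: L, t' :: s' :: L' =>
      obtain ⟨b, hb⟩ := ih _ (by rw [← hN]; simp; omega) (L := s :: L) (L' := s' :: L') rfl
        (by simp) (by simp) h.2.2 h'.2.2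
      obtain ⟨b', hb'⟩ := hb.cons h h'
      refine ⟨b', hb'.mono, hb'.left, hb'.right, hb'.fin, hb'.fin', hb'.card.trans ?_⟩
      simp; omega

lemma exists_node_right {a m : ℝ} (ha : a = 0 ∨ Dy a) (ham : a < m) :
    ∃ P ∈ Nodes, P UI.one < m ∧ range P = Ioc a (P UI.one) := by
  obtain ⟨w, hw, N, hN, hs⟩ : ∃ w : ℝ, 0 < w ∧ ∃ N ∈ Nodes, ∀ s : UI, N s = a + w * s := by
    rcases ha with rfl | ⟨v, hv, rfl⟩
    · exact ⟨1, one_pos, _, root_mem, fun s => by ring⟩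
    · obtain ⟨α, w, hw, -, -, hs⟩ := Nodes.affine hv
      refine ⟨w / 2, by positivity, v ∘ hR, Nodes.comp hv isCell_hR, fun s => ?_⟩
      simp only [Function.comp, hs, hR_val, UI.half_val]; ring
  have key : ∀ k : ℕ, ∃ P ∈ Nodes, ∀ s : UI, P s = a + w * (1 / 2) ^ k * s := by
    intro k
    induction k with
    | zero => exact ⟨N, hN, fun s => by rw [hs]; ring⟩
    | succ k ih =>
      obtain ⟨P, hP, hPs⟩ := ih
      refine ⟨P ∘ hL, Nodes.comp hP isCell_hL, fun s => ?_⟩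
      simp only [Function.comp, hPs, hL_val, pow_succ]; ring
  obtain ⟨k, hk⟩ := exists_pow_lt_of_lt_one (show 0 < (m - a) / w from div_pos (by linarith) hw)
    (show (1 / 2 : ℝ) < 1 by norm_num)
  obtain ⟨P, hP, hPs⟩ := key k
  refine ⟨P, hP, ?_, Nodes.range_of_affine hP hPs⟩
  rw [hPs, UI.one_val]
  rw [lt_div_iff₀ hw] at hk
  linarith

lemma Near.lt_of_mem_Mid {f : Equiv.Perm ℝ} {x y m : ℝ} (h : Near f x y) (hm : m ∈ Mid f)
    (hmy : m < y) : m < x := by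
  by_contra! hx
  obtain ⟨t, ht, hxt, hyt, -⟩ := id h
  obtain ⟨s, rfl⟩ := hxt
  obtain ⟨s', rfl⟩ := hyt
  exact (not_near_iff (Nodes.pos ht s) (hx.trans_lt hmy) (Nodes.le_one ht s')).2 ⟨m, hm, hx, hmy⟩ h

lemma near_of_node {f : Equiv.Perm ℝ} {u : UI → ℝ} (hu : u ∈ Nodes) (hfu : f • u ∈ Nodes)
    (s s' : UI) : Near f (u s) (u s') :=
  ⟨u, hu, mem_range_self s, mem_range_self s', hfu⟩

lemma exists_tile {f : Equiv.Perm ℝ} {a m : ℝ} (ha : a = 0 ∨ a ∈ Mid f) (hm : m = 1 ∨ m ∈ Mid f)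
    (ham : a < m) (hno : ∀ w ∈ Mid f, a < w → m ≤ w) : ∃ r ∈ Nodes, range r = Ioc a m := by
  have hm1 : m ≤ 1 := by
    rcases hm with rfl | ⟨u, hu, rfl⟩
    exacts [le_rfl, Nodes.le_one hu.1 _]
  have ha0 : 0 ≤ a := by
    rcases ha with rfl | ⟨u, hu, rfl⟩
    exacts [le_rfl, (Nodes.pos hu.1 _).le]
  obtain ⟨P, hP, hPm, hPr⟩ := exists_node_right (ha.imp_right dy_of_mem_Mid) ham
  have haP : a < P UI.one := (Nodes.affine_of_range hP hPr).1
  have hnear : Near f (P UI.one) m := by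
    by_contra hn
    obtain ⟨w, hw, h1, h2⟩ := (not_near_iff (ha0.trans_lt haP) hPm hm1).1 hn
    exact absurd (hno w hw (haP.trans_le h1)) (not_le.2 h2)
  obtain ⟨r, hr, hxr, hmr, hfr⟩ := hnear
  obtain ⟨sm, hsm⟩ := hmr
  have hone : r UI.one = m := by
    refine le_antisymm ?_ (by rw [← hsm]; exact (Nodes.strictMono hr).monotone (UI.le_one sm))
    rcases hm with rfl | hm
    · exact Nodes.le_one hr _
    · by_contra! hlt
      have := (near_of_node hr hfr sm UI.one).lt_of_mem_Mid hm hlt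
      exact absurd hsm this.ne'
  have hgt : ∀ s, a < r s := by
    intro s
    rcases ha with rfl | ha
    · exact Nodes.pos hr s
    · exact (near_of_node hr hfr s UI.one).lt_of_mem_Mid ha (by rwa [hone])
  refine ⟨r, hr, ?_⟩
  obtain ⟨a', h1, -, h2, -⟩ := Nodes.range_eq hr
  rw [h2, hone]
  congr 1
  refine le_antisymm ?_ ?_
  · rcases Nodes.comparable hr hP hxr (mem_range_self _) with ⟨γ, hγ, e⟩ | ⟨γ, hγ, e⟩
    · have : r UI.one ≤ P UI.one := by
        rw [e]; exact (Nodes.strictMono hP).monotone (UI.le_one _)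
      linarith
    · have hsub : Ioc a (P UI.one) ⊆ Ioc a' (r UI.one) := by
        rw [← hPr, ← h2, e]; exact range_comp_subset_range _ _
      exact ((Ioc_subset_Ioc_iff haP).1 hsub).2
  · by_contra! hlt
    have : a ∈ range r := by rw [h2]; exact ⟨hlt, by linarith⟩
    obtain ⟨s, hs⟩ := this
    exact absurd hs (hgt s).ne'

lemma Nodes.exists_comp_of_range_subset {u v : UI → ℝ} (hu : u ∈ Nodes) (hv : v ∈ Nodes)
    (h : range u ⊆ range v) : ∃ γ, IsCell γ ∧ u = v ∘ γ := by
  rcases Nodes.comparable hu hv (mem_range_self UI.one) (h (mem_range_self UI.one)) with H | ⟨γ, hγ, e⟩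
  · exact H
  · refine ⟨id, isCell_id, Nodes.eq_of_range hu hv (h.antisymm ?_)⟩
    rw [e]; exact range_comp_subset_range _ _

lemma exists_tiling {f : Equiv.Perm ℝ} (hf : Reg f) {e : ℝ} (he : e = 1 ∨ e ∈ Mid f) :
    ∀ n : ℕ, ∀ {a : ℝ}, (a = 0 ∨ a ∈ Mid f) → a < e → (Mid f ∩ Ioo a e).ncard = n →
    ∃ L, Tiling a L e ∧ L ≠ [] ∧ L.length ≤ 1 + (Mid f ∩ Ioo a e).ncard ∧
      ∀ u ∈ Nodes, f • u ∈ Nodes → range u ⊆ Ioc a e → ∃ t ∈ L, ∃ γ, IsCell γ ∧ u = t ∘ γ := by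
  intro n
  induction n using Nat.strong_induction_on with
  | _ n ih =>
    intro a ha hae hn
    have hfin : ∀ a, (Mid f ∩ Ioo a e).Finite := fun a => hf.finMid.subset inter_subset_left
    rcases (Mid f ∩ Ioo a e).eq_empty_or_nonempty with hemp | hne
    · obtain ⟨r, hr, hrr⟩ := exists_tile ha he hae fun w hw hw1 => by
        by_contra! hw2
        have : w ∈ Mid f ∩ Ioo a e := ⟨hw, hw1, hw2⟩
        rw [hemp] at this
        exact this
      have hone := (Nodes.affine_of_range hr hrr).2.1
      refine ⟨[r], ⟨hr, by rwa [hone], hone⟩, by simp, by simp, fun u hu _ hsub => ?_⟩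
      exact ⟨r, by simp, Nodes.exists_comp_of_range_subset hu hr (by rwa [hrr])⟩
    · obtain ⟨m, ⟨hmM, hm1, hm2⟩, hmin⟩ := exists_min_image _ id (hfin a) hne
      obtain ⟨r, hr, hrr⟩ := exists_tile ha (Or.inr hmM) hm1 fun w hw hw1 => by
        by_contra! hw2
        exact absurd (hmin w ⟨hw, hw1, hw2.trans hm2⟩) (not_le.2 hw2)
      have hone := (Nodes.affine_of_range hr hrr).2.1
      have hlt : (Mid f ∩ Ioo m e).ncard < (Mid f ∩ Ioo a e).ncard := by
        refine ncard_lt_ncard ⟨fun w hw => ⟨hw.1, hm1.trans hw.2.1, hw.2.2⟩, fun hh => ?_⟩ (hfin a)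
        exact lt_irrefl m (hh ⟨hmM, hm1, hm2⟩).2.1
      obtain ⟨L, hL, hL0, hL1, hL2⟩ := ih _ (hn ▸ hlt) (Or.inr hmM) hm2 rfl
      refine ⟨r :: L, ⟨hr, by rwa [hone], by rwa [hone]⟩, by simp, ?_, fun u hu hfu hsub => ?_⟩
      · rw [List.length_cons]; omega
      · rcases le_or_gt (u UI.one) m with h | h
        · refine ⟨r, by simp, Nodes.exists_comp_of_range_subset hu hr ?_⟩
          rw [hrr]
          rintro _ ⟨s, rfl⟩
          exact ⟨(hsub (mem_range_self s)).1,
            ((Nodes.strictMono hu).monotone (UI.le_one s)).trans h⟩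
        · obtain ⟨t, ht, hcomp⟩ := hL2 u hu hfu (by
            rintro _ ⟨s, rfl⟩
            exact ⟨(near_of_node hu hfu s UI.one).lt_of_mem_Mid hmM h, (hsub (mem_range_self s)).2⟩)
          exact ⟨t, List.mem_cons_of_mem _ ht, hcomp⟩

/-- `u` is obtained from a break of `g` by boundedly many iterations. -/
def Src (f g b : Equiv.Perm ℝ) (S : ℕ) (u : UI → ℝ) : Prop :=
  ∃ j, 1 ≤ j ∧ j ≤ S ∧ (b • f⁻¹ ^ j • u ∈ T g ∨ b • f ^ j • u ∈ T g⁻¹)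

/-- A conjugator from `f` to `g` on the interval `(c, e]`, with control on the nodes that are not
mapped to nodes. -/
structure Piece (f g b : Equiv.Perm ℝ) (c e : ℝ) (S : ℕ) : Prop where
  mono : StrictMono b
  conj : ∀ x, c < x → x ≤ e → b (f x) = g (b x)
  bad : ∃ I J : Set (UI → ℝ), I.Finite ∧ J.Finite ∧
    I.ncard + J.ncard ≤ (Mid f ∩ Ioo c e).ncard + (Mid g ∩ Ioo (b c) (b e)).ncard ∧
    (∀ u ∈ Nodes, u ∉ Pf f → range u ⊆ Ioc c e → b • u ∉ Nodes → u ∈ I ∨ Src f g b S u) ∧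
    (∀ u ∈ Nodes, u ∉ Pf g → range u ⊆ Ioc (b c) (b e) → b⁻¹ • u ∉ Nodes →
      u ∈ J ∨ Src g f b⁻¹ S u)
  spine : e = 1 → ∀ K K' M M', f • spine K = spine K' → g • spine M = spine M' →
    ∃ A A', b • spine A = spine A' ∧ range (spine A) ⊆ Ioc c 1 ∧
      A + A' ≤ max K K' + max M M' + (Mid f).ncard + (Mid g).ncard

lemma spine_pair {b : Equiv.Perm ℝ} (hb : StrictMono b) (b1 : b 1 = 1) {c : ℝ} {k k' : ℕ}
    (h : b • spine k ∈ Nodes) (hk : range (spine k) ⊆ Ioc c 1) (h' : b⁻¹ • spine k' ∈ Nodes)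
    (hk' : range (spine k') ⊆ Ioc (b c) 1) :
    ∃ A A', b • spine A = spine A' ∧ range (spine A) ⊆ Ioc c 1 ∧ A + A' ≤ k + k' := by
  obtain ⟨l, hl⟩ := Nodes.eq_spine h (by rw [perm_smul_apply, spine_one, b1])
  obtain ⟨l', hl'⟩ := Nodes.eq_spine h' (by
    rw [perm_smul_apply, spine_one, Equiv.Perm.inv_eq_iff_eq, b1])
  rw [inv_smul_eq_iff] at hl'
  rcases le_total k l' with hkl | hkl
  · obtain ⟨d, rfl⟩ := Nat.exists_eq_add_of_le hkl
    rw [smul_spine_add hl] at hl'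
    have := spine_inj hl'
    exact ⟨k, l, hl, hk, by omega⟩
  · refine ⟨l', k', hl'.symm, ?_, by omega⟩
    rintro _ ⟨s, rfl⟩
    refine ⟨hb.lt_iff_lt.1 ?_, Nodes.le_one (spine_mem _) s⟩
    have := hk' (mem_range_self s)
    rw [hl'] at this
    exact this.1

lemma range_spine_subset_Ioc {f : Equiv.Perm ℝ} {c : ℝ} (hc : c = 0 ∨ c ∈ Mid f) (hc1 : c < 1)
    {K : ℕ} (hK : f • spine K ∈ Nodes) : range (spine K) ⊆ Ioc c 1 := by
  rintro _ ⟨s, rfl⟩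
  refine ⟨?_, Nodes.le_one (spine_mem K) s⟩
  rcases hc with rfl | hc
  · exact Nodes.pos (spine_mem K) s
  · exact (near_of_node (spine_mem K) hK s UI.one).lt_of_mem_Mid hc (by rwa [spine_one])

lemma smul_mem_of_not_mem_Pf {f : Equiv.Perm ℝ} {u : UI → ℝ} (hu : u ∈ Nodes) (h : u ∉ Pf f) :
    (∀ i : ℕ, f ^ i • u ∈ Nodes) ∨ ∀ i : ℕ, f⁻¹ ^ i • u ∈ Nodes := by
  by_contra! hh
  exact h ⟨hu, hh.1, hh.2⟩

lemma Tiling.exists_spine {f : Equiv.Perm ℝ} {c : ℝ} {L : List (UI → ℝ)} {b : Equiv.Perm ℝ}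
    (hc : c = 0 ∨ c ∈ Mid f) (hc1 : c < 1) (hL : Tiling c L 1)
    (hcov : ∀ u ∈ Nodes, f • u ∈ Nodes → range u ⊆ Ioc c 1 → ∃ t ∈ L, ∃ γ, IsCell γ ∧ u = t ∘ γ)
    (hfin : (Bad L b).Finite) {K : ℕ} (hK : f • spine K ∈ Nodes) :
    ∃ k, K ≤ k ∧ k ≤ K + (Bad L b).ncard ∧ b • spine k ∈ Nodes := by
  obtain ⟨t, ht, γ, hγ, e⟩ := hcov _ (spine_mem K) hK (range_spine_subset_Ioc hc hc1 hK)
  by_contra! hno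
  have hbad : spine '' Icc K (K + (Bad L b).ncard) ⊆ Bad L b := by
    rintro _ ⟨k, ⟨hk1, hk2⟩, rfl⟩
    have h1 : range (spine k) ⊆ range t := (range_spine_subset.2 hk1).trans (by
      rw [e]; exact range_comp_subset_range _ _)
    obtain ⟨δ, hδ, e'⟩ := Nodes.exists_comp_of_range_subset (spine_mem k) (hL.range_subset.2 t ht).1 h1
    exact ⟨t, ht, δ, hδ, e', hno k hk1 hk2⟩
  have := ncard_le_ncard hbad hfin
  rw [InjOn.ncard_image (fun a _ b _ hab => spine_inj hab), ncard_eq_toFinset_card',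
    toFinset_Icc, Nat.card_Icc] at this
  omega

/-- Conjugators on intervals of fixed points. -/
lemma exists_piece_of_fixed {f g : Equiv.Perm ℝ} (hf : Reg f) (hg : Reg g) {c e c' e' : ℝ} (S : ℕ)
    (hc : c = 0 ∨ c ∈ Mid f) (he : e = 1 ∨ e ∈ Mid f) (hce : c < e) (hc' : c' = 0 ∨ c' ∈ Mid g)
    (he' : e' = 1 ∨ e' ∈ Mid g) (hce' : c' < e') (hee : e = 1 → e' = 1)
    (ff : ∀ x, c < x → x ≤ e → f x = x)
    (fg : ∀ x, c' < x → x ≤ e' → g x = x) :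
    ∃ b, Piece f g b c e S ∧ b c = c' ∧ b e = e' := by
  obtain ⟨L, hL, hL0, hLn, hLc⟩ := exists_tiling hf he _ hc hce rfl
  obtain ⟨L', hL', hL0', hLn', hLc'⟩ := exists_tiling hg he' _ hc' hce' rfl
  obtain ⟨b, hb⟩ := exists_match _ rfl hL0 hL0' hL hL'
  have key : ∀ {f : Equiv.Perm ℝ} {c e : ℝ}, (∀ x, c < x → x ≤ e → f x = x) → ∀ {u : UI → ℝ},
      u ∈ Nodes → range u ⊆ Ioc c e → f • u ∈ Nodes := by
    intro f c e ff u hu hs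
    have : f • u = u := funext fun s => ff _ (hs (mem_range_self s)).1 (hs (mem_range_self s)).2
    rwa [this]
  have hcard := hb.card
  refine ⟨b, ⟨hb.mono, fun x h1 h2 => ?_, ⟨Bad L b, Bad L' b⁻¹, hb.fin, hb.fin', ?_, ?_, ?_⟩, ?_⟩,
    hb.left, hb.right⟩
  · rw [ff x h1 h2, fg]
    · rw [← hb.left]; exact hb.mono h1
    · rw [← hb.right]; exact hb.mono.monotone h2
  · rw [hb.left, hb.right]; omega
  · intro u hu _ hs hbu
    obtain ⟨t, ht, γ, hγ, e⟩ := hLc u hu (key ff hu hs) hs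
    exact Or.inl ⟨t, ht, γ, hγ, e, hbu⟩
  · rw [hb.left, hb.right]
    intro u hu _ hs hbu
    obtain ⟨t, ht, γ, hγ, e⟩ := hLc' u hu (key fg hu hs) hs
    exact Or.inl ⟨t, ht, γ, hγ, e, hbu⟩
  · intro e1 K K' M M' hK hM
    have e1' := hee e1
    subst e1 e1'
    have hK1 : f • spine K ∈ Nodes := by rw [hK]; exact spine_mem _
    have hM1 : g • spine M ∈ Nodes := by rw [hM]; exact spine_mem _
    obtain ⟨k, hk, hk', hk''⟩ := hL.exists_spine hc hce hLc hb.fin hK1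
    obtain ⟨m, hm, hm', hm''⟩ := hL'.exists_spine hc' hce' hLc' hb.fin' hM1
    obtain ⟨A, A', h1, h2, h3⟩ := spine_pair hb.mono hb.right hk''
      ((range_spine_subset.2 hk).trans (range_spine_subset_Ioc hc hce hK1)) hm''
      ((range_spine_subset.2 hm).trans (by
        rw [hb.left]; exact range_spine_subset_Ioc hc' hce' hM1))
    have n1 := ncard_le_ncard (s := Mid f ∩ Ioo c 1) inter_subset_left hf.finMid
    have n2 := ncard_le_ncard (s := Mid g ∩ Ioo c' 1) inter_subset_left hg.finMid
    have := le_max_left K K'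
    have := le_max_left M M'
    exact ⟨A, A', h1, h2, by omega⟩

/-- Conjugators on intervals without intervals of fixed points. -/
lemma Comp.piece {f g b : Equiv.Perm ℝ} {c e : ℝ} (h : Comp f g b c e) {S : ℕ}
    (hc : c = 0 ∨ c ∈ Mid f) (hc' : b c = 0 ∨ b c ∈ Mid g)
    (hS : (Mid f).ncard + (Mid g).ncard ≤ S) (hS' : (Mid f⁻¹).ncard + (Mid g⁻¹).ncard ≤ S) :
    Piece f g b c e S := by
  have key : ∀ {f g b : Equiv.Perm ℝ} {c e : ℝ}, Comp f g b c e →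
      (Mid f).ncard + (Mid g).ncard ≤ S → ∀ {u : UI → ℝ}, range u ⊆ Ioc c e →
      (∀ i : ℕ, f⁻¹ ^ i • u ∈ Nodes) → b • u ∉ Nodes → ∃ j, 1 ≤ j ∧ j ≤ S ∧ b • f⁻¹ ^ j • u ∈ T g := by
    intro f g b c e h hS u hs hu hbu
    obtain ⟨w, hw, j, h1, h2, h3⟩ := h.exists_source hs (fun n hn => by
      obtain ⟨m, rfl⟩ := Int.exists_eq_neg_ofNat hn
      have := hu m
      rwa [inv_pow, ← zpow_natCast, ← zpow_neg] at this) hbu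
    refine ⟨j, h1, h2.trans hS, ?_⟩
    rwa [h3, inv_pow, inv_smul_smul, smul_inv_smul]
  have key' : ∀ {f g b : Equiv.Perm ℝ} {c e : ℝ}, Comp f g b c e →
      (Mid f).ncard + (Mid g).ncard ≤ S → (Mid f⁻¹).ncard + (Mid g⁻¹).ncard ≤ S →
      ∀ u ∈ Nodes, u ∉ Pf f → range u ⊆ Ioc c e → b • u ∉ Nodes → Src f g b S u := by
    intro f g b c e h hS hS' u hu hP hs hbu
    rcases smul_mem_of_not_mem_Pf hu hP with H | H
    · obtain ⟨j, h1, h2, h3⟩ := key h.inv hS' hs (by simpa using H) hbu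
      exact ⟨j, h1, h2, Or.inr (by simpa using h3)⟩
    · obtain ⟨j, h1, h2, h3⟩ := key h hS hs H hbu
      exact ⟨j, h1, h2, Or.inl h3⟩
  refine ⟨h.regb.mono, fun x _ _ => h.conj x, ⟨∅, ∅, finite_empty, finite_empty, by simp, ?_, ?_⟩, ?_⟩
  · exact fun u hu hP hs hbu => Or.inr (key' h hS hS' u hu hP hs hbu)
  · exact fun u hu hP hs hbu => Or.inr (key' h.symm (by omega) (by omega) u hu hP hs hbu)
  · rintro rfl K K' M M' hK hM
    have b1 : b 1 = 1 := h.regb.one_le 1 le_rfl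
    have hsym := h.symm
    rw [b1] at hsym
    have hbc : b c < 1 := by rw [← b1]; exact h.regb.mono h.lt
    obtain ⟨A, A', h1, h2, h3⟩ := spine_pair h.regb.mono b1 (h.smul_spine_mem hK)
      ((range_spine_subset.2 (le_max_left K K')).trans
        (range_spine_subset_Ioc hc h.lt (by rw [hK]; exact spine_mem _))) (hsym.smul_spine_mem hM)
      ((range_spine_subset.2 (le_max_left M M')).trans
        (range_spine_subset_Ioc hc' hbc (by rw [hM]; exact spine_mem _)))
    exact ⟨A, A', h1, h2, by omega⟩

lemma range_smul_subset {f : Equiv.Perm ℝ} (hf : StrictMono f) {p q : ℝ} (hp : f p = p)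
    (hq : f q = q) {u : UI → ℝ} (hu : range u ⊆ Ioc p q) : range (f • u) ⊆ Ioc p q := by
  rintro _ ⟨s, rfl⟩
  have := hu (mem_range_self s)
  exact ⟨by rw [← hp]; exact hf this.1, by rw [← hq]; exact hf.monotone this.2⟩

lemma range_pow_smul_subset {f : Equiv.Perm ℝ} (hf : StrictMono f) {p q : ℝ} (hp : f p = p)
    (hq : f q = q) {u : UI → ℝ} (hu : range u ⊆ Ioc p q) (j : ℕ) :
    range (f ^ j • u) ⊆ Ioc p q := by
  induction j with
  | zero => simpa using hu
  | succ j ih => rw [pow_succ', mul_smul]; exact range_smul_subset hf hp hq ih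

lemma Src.congr {f g b b' : Equiv.Perm ℝ} {S : ℕ} {u : UI → ℝ} (h : Src f g b S u)
    (hf : StrictMono f) {p q : ℝ} (hp : f p = p) (hq : f q = q) (hu : range u ⊆ Ioc p q)
    (hb : ∀ x, p < x → x ≤ q → b' x = b x) : Src f g b' S u := by
  obtain ⟨j, h1, h2, h3⟩ := h
  have e1 : b' • f⁻¹ ^ j • u = b • f⁻¹ ^ j • u := smul_congr fun x hx => by
    have := range_pow_smul_subset (strictMono_inv hf) (by rw [Equiv.Perm.inv_eq_iff_eq, hp])
      (by rw [Equiv.Perm.inv_eq_iff_eq, hq]) hu j hx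
    exact hb x this.1 this.2
  have e2 : b' • f ^ j • u = b • f ^ j • u := smul_congr fun x hx => by
    have := range_pow_smul_subset hf hp hq hu j hx
    exact hb x this.1 this.2
  exact ⟨j, h1, h2, by rwa [e1, e2]⟩

lemma ncard_inter_Ioo_add_le {M : Set ℝ} (hM : M.Finite) {p q r : ℝ} (hpq : p ≤ q) (hqr : q ≤ r) :
    (M ∩ Ioo p q).ncard + (M ∩ Ioo q r).ncard ≤ (M ∩ Ioo p r).ncard := by
  rw [← ncard_union_eq _ (hM.subset inter_subset_left) (hM.subset inter_subset_left)]
  · refine ncard_le_ncard ?_ (hM.subset inter_subset_left)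
    rintro m (⟨hm, h1, h2⟩ | ⟨hm, h1, h2⟩)
    · exact ⟨hm, h1, h2.trans_le hqr⟩
    · exact ⟨hm, hpq.trans_lt h1, h2⟩
  · rw [Set.disjoint_left]
    rintro m ⟨-, -, h2⟩ ⟨-, h1, -⟩
    exact lt_asymm h1 h2

/-- No node outside `Pf f` has `p` in its interior. -/
def Cut (f : Equiv.Perm ℝ) (p : ℝ) : Prop :=
  ∀ u ∈ Nodes, u ∉ Pf f → ∀ s s', u s ≤ p → u s' ≤ p

lemma Cut.subset {f : Equiv.Perm ℝ} {p a e : ℝ} (h : Cut f p) {u : UI → ℝ} (hu : u ∈ Nodes)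
    (hP : u ∉ Pf f) (hs : range u ⊆ Ioc a e) : range u ⊆ Ioc a p ∨ range u ⊆ Ioc p e := by
  rcases le_or_gt (u UI.one) p with h1 | h1
  · left
    rintro _ ⟨s, rfl⟩
    exact ⟨(hs (mem_range_self s)).1, h u hu hP _ _ h1⟩
  · right
    rintro _ ⟨s, rfl⟩
    refine ⟨?_, (hs (mem_range_self s)).2⟩
    by_contra! hh
    exact absurd (h u hu hP s UI.one hh) (not_le.2 h1)

/-- Conjugators on adjacent intervals can be glued. -/
lemma Piece.glue {f g b₁ b₂ : Equiv.Perm ℝ} {c m e : ℝ} {S : ℕ} (hf : Reg f) (hg : Reg g)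
    (h₁ : Piece f g b₁ c m S) (h₂ : Piece f g b₂ m e S) (hb : b₁ m = b₂ m) (hcm : c < m)
    (hme : m < e) (fc : f c = c) (fm : f m = m) (fe : f e = e) (gc : g (b₁ c) = b₁ c)
    (hcut : Cut f m) (hcut' : Cut g (b₁ m)) :
    ∃ b, Piece f g b c e S ∧ b c = b₁ c ∧ b e = b₂ e := by
  have gm : g (b₁ m) = b₁ m := by rw [← h₁.conj m hcm le_rfl, fm]
  have ge : g (b₂ e) = b₂ e := by rw [← h₂.conj e hme le_rfl, fe]
  obtain ⟨b, r1, r2, r3, r4, r5⟩ := exists_glue h₁.mono h₂.mono hb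
  have bc : b c = b₁ c := r2 c hcm.le
  have be : b e = b₂ e := r3 e hme.le
  obtain ⟨I, J, i1, i2, i3, i4, i5⟩ := h₁.bad
  obtain ⟨I', J', j1, j2, j3, j4, j5⟩ := h₂.bad
  refine ⟨b, ⟨r1, fun x hx1 hx2 => ?_, ⟨I ∪ I', J ∪ J', i1.union j1, i2.union j2, ?_, ?_, ?_⟩, ?_⟩,
    bc, be⟩
  · rcases le_or_gt x m with hx | hx
    · rw [r2 x hx, r2 _ (by rw [← fm]; exact hf.mono.monotone hx), h₁.conj x hx1 hx]
    · rw [r3 x hx.le, r3 _ (by rw [← fm]; exact hf.mono.monotone hx.le), h₂.conj x hx hx2]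
  · have s1 := ncard_inter_Ioo_add_le hf.finMid hcm.le hme.le
    have s2 := ncard_inter_Ioo_add_le hg.finMid (h₁.mono hcm).le (show b₁ m ≤ b₂ e by
      rw [hb]; exact (h₂.mono hme).le)
    have s3 := ncard_union_le I I'
    have s4 := ncard_union_le J J'
    rw [bc, be]
    rw [← hb] at j3
    omega
  · intro u hu hP hs hbu
    rcases hcut.subset hu hP hs with H | H
    · have e1 : b • u = b₁ • u := smul_congr fun x hx => r2 x (H hx).2
      rw [e1] at hbu
      rcases i4 u hu hP H hbu with h | h
      · exact Or.inl (Or.inl h)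
      · exact Or.inr (h.congr hf.mono fc fm H fun x _ hx => r2 x hx)
    · have e1 : b • u = b₂ • u := smul_congr fun x hx => r3 x (H hx).1.le
      rw [e1] at hbu
      rcases j4 u hu hP H hbu with h | h
      · exact Or.inl (Or.inr h)
      · exact Or.inr (h.congr hf.mono fm fe H fun x hx _ => r3 x hx.le)
  · rw [bc, be]
    intro u hu hP hs hbu
    rcases hcut'.subset hu hP hs with H | H
    · have e1 : b⁻¹ • u = b₁⁻¹ • u := smul_congr fun x hx => r4 x (H hx).2
      rw [e1] at hbu
      rcases i5 u hu hP H hbu with h | h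
      · exact Or.inl (Or.inl h)
      · exact Or.inr (h.congr hg.mono gc gm H fun x _ hx => r4 x hx)
    · have e1 : b⁻¹ • u = b₂⁻¹ • u := smul_congr fun x hx => r5 x (H hx).1
      rw [e1] at hbu
      rcases j5 u hu hP (by rwa [← hb]) hbu with h | h
      · exact Or.inl (Or.inr h)
      · exact Or.inr (h.congr hg.mono gm ge H fun x hx _ => r5 x hx)
  · intro e1 K K' M M' hK hM
    obtain ⟨A, A', h1, h2, h3⟩ := h₂.spine e1 K K' M M' hK hM
    refine ⟨A, A', ?_, h2.trans (Ioc_subset_Ioc_left hcm.le), h3⟩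
    rw [← h1]
    exact smul_congr fun x hx => r3 x (h2 hx).1.le

/-- The open set of points near which `f` is the identity. -/
def LocFix (f : Equiv.Perm ℝ) : Set ℝ := interior {x | f x = x}

lemma fixed_of_mem_LocFix {f : Equiv.Perm ℝ} {x : ℝ} (h : x ∈ LocFix f) : f x = x :=
  show x ∈ {x | f x = x} from interior_subset h

/-- Dyadic fixed points of `f` near which `f` is not the identity. -/
def Bd (f : Equiv.Perm ℝ) : Set ℝ := {c | Dy c ∧ f c = c ∧ c ∉ LocFix f}

lemma Nodes.dy_one {v : UI → ℝ} (hv : v ∈ Nodes) (h : v UI.one ≠ 1) : Dy (v UI.one) := by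
  obtain ⟨k, m, hm, rfl⟩ := hv
  induction k generalizing m with
  | zero =>
    obtain rfl : m = 0 := by simpa using hm
    simp [node] at h
  | succ k ih =>
    rcases Nat.even_or_odd' m with ⟨l, rfl | rfl⟩
    · refine ⟨node k l, node_mem (by rw [pow_succ] at hm; omega), ?_⟩
      simp only [node, UI.one, UI.half]
      push_cast
      rw [pow_succ]
      field_simp
    · have e : node (k + 1) (2 * l + 1) UI.one = node k l UI.one := by
        simp only [node, UI.one]
        push_cast
        field_simp
        ring
      rw [e] at h ⊢
      exact ih l (by rw [pow_succ] at hm; omega) h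

lemma Nodes.interior_subset {u : UI → ℝ} (hu : u ∈ Nodes) {x : ℝ} (hx : x ∈ range u)
    (h : x ≠ u UI.one) : x ∈ interior (range u) := by
  obtain ⟨a, -, -, e, -⟩ := Nodes.range_eq hu
  rw [e] at hx ⊢
  rw [interior_Ioc]
  exact ⟨hx.1, lt_of_le_of_ne hx.2 h⟩

lemma mem_LocFix_of_smul_eq {f : Equiv.Perm ℝ} {u : UI → ℝ} (hu : u ∈ Nodes) (h : f • u = u) {x : ℝ}
    (hx : x ∈ range u) (h1 : x ≠ u UI.one) : x ∈ LocFix f := by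
  refine interior_mono ?_ (Nodes.interior_subset hu hx h1)
  rintro _ ⟨s, rfl⟩
  exact congrFun h s

lemma Nodes.half_ne_one {u : UI → ℝ} (hu : u ∈ Nodes) : u UI.half < u UI.one :=
  Nodes.strictMono hu (show (UI.half : ℝ) < UI.one by norm_num)

lemma Dy.pos {c : ℝ} (h : Dy c) : 0 < c := by
  obtain ⟨u, hu, rfl⟩ := h
  exact Nodes.pos hu _

lemma Dy.lt_one {c : ℝ} (h : Dy c) : c < 1 := by
  obtain ⟨u, hu, rfl⟩ := h
  exact (Nodes.half_ne_one hu).trans_le (Nodes.le_one hu _)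

lemma Bd_subset_Mid (f : Equiv.Perm ℝ) : Bd f ⊆ Mid f := by
  rintro c ⟨⟨u, hu, rfl⟩, h1, h2⟩
  refine ⟨u, ⟨hu, fun h3 => h2 ?_⟩, rfl⟩
  exact mem_LocFix_of_smul_eq hu (Nodes.eq_of_half h3 hu h1) (mem_range_self _)
    (Nodes.half_ne_one hu).ne

lemma LocFix_inv (f : Equiv.Perm ℝ) : LocFix f⁻¹ = LocFix f := by
  unfold LocFix
  congr 1
  ext x
  exact Equiv.Perm.inv_eq_iff_eq.trans eq_comm

lemma Bd_inv (f : Equiv.Perm ℝ) : Bd f⁻¹ = Bd f := by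
  ext x
  simp only [Bd, LocFix_inv, mem_ofPred_eq, Equiv.Perm.inv_eq_iff_eq, eq_comm (a := x) (b := f x)]

lemma cut_of_mem_Bd {f : Equiv.Perm ℝ} {m : ℝ} (h : m ∈ Bd f) : Cut f m := by
  have key : ∀ {f : Equiv.Perm ℝ}, m ∈ Bd f → ∀ u ∈ Nodes, f • u ∈ Nodes → ∀ s s', u s ≤ m →
      u s' ≤ m := by
    intro f h u hu hfu s s' hs
    by_contra! hs'
    exact absurd ((near_of_node hu hfu s s').lt_of_mem_Mid (Bd_subset_Mid f h) hs') (not_lt.2 hs)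
  intro u hu hP
  by_cases h1 : f • u ∈ Nodes
  · exact key h u hu h1
  by_cases h2 : f⁻¹ • u ∈ Nodes
  · exact key (f := f⁻¹) (by rwa [Bd_inv]) u hu h2
  · exact absurd ⟨hu, ⟨1, by simpa using h1⟩, 1, by simpa using h2⟩ hP

lemma Reg.continuous {f : Equiv.Perm ℝ} (hf : Reg f) : Continuous f :=
  hf.mono.monotone.continuous_of_surjective f.surjective

lemma Reg.dy {b : Equiv.Perm ℝ} (hb : Reg b) {c : ℝ} (h : Dy c) : Dy (b c) := by
  have hc0 := h.pos
  have hc1 := h.lt_one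
  obtain ⟨u, hu, rfl⟩ := h
  have hlt := Nodes.half_ne_one hu
  obtain ⟨t, ht, h1, h2, h3⟩ := hb.exists_good hc0 hc1.le (sub_pos.2 hlt)
  have hno : u UI.one ∉ range t := fun hm => absurd (h3 _ hm) (not_lt.2 (le_abs_self _))
  have key : t UI.one = u UI.half := by
    rcases Nodes.comparable ht hu h1 (mem_range_self _) with ⟨γ, hγ, e⟩ | ⟨γ, hγ, e⟩
    · rcases hγ.cases with rfl | ⟨δ, hδ, rfl⟩ | ⟨δ, hδ, rfl⟩
      · exact absurd ⟨UI.one, by rw [e]; rfl⟩ hno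
      · refine le_antisymm (Nodes.le_half hu ⟨δ UI.one, by rw [e]; rfl⟩) ?_
        obtain ⟨s, hs⟩ := h1
        rw [← hs]
        exact (Nodes.strictMono ht).monotone (UI.le_one s)
      · obtain ⟨s, hs⟩ := h1
        exact absurd (Nodes.half_lt hu ⟨δ s, by rw [← hs, e]; rfl⟩) (lt_irrefl _)
    · exact absurd ⟨γ UI.one, by rw [e]; rfl⟩ hno
  have := Nodes.dy_one h2 (by rw [perm_smul_apply, key]; exact (hb.lt_one hc1).ne)
  rwa [perm_smul_apply, key] at this

lemma Reg.mem_LocFix {f g b : Equiv.Perm ℝ} (hb : Reg b) (hc : ∀ x, b (f x) = g (b x)) {x : ℝ} :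
    b x ∈ LocFix g ↔ x ∈ LocFix f := by
  constructor
  · intro h
    have := preimage_interior_subset_interior_preimage hb.continuous h
    refine interior_mono ?_ this
    intro y hy
    exact (conj_fixed_iff hc).1 hy
  · intro h
    have := preimage_interior_subset_interior_preimage hb.inv.continuous
      (show (b⁻¹ : Equiv.Perm ℝ) (b x) ∈ interior {x | f x = x} by simpa [LocFix] using h)
    refine interior_mono ?_ this
    intro y hy
    have := (conj_fixed_iff hc).2 hy
    simpa using this

lemma Reg.mem_Bd {f g b : Equiv.Perm ℝ} (hb : Reg b) (hc : ∀ x, b (f x) = g (b x)) {x : ℝ}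
    (h : x ∈ Bd f) : b x ∈ Bd g :=
  ⟨hb.dy h.1, (conj_fixed_iff hc).2 h.2.1, fun hL => h.2.2 ((hb.mem_LocFix hc).1 hL)⟩

/-- Between consecutive points of `Bd f`, either `f` is the identity or it is nowhere locally so. -/
lemma Reg.locFix_dichotomy {f : Equiv.Perm ℝ} (hf : Reg f) {c e : ℝ} (hc : 0 ≤ c) (he : e ≤ 1)
    (h : ∀ x, c < x → x < e → x ∉ Bd f) :
    (∀ x, c < x → x < e → f x = x) ∨ ∀ x, c < x → x < e → x ∉ LocFix f := by
  by_cases hne : (Ioo c e ∩ LocFix f).Nonempty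
  · left
    have : Ioo c e ⊆ LocFix f := by
      refine isPreconnected_Ioo.subset_of_closure_inter_subset isOpen_interior hne ?_
      rintro p ⟨hp, h1, h2⟩
      by_contra hpL
      by_cases hD : Dy p
      · refine h p h1 h2 ⟨hD, ?_, hpL⟩
        have hcl : IsClosed {x | f x = x} := isClosed_eq hf.continuous continuous_id
        exact hcl.closure_subset_iff.2 interior_subset hp
      · obtain ⟨t, ht, hpt, hft, -⟩ :=
          hf.exists_good (hc.trans_lt h1) (h2.le.trans he) one_pos
        have hp1 : p ≠ t UI.one := by
          rintro rfl
          exact hD (Nodes.dy_one ht (h2.trans_le he).ne)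
        obtain ⟨q, hq1, hq2⟩ := mem_closure_iff.1 hp _ isOpen_interior
          (Nodes.interior_subset ht hpt hp1)
        have hop : IsOpen (interior (range t) ∩ LocFix f) := isOpen_interior.inter isOpen_interior
        obtain ⟨r, hr, r', hr', hne⟩ := (infinite_of_mem_nhds q (hop.mem_nhds ⟨hq1, hq2⟩)).nontrivial
        exact hpL (mem_LocFix_of_smul_eq ht (Nodes.fixed_of_two ht hft (interior_subset hr.1)
          (interior_subset hr'.1) hne (fixed_of_mem_LocFix hr.2) (fixed_of_mem_LocFix hr'.2)) hpt hp1)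
    exact fun x h1 h2 => fixed_of_mem_LocFix (this ⟨h1, h2⟩)
  · right
    exact fun x h1 h2 h3 => hne ⟨x, ⟨h1, h2⟩, h3⟩

/-- After composing with a power of `g`, the reference orbits have equal thresholds. -/
lemma exists_comp {f g b : Equiv.Perm ℝ} (hf : Reg f) (hg : Reg g) (hb : Reg b)
    (hconj : ∀ x, b (f x) = g (b x)) {c e : ℝ} (hc : 0 ≤ c) (hce : c < e) (he : e ≤ 1)
    (fc : f c = c) (fe : f e = e) (h : ∀ x, c < x → x < e → x ∉ Bd f)
    (hL : ∀ x, c < x → x < e → x ∉ LocFix f) :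
    ∃ b', Comp f g b' c e ∧ b' c = b c ∧ b' e = b e := by
  have active : ∀ x y, c < x → x < y → y ≤ e → ∃ w, x < w ∧ w < y ∧ f w ≠ w := by
    intro x y hx hxy hy
    by_contra! hh
    obtain ⟨p, hp1, hp2⟩ := exists_between hxy
    refine hL p (hx.trans hp1) (hp2.trans_le hy) ?_
    exact mem_interior.2 ⟨Ioo x y, fun w hw => hh w hw.1 hw.2, isOpen_Ioo, hp1, hp2⟩
  have dy : ∀ z, c < z → z < e → f z = z → ¬ Dy z := fun z h1 h2 h3 h4 =>
    h z h1 h2 ⟨h4, h3, hL z h1 h2⟩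
  obtain ⟨z, hz, hmax⟩ : ∃ z ∈ insert c {x | c < x ∧ x < e ∧ f x = x},
      ∀ w ∈ insert c {x | c < x ∧ x < e ∧ f x = x}, w ≤ z :=
    exists_max_image _ id (((fixed_finite hf hc he active).subset
      fun x hx => ⟨hx.1, hx.2.1.le, hx.2.2⟩).insert c) ⟨c, mem_insert _ _⟩
  have hcz : c ≤ z := hmax c (mem_insert _ _)
  have hze : z < e ∧ f z = z := by
    rcases hz with rfl | hz
    · exact ⟨hce, fc⟩
    · exact hz.2
  have hB : Bump f z e := ⟨hc.trans hcz, hze.1, he, hze.2, fe, fun w h1 h2 h3 =>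
    absurd (hmax w (Or.inr ⟨hcz.trans_lt h1, h2, h3⟩)) (not_le.2 h1)⟩
  obtain ⟨x, hx1, hx2⟩ := exists_between hze.1
  obtain ⟨y, hy, -⟩ := hB.exists_incOrb hf hx1 hx2
  obtain ⟨-, p, -, -, -, hp, -⟩ := hy.window hf hB
  obtain ⟨-, q, -, -, -, hq, -⟩ := (hy.conj hb hconj).window hg (hB.conj hb hconj)
  obtain ⟨κ, hκ⟩ : ∃ κ : ℤ, ∀ k, (g ^ κ) (b (y k)) = b (y (k + (q - p))) := by
    have step : ∀ {f : Equiv.Perm ℝ} {y : ℤ → ℝ}, (∀ k, y (k + 1) = f (y k)) → ∀ d k : ℤ,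
        (f ^ d) (y k) = y (k + d) := by
      intro f y hy d
      induction d with
      | zero => simp
      | succ i ih =>
        intro k
        rw [zpow_succ_apply, ih, ← hy, add_assoc]
      | pred i ih =>
        intro k
        apply f.injective
        rw [← zpow_succ_apply, sub_add_cancel, ih, ← hy]
        congr 1
        ring
    rcases hy.orb.conj hconj with ho | ho
    · exact ⟨q - p, fun k => step (y := fun k => b (y k)) ho _ k⟩
    · refine ⟨-(q - p), fun k => ?_⟩
      rw [← inv_zpow']
      refine step (y := fun k => b (y k)) (fun k => ?_) _ k
      rw [Equiv.Perm.eq_inv_iff_eq]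
      exact (ho k).symm
  have gfix : ∀ {x}, f x = x → (g ^ κ * b) x = b x := fun {x} hx =>
    Function.IsFixedPt.perm_zpow (show Function.IsFixedPt g (b x) from (conj_fixed_iff hconj).2 hx) κ
  have hb' : Reg (g ^ κ * b) := (hg.zpow κ).mul hb
  have hconj' : ∀ x, (g ^ κ * b) (f x) = g ((g ^ κ * b) x) := by
    intro x
    rw [Equiv.Perm.mul_apply, Equiv.Perm.mul_apply, hconj, ← zpow_succ_apply, zpow_add_apply, zpow_one]
  refine ⟨g ^ κ * b, ⟨hf, hg, hb', hconj', hc, hce, he, fc, fe, active,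
    fun z h1 h2 h3 => ⟨dy z h1 h2 h3, fun h4 => dy z h1 h2 h3 (by simpa using hb'.inv.dy h4)⟩,
    z, y, p, hB, hy, hp, fun k => ?_⟩,
    gfix fc, gfix fe⟩
  rw [gfix fe]
  change Near g ((g ^ κ) (b (y k))) (b e) ↔ p ≤ k
  rw [hκ, hq]
  omega

/-- Conjugators exist on the interval between consecutive points of `Bd f ∪ {0, 1}`. -/
lemma exists_piece {f g b : Equiv.Perm ℝ} (hf : Reg f) (hg : Reg g) (hb : Reg b)
    (hconj : ∀ x, b (f x) = g (b x)) {S : ℕ} (hS : (Mid f).ncard + (Mid g).ncard ≤ S)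
    (hS' : (Mid f⁻¹).ncard + (Mid g⁻¹).ncard ≤ S) {c e : ℝ} (hc : c = 0 ∨ c ∈ Bd f)
    (he : e = 1 ∨ e ∈ Bd f) (hce : c < e) (h : ∀ x, c < x → x < e → x ∉ Bd f) :
    ∃ b', Piece f g b' c e S ∧ b' c = b c ∧ b' e = b e := by
  have b0 : b 0 = 0 := hb.nonpos 0 le_rfl
  have b1 : b 1 = 1 := hb.one_le 1 le_rfl
  have hc0 : 0 ≤ c := hc.elim (fun h => h.ge) fun h => h.1.pos.le
  have he1 : e ≤ 1 := he.elim (fun h => h.le) fun h => h.1.lt_one.le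
  have fc : f c = c := hc.elim (fun h => hf.nonpos c h.le) fun h => h.2.1
  have fe : f e = e := he.elim (fun h => hf.one_le e h.ge) fun h => h.2.1
  have mc : c = 0 ∨ c ∈ Mid f := hc.imp_right fun h => Bd_subset_Mid f h
  have mc' : b c = 0 ∨ b c ∈ Mid g :=
    hc.imp (fun h => by rw [h, b0]) fun h => Bd_subset_Mid g (hb.mem_Bd hconj h)
  rcases hf.locFix_dichotomy hc0 he1 h with hid | hact
  · have hid' : ∀ x, c < x → x ≤ e → f x = x := fun x h1 h2 => by
      rcases h2.eq_or_lt with rfl | h2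
      · exact fe
      · exact hid x h1 h2
    refine exists_piece_of_fixed hf hg S mc (he.imp_right fun h => Bd_subset_Mid f h) hce mc'
      (he.imp (fun h => by rw [h, b1]) fun h => Bd_subset_Mid g (hb.mem_Bd hconj h)) (hb.mono hce)
      (fun h => by rw [h, b1]) hid' fun x h1 h2 => ?_
    have := (conj_fixed_iff hconj).2 (hid' (b⁻¹ x) (hb.lt_inv.2 h1) (by
      rw [← hb.mono.le_iff_le]; simpa using h2))
    simpa using this
  · obtain ⟨b', h1, h2, h3⟩ := exists_comp hf hg hb hconj hc0 hce he1 fc fe h hact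
    exact ⟨b', h1.piece mc (by rwa [h2]) hS hS', h2, h3⟩

lemma exists_piece_zero {f g b : Equiv.Perm ℝ} (hf : Reg f) (hg : Reg g) (hb : Reg b)
    (hconj : ∀ x, b (f x) = g (b x)) {S : ℕ} (hS : (Mid f).ncard + (Mid g).ncard ≤ S)
    (hS' : (Mid f⁻¹).ncard + (Mid g⁻¹).ncard ≤ S) (N : ℕ) :
    ∀ {e : ℝ}, e = 1 ∨ e ∈ Bd f → (Bd f ∩ Iio e).ncard = N →
    ∃ b', Piece f g b' 0 e S ∧ b' 0 = 0 ∧ b' e = b e := by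
  have b0 : b 0 = 0 := hb.nonpos 0 le_rfl
  have hfin : (Bd f).Finite := hf.finMid.subset (Bd_subset_Mid f)
  induction N using Nat.strong_induction_on with
  | _ N ih =>
  intro e he hN
  have he0 : 0 < e := he.elim (fun h => by rw [h]; exact one_pos) fun h => h.1.pos
  rcases (Bd f ∩ Iio e).eq_empty_or_nonempty with hemp | hne
  · obtain ⟨b', h1, h2, h3⟩ := exists_piece hf hg hb hconj hS hS' (Or.inl rfl) he he0
      fun x _ h2 h3 => (hemp ▸ (⟨h3, h2⟩ : x ∈ Bd f ∩ Iio e) : x ∈ (∅ : Set ℝ))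
    exact ⟨b', h1, h2.trans b0, h3⟩
  · obtain ⟨m, ⟨hm, hme⟩, hmax⟩ := exists_max_image _ id (hfin.subset inter_subset_left) hne
    have hlt : (Bd f ∩ Iio m).ncard < N := by
      rw [← hN]
      refine ncard_lt_ncard ⟨inter_subset_inter_right _ (Iio_subset_Iio (le_of_lt hme)), fun hh => ?_⟩
        (hfin.subset inter_subset_left)
      exact lt_irrefl m (hh ⟨hm, hme⟩).2
    obtain ⟨b₁, p1, p2, p3⟩ := ih _ hlt (Or.inr hm) rfl
    obtain ⟨b₂, q1, q2, q3⟩ := exists_piece hf hg hb hconj hS hS' (Or.inr hm) he hme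
      fun x h1 h2 h3 => absurd (hmax x ⟨h3, h2⟩) (not_le.2 h1)
    have fe : f e = e := he.elim (fun h => hf.one_le e h.ge) fun h => h.2.1
    obtain ⟨b', r1, r2, r3⟩ := p1.glue hf hg q1 (p3.trans q2.symm) hm.1.pos hme (hf.nonpos 0 le_rfl)
      hm.2.1 fe (by rw [p2]; exact hg.nonpos 0 le_rfl) (cut_of_mem_Bd hm)
      (by rw [p3]; exact cut_of_mem_Bd (hb.mem_Bd hconj hm))
    exact ⟨b', r1, r2.trans p2, r3.trans q3⟩

lemma Nodes.range_subset_unit {u : UI → ℝ} (hu : u ∈ Nodes) : range u ⊆ Ioc 0 1 := by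
  rintro _ ⟨s, rfl⟩
  exact ⟨Nodes.pos hu s, Nodes.le_one hu s⟩

lemma Ns.one_lt {u : UI → ℝ} (hu : u ∈ Ns) : u UI.one < 1 :=
  lt_of_le_of_ne (Nodes.le_one hu.1 _) hu.2

lemma src_ncard {f g h : Equiv.Perm ℝ} {n S : ℕ} (hf : Reg f) (hh : ∀ x < 1, h x < 1)
    (hg : Complexity g n) :
    {u | u ∈ Ns ∧ Src f g h S u}.Finite ∧ {u | u ∈ Ns ∧ Src f g h S u}.ncard ≤ S * n := by
  set V : ℕ → Set (UI → ℝ) := fun j =>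
    (fun w : UI → ℝ => f ^ j • h⁻¹ • w) '' D g ∪ (fun w : UI → ℝ => f⁻¹ ^ j • h⁻¹ • w) '' D g⁻¹
    with hV
  have hVfin : ∀ j, (V j).Finite := fun j => (hg.finD.image _).union (hg.finE.image _)
  have hVcard : ∀ j, (V j).ncard ≤ n := fun j => (ncard_union_le _ _).trans
    ((add_le_add (ncard_image_le hg.finD) (ncard_image_le hg.finE)).trans hg.sum_le)
  have hmem : ∀ {g w : _}, w ∈ T g → w UI.one < 1 → w ∈ D g := fun h1 h2 =>
    ⟨⟨h1.1, h2.ne⟩, fun h3 => h1.2 h3.1⟩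
  have hsub : {u | u ∈ Ns ∧ Src f g h S u} ⊆ ⋃ j ∈ Finset.Icc 1 S, V j := by
    rintro u ⟨hu, j, h1, h2, h3⟩
    have hu1 := Ns.one_lt hu
    refine mem_iUnion₂.2 ⟨j, Finset.mem_Icc.2 ⟨h1, h2⟩, h3.imp (fun h3 => ?_) fun h3 => ?_⟩
    · exact ⟨_, hmem h3 (hh _ ((hf.inv.pow j).lt_one hu1)), by
        simp only [inv_smul_smul, inv_pow, smul_inv_smul]⟩
    · exact ⟨_, hmem h3 (hh _ ((hf.pow j).lt_one hu1)), by
        simp only [inv_smul_smul, inv_pow]⟩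
  have hfin : (⋃ j ∈ Finset.Icc 1 S, V j).Finite :=
    (Finset.Icc 1 S).finite_toSet.biUnion fun j _ => hVfin j
  refine ⟨hfin.subset hsub, (ncard_le_ncard hsub hfin).trans ?_⟩
  refine (Finset.set_ncard_biUnion_le _ _).trans
    ((Finset.sum_le_card_nsmul _ _ n fun j _ => hVcard j).trans ?_)
  simp

lemma D_ncard_le {f g h : Equiv.Perm ℝ} {p q S : ℕ} (hf : Reg f) (cf : Complexity f p)
    (cg : Complexity g q) (hh : ∀ x < 1, h x < 1) {I : Set (UI → ℝ)} (hI : I.Finite)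
    (hbad : ∀ u ∈ Nodes, u ∉ Pf f → h • u ∉ Nodes → u ∈ I ∨ Src f g h S u) :
    (D h).Finite ∧ 2 * (D h).ncard ≤ (p + 3) * p + 2 * I.ncard + 2 * (S * q) := by
  obtain ⟨s1, s2⟩ := src_ncard (S := S) hf hh cg
  have hP : (Pf f ∩ Ns).Finite := Pf_finite hf cf
  have hsub : D h ⊆ (Pf f ∩ Ns) ∪ I ∪ {u | u ∈ Ns ∧ Src f g h S u} := by
    rintro u ⟨hu, hhu⟩
    by_cases hP : u ∈ Pf f
    · exact Or.inl (Or.inl ⟨hP, hu⟩)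
    · have : h • u ∉ Nodes := fun hn => hhu ⟨hn, (hh _ (Ns.one_lt hu)).ne⟩
      rcases hbad u hu.1 hP this with h1 | h1
      · exact Or.inl (Or.inr h1)
      · exact Or.inr ⟨hu, h1⟩
  have hfin := (hP.union hI).union s1
  refine ⟨hfin.subset hsub, ?_⟩
  have e1 := ncard_le_ncard hsub hfin
  have e2 := ncard_union_le (Pf f ∩ Ns ∪ I) {u | u ∈ Ns ∧ Src f g h S u}
  have e3 := ncard_union_le (Pf f ∩ Ns) I
  have e4 := Pf_ncard hf cf
  omega

/-- Truncating a map fixing `0` and `1` to the unit interval. -/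
lemma exists_truncation {b : Equiv.Perm ℝ} (hb : StrictMono b) (b0 : b 0 = 0) (b1 : b 1 = 1) :
    ∃ h : Equiv.Perm ℝ, StrictMono h ∧ (∀ x ≤ 0, h x = x) ∧ (∀ x, 1 ≤ x → h x = x) ∧
      (∀ x, 0 < x → x ≤ 1 → h x = b x) ∧ ∀ x, 0 < x → x ≤ 1 → h⁻¹ x = b⁻¹ x := by
  obtain ⟨k, k1, k2, k3, -, -⟩ := exists_glue (p := 0) (a := 1) strictMono_id hb (by simp [b0])
  obtain ⟨h, h1, h2, h3, -, -⟩ := exists_glue (p := 1) (b := 1) k1 strictMono_id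
    (by rw [k3 1 zero_le_one, b1]; rfl)
  have hb' : ∀ x, 0 < x → x ≤ 1 → h x = b x := fun x hx hx' => by rw [h2 x hx', k3 x hx.le]
  refine ⟨h, h1, fun x hx => by rw [h2 x (hx.trans zero_le_one), k2 x hx]; rfl,
    fun x hx => by rw [h3 x hx]; rfl, hb', fun x hx hx' => ?_⟩
  rw [Equiv.Perm.inv_eq_iff_eq, hb']
  · simp
  · rw [← hb.lt_iff_lt, b0]; simpa
  · rw [← hb.le_iff_le, b1]; simpa

/-- Conjugate elements of Thompson's group have a conjugator of quadratic length. -/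
theorem exists_short_conjugator {f g b : Equiv.Perm ℝ} (hf : f ∈ ThompsonF) (hg : g ∈ ThompsonF)
    (hb : b ∈ ThompsonF) (hconj : ∀ x, b (f x) = g (b x)) :
    ∃ h ∈ ThompsonF, (∀ x, h (f x) = g (h x)) ∧
      wordLength h ≤
        3 * (wordLength f + wordLength g) ^ 2 + 15 * (wordLength f + wordLength g) + 16 := by
  have cf := Complexity.of_mem hf
  have cg := Complexity.of_mem hg
  replace hf := Reg.of_mem hf
  replace hg := Reg.of_mem hg
  replace hb := Reg.of_mem hb
  set p := wordLength f
  set q := wordLength g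
  have mf := cf.Mid_ncard
  have mg := cg.Mid_ncard
  have mf' := cf.inv.Mid_ncard
  have mg' := cg.inv.Mid_ncard
  obtain ⟨b', hP, b0, b1⟩ := exists_piece_zero hf hg hb hconj (S := p + q + 4) (by omega) (by omega) _
    (Or.inl rfl) rfl
  rw [hb.one_le 1 le_rfl] at b1
  obtain ⟨h, h1, h2, h3, h4, h5⟩ := exists_truncation hP.mono b0 b1
  have hconj' : ∀ x, h (f x) = g (h x) := by
    intro x
    rcases le_or_gt x 0 with hx | hx
    · rw [hf.nonpos x hx, h2 x hx, hg.nonpos x hx]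
    rcases le_or_gt x 1 with hx' | hx'
    · rw [h4 x hx hx', h4 _ (hf.pos hx) (hf.le_one hx'), hP.conj x hx hx']
    · rw [hf.one_le x hx'.le, h3 x hx'.le, hg.one_le x hx'.le]
  have hlt : ∀ x < 1, h x < 1 := fun x hx => by
    have := h1 hx
    rwa [h3 1 le_rfl] at this
  have hlt' : ∀ x < 1, h⁻¹ x < 1 := fun x hx => by
    rw [← h1.lt_iff_lt, h3 1 le_rfl]; simpa
  have n0 : ∀ {f : Equiv.Perm ℝ}, Reg f → f 0 = 0 := fun hf => hf.nonpos 0 le_rfl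
  have n1 : ∀ {f : Equiv.Perm ℝ}, Reg f → f 1 = 1 := fun hf => hf.one_le 1 le_rfl
  have e1 : ∀ {u}, u ∈ Nodes → h • u = b' • u := fun hu =>
    smul_congr fun x hx => h4 x (Nodes.range_subset_unit hu hx).1 (Nodes.range_subset_unit hu hx).2
  have e2 : ∀ {u}, u ∈ Nodes → h⁻¹ • u = b'⁻¹ • u := fun hu =>
    smul_congr fun x hx => h5 x (Nodes.range_subset_unit hu hx).1 (Nodes.range_subset_unit hu hx).2
  obtain ⟨I, J, i1, i2, i3, i4, i5⟩ := hP.bad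
  rw [b0, b1] at i3 i5
  obtain ⟨d1, d2⟩ := D_ncard_le hf cf cg hlt i1 fun u hu hPu hhu =>
    (i4 u hu hPu (Nodes.range_subset_unit hu) (by rwa [← e1 hu])).imp_right fun h =>
      h.congr hf.mono (n0 hf) (n1 hf) (Nodes.range_subset_unit hu) h4
  obtain ⟨d3, d4⟩ := D_ncard_le hg cg cf hlt' i2 fun u hu hPu hhu =>
    (i5 u hu hPu (Nodes.range_subset_unit hu) (by rwa [← e2 hu])).imp_right fun h =>
      h.congr hg.mono (n0 hg) (n1 hg) (Nodes.range_subset_unit hu) h5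
  obtain ⟨K, K', k1, -, -, k2, k3⟩ := cf.spine
  obtain ⟨M, M', l1, -, -, l2, l3⟩ := cg.spine
  obtain ⟨A, A', a1, -, a2⟩ := hP.spine rfl K K' M M' k1 l1
  obtain ⟨w1, w2⟩ := mem_and_wordLength_le h1 h2 h3 d1 d3 (K := A) (K' := A')
    (by rw [e1 (spine_mem A), a1])
  refine ⟨h, w1, hconj', ?_⟩
  have m1 : (Mid f ∩ Ioo 0 1).ncard ≤ (Mid f).ncard := ncard_le_ncard inter_subset_left hf.finMid
  have m2 : (Mid g ∩ Ioo 0 1).ncard ≤ (Mid g).ncard := ncard_le_ncard inter_subset_left hg.finMid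
  have a3 : A + A' ≤ 2 * (p + q) + 8 := by omega
  nlinarith [mul_nonneg p.zero_le q.zero_le]

lemma conj_iff {f g h : Equiv.Perm ℝ} : h⁻¹ * f * h = g ↔ ∀ x, h (g x) = f (h x) := by
  rw [mul_assoc, inv_mul_eq_iff_eq_mul, Equiv.ext_iff]
  exact forall_congr' fun x => eq_comm

theorem clf_quadratic_upper_bound (n : ℕ) :
    (∀ f g : Equiv.Perm ℝ, f ∈ ThompsonF → g ∈ ThompsonF →
      (∃ h ∈ ThompsonF, h⁻¹ * f * h = g) → wordLength f + wordLength g ≤ n →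
      ∃ h ∈ ThompsonF, h⁻¹ * f * h = g ∧
        (wordLength h : ℝ) ≤ 7 / 2 * (n : ℝ) ^ 2 + 15 * (n : ℝ) + 20) ∧
    (CLF n : ℝ) ≤ 7 / 2 * (n : ℝ) ^ 2 + 15 * (n : ℝ) + 20 := by
  have key : ∀ f g : Equiv.Perm ℝ, f ∈ ThompsonF → g ∈ ThompsonF →
      (∃ h ∈ ThompsonF, h⁻¹ * f * h = g) → wordLength f + wordLength g ≤ n →
      ∃ h ∈ ThompsonF, h⁻¹ * f * h = g ∧ wordLength h ≤ 3 * n ^ 2 + 15 * n + 16 := by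
    rintro f g hf hg ⟨b, hb, hbc⟩ hn
    obtain ⟨h, h1, h2, h3⟩ := exists_short_conjugator hg hf hb (conj_iff.1 hbc)
    refine ⟨h, h1, conj_iff.2 h2, h3.trans ?_⟩
    rw [add_comm] at hn
    gcongr
  have bound : ∀ m : ℕ, m ≤ 3 * n ^ 2 + 15 * n + 16 →
      (m : ℝ) ≤ 7 / 2 * (n : ℝ) ^ 2 + 15 * (n : ℝ) + 20 := by
    intro m hm
    have : (m : ℝ) ≤ 3 * (n : ℝ) ^ 2 + 15 * n + 16 := by exact_mod_cast hm
    nlinarith [sq_nonneg (n : ℝ)]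
  refine ⟨fun f g hf hg hh hn => ?_, bound _ ?_⟩
  · obtain ⟨h, h1, h2, h3⟩ := key f g hf hg hh hn
    exact ⟨h, h1, h2, bound _ h3⟩
  · refine csSup_le' ?_
    rintro m ⟨f, g, hf, hg, hh, hn, rfl⟩
    obtain ⟨h, h1, h2, h3⟩ := key f g hf hg hh hn
    have : conjDist f g ≤ wordLength h := Nat.sInf_le ⟨h, h1, h2, rfl⟩
    exact this.trans h3

end
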